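/- arXiv:1806.04980 — 2 statements merged into one kernel-verified Lean document; each statement's English description precedes it below -/
import Mathlib

section
/- Let d ≥ 2 and n ≥ 1, and let f_c(x) = x^d + c, viewed over the polynomial ring ℂ[x, c] with c an indeterminate. Let Φ_n(x, c) be the n-th dynatomic polynomial of f_c, i.e., the polynomial in ℂ[x, c] satisfying Φ_n(x,c) · ∏_{m ∣ n, μ(n/m) = −1} (f_c^m(x) − x) = ∏_{m ∣ n, μ(n/m) = 1} (f_c^m(x) − x), where f_c^m denotes the m-th compositional iterate. Then Φ_n(x, c) is irreducible in ℂ[x, c]. -/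
open MvPolynomial

/-- The m-th iterate f_c^m(x) of f_c(x) = x^d + c, as an element of ℂ[x, c], where
x is the variable `X 0` and c is the indeterminate `X 1`. -/
noncomputable def fcIter (d : ℕ) : ℕ → MvPolynomial (Fin 2) ℂ
  | 0 => X 0
  | m + 1 => (fcIter d m) ^ d + X 1

section Transfer

/-- The sum of the `j`-th powers of the `d`-th roots `ζ ^ k * w` of `w ^ d`. -/
lemma sum_rootsOfPow_pow {d : ℕ} {ζ : ℂ} (hζ : IsPrimitiveRoot ζ d) (w : ℂ) (j : ℕ) :
    ∑ k ∈ Finset.range d, (ζ ^ k * w) ^ j = if d ∣ j then d * w ^ j else 0 := by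
  have h1 : ∀ k, (ζ ^ k * w) ^ j = (ζ ^ j) ^ k * w ^ j := fun k => by
    rw [mul_pow, ← pow_mul, ← pow_mul, mul_comm k j]
  simp_rw [h1, ← Finset.sum_mul]
  split_ifs with h
  · rw [(hζ.pow_eq_one_iff_dvd j).2 h]; simp
  · have h2 : ζ ^ j ≠ 1 := fun h' => h ((hζ.pow_eq_one_iff_dvd j).1 h')
    have h3 := mul_geom_sum (ζ ^ j) d
    rw [← pow_mul, mul_comm j d, pow_mul, hζ.pow_eq_one, one_pow, sub_self] at h3
    rw [(mul_eq_zero.1 h3).resolve_left (sub_ne_zero.2 h2), zero_mul]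

lemma sum_sq_div_sub {d : ℕ} (hd : 2 ≤ d) {ζ : ℂ} (hζ : IsPrimitiveRoot ζ d) {w a : ℂ}
    (h : w ^ d ≠ a ^ d) :
    ∑ k ∈ Finset.range d, (ζ ^ k * w) ^ 2 / (ζ ^ k * w - a)
      = d * a * w ^ d / (w ^ d - a ^ d) := by
  have hu : w ^ d - a ^ d ≠ 0 := sub_ne_zero.2 h
  have hpow : ∀ k, (ζ ^ k * w) ^ d = w ^ d := fun k => by
    rw [mul_pow, ← pow_mul, mul_comm k d, pow_mul, hζ.pow_eq_one, one_pow, one_mul]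
  have h1 : ∀ k, (ζ ^ k * w) ^ 2 / (ζ ^ k * w - a) =
      ∑ j ∈ Finset.range d, (ζ ^ k * w) ^ (j + 2) * a ^ (d - 1 - j) / (w ^ d - a ^ d) := fun k => by
    have h2 : ζ ^ k * w - a ≠ 0 := by
      intro h3
      apply h
      rw [← hpow k, sub_eq_zero.1 h3]
    rw [← Finset.sum_div, div_eq_div_iff h2 hu, ← hpow k, ← geom_sum₂_mul (ζ ^ k * w) a d,
      ← mul_assoc, Finset.mul_sum]
    congr 1
    exact Finset.sum_congr rfl fun j _ => by ring
  simp_rw [h1]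
  rw [Finset.sum_comm]
  simp_rw [← Finset.sum_div, ← Finset.sum_mul, sum_rootsOfPow_pow hζ]
  congr 1
  rw [Finset.sum_eq_single (d - 2)]
  · have e1 : d - 2 + 2 = d := by omega
    have e2 : d - 1 - (d - 2) = 1 := by omega
    rw [e1, e2]; simp; ring
  · intro j hj hj'
    rw [Finset.mem_range] at hj
    rw [if_neg, zero_mul]
    rintro ⟨q, hq⟩
    have : q = 1 := by
      have h1 : q < 2 := by
        by_contra hc
        have : d * 2 ≤ d * q := Nat.mul_le_mul_left d (not_lt.1 hc)
        omega
      have h0 : q ≠ 0 := by rintro rfl; omega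
      omega
    subst this
    omega
  · intro h'
    exact absurd (Finset.mem_range.2 (by omega)) h'

lemma sum_sq_div_sub_sq {d : ℕ} (hd : 2 ≤ d) {ζ : ℂ} (hζ : IsPrimitiveRoot ζ d) {w a : ℂ}
    (h : w ^ d ≠ a ^ d) :
    ∑ k ∈ Finset.range d, (ζ ^ k * w) ^ 2 / (ζ ^ k * w - a) ^ 2
      = d * w ^ d * (w ^ d + (d - 1) * a ^ d) / (w ^ d - a ^ d) ^ 2 := by
  have hu : w ^ d - a ^ d ≠ 0 := sub_ne_zero.2 h
  have hpow : ∀ k, (ζ ^ k * w) ^ d = w ^ d := fun k => by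
    rw [mul_pow, ← pow_mul, mul_comm k d, pow_mul, hζ.pow_eq_one, one_pow, one_mul]
  have hne : ∀ k, ζ ^ k * w - a ≠ 0 := fun k h3 => by
    apply h
    rw [← hpow k, sub_eq_zero.1 h3]
  have hL : HasDerivAt (fun b => ∑ k ∈ Finset.range d, (ζ ^ k * w) ^ 2 / (ζ ^ k * w - b))
      (∑ k ∈ Finset.range d, (ζ ^ k * w) ^ 2 / (ζ ^ k * w - a) ^ 2) a := by
    refine HasDerivAt.fun_sum fun k _ => ?_
    have := (hasDerivAt_const a ((ζ ^ k * w) ^ 2)).fun_div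
      ((hasDerivAt_id' a).const_sub (ζ ^ k * w)) (hne k)
    exact this.congr_deriv (by simp)
  have hR : HasDerivAt (fun b => d * b * w ^ d / (w ^ d - b ^ d))
      (d * w ^ d * (w ^ d + (d - 1) * a ^ d) / (w ^ d - a ^ d) ^ 2) a := by
    have := (((hasDerivAt_id' a).const_mul (d : ℂ)).mul_const (w ^ d)).fun_div
      ((hasDerivAt_pow d a).const_sub (w ^ d)) hu
    refine this.congr_deriv ?_
    obtain ⟨e, rfl⟩ : ∃ e, d = e + 1 := ⟨d - 1, by omega⟩
    simp only [Nat.add_sub_cancel, Nat.cast_add, Nat.cast_one]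
    congr 1
    ring
  refine hL.unique (hR.congr_of_eventuallyEq ?_)
  have hopen : ∀ᶠ b in nhds a, w ^ d ≠ b ^ d :=
    (continuous_const.sub (continuous_pow d) : Continuous fun b : ℂ =>
      w ^ d - b ^ d).continuousAt.eventually_ne hu
      |>.mono fun b hb => sub_ne_zero.1 hb
  filter_upwards [hopen] with b hb
  exact sum_sq_div_sub hd hζ hb

/-- The rational function `∑ i < m, β / (z - x i) ^ 2 + γ i / (z - x i)`, regarded as the
coefficient of a quadratic differential. -/
noncomputable def quadDiff (m : ℕ) (β : ℂ) (x γ : ℕ → ℂ) (z : ℂ) : ℂ :=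
  ∑ i ∈ Finset.range m, (β / (z - x i) ^ 2 + γ i / (z - x i))

/-- The coefficients of `quadDiff` are compatible with the push-forward by `z ^ d + c` along the
cycle `x`. -/
structure IsInvariantData (d m : ℕ) (c β : ℂ) (x γ : ℕ → ℂ) : Prop where
  map_eq : ∀ i, x (i + 1) = x i ^ d + c
  periodic : x m = x 0
  ne_zero : ∀ i, x i ≠ 0
  rec_eq : ∀ i, γ (i + 1) * (d * x i ^ (d - 1)) = γ i - β * (d - 1) / x i
  coeff_periodic : γ m = γ 0
  sum_eq_zero : ∑ i ∈ Finset.range m, γ i = 0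

lemma quadDiff_transfer {d m : ℕ} {c β : ℂ} {x γ : ℕ → ℂ} (hd : 2 ≤ d)
    (H : IsInvariantData d m c β x γ) {ζ : ℂ} (hζ : IsPrimitiveRoot ζ d) {w : ℂ} (hw : w ≠ 0)
    (hz : ∀ i, w ^ d + c ≠ x i) :
    ∑ k ∈ Finset.range d, quadDiff m β x γ (ζ ^ k * w) / (d * (ζ ^ k * w) ^ (d - 1)) ^ 2
      = quadDiff m β x γ (w ^ d + c) := by
  have hd0 : (d : ℂ) ≠ 0 := by exact_mod_cast (by omega : d ≠ 0)
  have hζ0 : ζ ≠ 0 := hζ.ne_zero (by omega)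
  have hpow : ∀ k, (ζ ^ k * w) ^ d = w ^ d := fun k => by
    rw [mul_pow, ← pow_mul, mul_comm k d, pow_mul, hζ.pow_eq_one, one_pow, one_mul]
  have hterm : ∀ k (A : ℂ), A / (d * (ζ ^ k * w) ^ (d - 1)) ^ 2
      = (ζ ^ k * w) ^ 2 * A / (d * w ^ d) ^ 2 := fun k A => by
    have hv : ζ ^ k * w ≠ 0 := mul_ne_zero (pow_ne_zero _ hζ0) hw
    rw [← hpow k]
    generalize ζ ^ k * w = v at hv ⊢
    have : v ^ d = v ^ (d - 1) * v := by rw [← pow_succ]; congr 1; omega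
    rw [this]
    have := pow_ne_zero (d - 1) hv
    field_simp
  have hne : ∀ i, w ^ d ≠ x i ^ d := fun i h => hz (i + 1) (by rw [h, H.map_eq])
  simp_rw [hterm, ← Finset.sum_div, quadDiff, Finset.mul_sum]
  rw [Finset.sum_comm, Finset.sum_div]
  have key : ∀ i, (∑ k ∈ Finset.range d, (ζ ^ k * w) ^ 2 *
      (β / (ζ ^ k * w - x i) ^ 2 + γ i / (ζ ^ k * w - x i))) / (d * w ^ d) ^ 2
      = β / (w ^ d + c - x (i + 1)) ^ 2 + γ (i + 1) / (w ^ d + c - x (i + 1))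
        - γ (i + 1) / w ^ d := fun i => by
    have e1 : ∀ k, (ζ ^ k * w) ^ 2 * (β / (ζ ^ k * w - x i) ^ 2 + γ i / (ζ ^ k * w - x i))
        = β * ((ζ ^ k * w) ^ 2 / (ζ ^ k * w - x i) ^ 2)
          + γ i * ((ζ ^ k * w) ^ 2 / (ζ ^ k * w - x i)) := fun k => by ring
    simp_rw [e1, Finset.sum_add_distrib, ← Finset.mul_sum]
    rw [sum_sq_div_sub hd hζ (hne i), sum_sq_div_sub_sq hd hζ (hne i), H.map_eq]
    have h1 := H.rec_eq i
    have h2 := H.ne_zero i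
    have h3 := sub_ne_zero.2 (hne i)
    have h4 : w ^ d ≠ 0 := pow_ne_zero _ hw
    have h5 : x i ^ d = x i ^ (d - 1) * x i := by rw [← pow_succ]; congr 1; omega
    have h6 : γ i = γ (i + 1) * (d * x i ^ (d - 1)) + β * (d - 1) / x i := by rw [h1]; ring
    have h7 : w ^ d + c - (x i ^ d + c) = w ^ d - x i ^ d := by ring
    rw [h6, h7]
    rw [h5] at h3 ⊢
    have h8 := pow_ne_zero (d - 1) h2
    generalize x i ^ (d - 1) = y at *
    generalize w ^ d = u at *
    field_simp
    ring
  simp_rw [key]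
  rw [Finset.sum_sub_distrib, ← Finset.sum_div]
  have hsum : ∑ i ∈ Finset.range m, γ (i + 1) = 0 := by
    have h1 := Finset.sum_range_succ γ m
    rw [Finset.sum_range_succ' γ m, H.coeff_periodic] at h1
    rw [add_right_cancel h1, H.sum_eq_zero]
  rw [hsum, zero_div, sub_zero]
  have h1 := Finset.sum_range_succ (fun i => β / (w ^ d + c - x i) ^ 2 + γ i / (w ^ d + c - x i)) m
  rw [Finset.sum_range_succ' _ m, H.coeff_periodic, H.periodic] at h1
  exact add_right_cancel h1

end Transfer

section MassTransfer

open MeasureTheory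

lemma abs_det_restrictScalars_toSpanSingleton (a : ℂ) :
    |((ContinuousLinearMap.toSpanSingleton ℂ a).restrictScalars ℝ).det| = ‖a‖ ^ 2 := by
  rw [ContinuousLinearMap.det, ContinuousLinearMap.coe_restrictScalars,
    LinearMap.det_restrictScalars, Algebra.norm_complex_apply, Complex.normSq_eq_norm_sq]
  simp [abs_of_nonneg]

lemma volume_sub_notMem_slitPlane (c : ℂ) :
    volume {z : ℂ | z - c ∉ Complex.slitPlane} = 0 := by
  have h1 : volume (LinearMap.ker Complex.imLm : Set ℂ) = 0 := by
    apply Measure.addHaar_submodule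
    intro h
    have : Complex.I ∈ LinearMap.ker Complex.imLm := by rw [h]; trivial
    simp at this
  have h2 : volume ((fun z : ℂ => z - c) ⁻¹' (LinearMap.ker Complex.imLm : Set ℂ)) = 0 := by
    rw [(measurePreserving_sub_right volume c).measure_preimage
      (Submodule.closed_of_finiteDimensional _).measurableSet.nullMeasurableSet]
    exact h1
  refine measure_mono_null (fun z hz => ?_) h2
  simp only [Set.mem_ofPred_eq, Complex.slitPlane, not_or, not_not] at hz
  simp
  simpa [sub_eq_zero] using hz.2

/-- A quadratic differential that is its own push-forward under `z ^ d + c` does not lose mass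
under taking preimages. -/
lemma setLIntegral_le_preimage {d : ℕ} (hd : 2 ≤ d) {ζ : ℂ} (hζ : IsPrimitiveRoot ζ d) (c : ℂ)
    (h : ℂ → ℂ) (hm : Measurable h) {Z : Set ℂ} (hZ : Z.Countable)
    (htr : ∀ w : ℂ, w ≠ 0 → w ^ d + c ∉ Z →
      ∑ k ∈ Finset.range d, h (ζ ^ k * w) / (d * (ζ ^ k * w) ^ (d - 1)) ^ 2 = h (w ^ d + c))
    {U : Set ℂ} (hU : MeasurableSet U) :
    ∫⁻ z in U, ‖h z‖ₑ ≤ ∫⁻ z in (fun z : ℂ => z ^ d + c) ⁻¹' U, ‖h z‖ₑ := by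
  have hd0 : (d : ℂ) ≠ 0 := by exact_mod_cast (by omega : d ≠ 0)
  set N : Set ℂ := {z : ℂ | z - c ∉ Complex.slitPlane} ∪ Z with hN
  have hN0 : volume N = 0 := measure_union_null (volume_sub_notMem_slitPlane c) (hZ.measure_zero _)
  have hNm : MeasurableSet N := by
    refine MeasurableSet.union ?_ hZ.measurableSet
    exact (Complex.isOpen_slitPlane.measurableSet.preimage (measurable_id.sub_const c)).compl
  set V := U \ N with hV
  have hVm : MeasurableSet V := hU.diff hNm
  have hslit : ∀ z ∈ V, z - c ∈ Complex.slitPlane := fun z hz => by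
    by_contra h'; exact hz.2 (Or.inl h')
  set g : ℕ → ℂ → ℂ := fun k z => ζ ^ k * (z - c) ^ ((d : ℂ)⁻¹) with hg
  have hgpow : ∀ k z, g k z ^ d = z - c := fun k z => by
    simp only [hg]
    rw [mul_pow, ← pow_mul, mul_comm k d, pow_mul, hζ.pow_eq_one, one_pow, one_mul,
      Complex.cpow_nat_inv_pow _ (by omega)]
  have hg0 : ∀ k, ∀ z ∈ V, g k z ≠ 0 := fun k z hz h0 => by
    have := hgpow k z
    rw [h0, zero_pow (by omega)] at this
    exact Complex.slitPlane_ne_zero (hslit z hz) this.symm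
  have hder : ∀ k, ∀ z ∈ V, HasDerivAt (g k) (d * g k z ^ (d - 1))⁻¹ z := fun k z hz => by
    have h1 : DifferentiableAt ℂ (g k) z := by
      simp only [hg]
      exact (DifferentiableAt.cpow_const (f := fun z => z - c)
        (differentiableAt_id.sub_const c) (hslit z hz)).const_mul _
    have h2 := h1.hasDerivAt.fun_pow d
    have h3 : HasDerivAt (fun z => g k z ^ d) 1 z := by
      simp only [hgpow]
      exact (hasDerivAt_id' z).sub_const c
    have h4 := h2.unique h3
    have h5 := eq_inv_of_mul_eq_one_right h4
    rw [← h5]; exact h1.hasDerivAt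
  have hF : ∀ k, ∀ z ∈ V, HasFDerivWithinAt (g k)
      ((ContinuousLinearMap.toSpanSingleton ℂ ((d * g k z ^ (d - 1))⁻¹ : ℂ)).restrictScalars ℝ)
      V z := fun k z hz => ((hder k z hz).hasFDerivAt.restrictScalars ℝ).hasFDerivWithinAt
  have hinj' : ∀ k l, k < d → l < d → ∀ z ∈ V, ∀ z' ∈ V, g k z = g l z' → z = z' ∧ k = l := by
    intro k l hk hl z hz z' hz' he
    have h1 : z = z' := by
      have := hgpow k z
      rw [he, hgpow] at this
      exact (sub_left_inj.1 this).symm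
    subst h1
    refine ⟨rfl, hζ.pow_inj hk hl ?_⟩
    have h2 : (z - c) ^ ((d : ℂ)⁻¹) ≠ 0 := fun h0 => hg0 0 z hz (by simp [hg, h0])
    exact mul_right_cancel₀ h2 he
  have hinj : ∀ k < d, Set.InjOn (g k) V := fun k hk z hz z' hz' he =>
    (hinj' k k hk hk z hz z' hz' he).1
  have hchange : ∀ k < d, ∫⁻ z in g k '' V, ‖h z‖ₑ
      = ∫⁻ z in V, ‖h (g k z) / (d * g k z ^ (d - 1)) ^ 2‖ₑ := fun k hk => by
    rw [lintegral_image_eq_lintegral_abs_det_fderiv_mul volume hVm (hF k) (hinj k hk)]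
    refine lintegral_congr fun z => ?_
    rw [abs_det_restrictScalars_toSpanSingleton, ← ofReal_norm, ← ofReal_norm,
      ← ENNReal.ofReal_mul (by positivity), norm_div, norm_pow, norm_inv]
    congr 1
    rw [div_eq_mul_inv, mul_comm, inv_pow]
  have hsum : ∫⁻ z in V, ‖h z‖ₑ
      ≤ ∑ k ∈ Finset.range d, ∫⁻ z in V, ‖h (g k z) / (d * g k z ^ (d - 1)) ^ 2‖ₑ := by
    rw [← lintegral_finsetSum']
    · refine setLIntegral_mono' hVm fun z hz => ?_
      have h1 := htr (g 0 z) (hg0 0 z hz) (by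
        rw [hgpow, sub_add_cancel]; exact fun h' => hz.2 (Or.inr h'))
      rw [hgpow, sub_add_cancel] at h1
      rw [← h1]
      have h2 : ∀ k, ζ ^ k * g 0 z = g k z := fun k => by simp [hg]
      simp_rw [h2]
      exact enorm_sum_le _ _
    · intro k _
      have : Measurable (g k) := by
        simp only [hg]
        fun_prop
      exact ((hm.comp this).div (by fun_prop)).enorm.aemeasurable
  calc ∫⁻ z in U, ‖h z‖ₑ = ∫⁻ z in V, ‖h z‖ₑ :=
        (setLIntegral_congr (sdiff_null_ae_eq_self hN0)).symm
    _ ≤ _ := hsum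
    _ = ∑ k ∈ Finset.range d, ∫⁻ z in g k '' V, ‖h z‖ₑ :=
        Finset.sum_congr rfl fun k hk => (hchange k (Finset.mem_range.1 hk)).symm
    _ = ∫⁻ z in ⋃ k ∈ Finset.range d, g k '' V, ‖h z‖ₑ := by
        refine (lintegral_biUnion_finset ?_ ?_ _).symm
        · intro k hk l hl hkl
          refine Set.disjoint_left.2 ?_
          rintro _ ⟨z, hz, rfl⟩ ⟨z', hz', he⟩
          exact hkl (hinj' k l (by simpa using hk) (by simpa using hl) z hz z' hz' he.symm).2
        · intro k hk
          exact measurable_image_of_fderivWithin hVm (hF k) (hinj k (by simpa using hk))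
    _ ≤ _ := by
        refine lintegral_mono_set ?_
        refine Set.iUnion₂_subset fun k _ => ?_
        rintro _ ⟨z, hz, rfl⟩
        simp only [Set.mem_preimage, hgpow, sub_add_cancel]
        exact hz.1

end MassTransfer

section Analytic

open MeasureTheory Filter Topology

lemma eventually_norm_quadDiff_mul_le {m : ℕ} (β : ℂ) {x : ℕ → ℂ} (γ : ℕ → ℂ)
    (hinj : Set.InjOn x (Set.Iio m)) {i : ℕ} (hi : i < m) :
    ∀ᶠ z in 𝓝 (x i), z ≠ x i → ‖quadDiff m β x γ z‖ * ‖z - x i‖ ^ 2 ≤ ‖β‖ + 1 := by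
  set k : ℂ → ℂ := fun z => β + γ i * (z - x i) + (z - x i) ^ 2 *
    ∑ j ∈ (Finset.range m).erase i, (β / (z - x j) ^ 2 + γ j / (z - x j)) with hk
  have hc : ContinuousAt k (x i) := by
    refine ContinuousAt.add (by fun_prop) (ContinuousAt.mul (by fun_prop) ?_)
    refine tendsto_finsetSum _ fun j hj => ?_
    have hne : x i - x j ≠ 0 := by
      rw [Finset.mem_erase, Finset.mem_range] at hj
      exact sub_ne_zero.2 fun h => hj.1 (hinj hi hj.2 h).symm
    have h1 : ContinuousAt (fun z => β / (z - x j) ^ 2 + γ j / (z - x j)) (x i) := by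
      refine ContinuousAt.add (ContinuousAt.div (by fun_prop) (by fun_prop) (pow_ne_zero _ hne))
        (ContinuousAt.div (by fun_prop) (by fun_prop) hne)
    exact h1
  have h1 : ∀ᶠ z in 𝓝 (x i), ‖k z‖ < ‖β‖ + 1 :=
    hc.norm.eventually_lt_const (by simp [hk])
  filter_upwards [h1] with z hz hne
  have h2 : z - x i ≠ 0 := sub_ne_zero.2 hne
  rw [← norm_pow, ← norm_mul]
  refine le_trans (le_of_eq (congrArg norm ?_)) hz.le
  rw [quadDiff, ← Finset.add_sum_erase _ _ (Finset.mem_range.2 hi)]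
  simp only [hk]
  field_simp

lemma setLIntegral_annulus_le {h : ℂ → ℂ} {a : ℂ} {s δ M : ℝ} (hs : 0 < s) (hδ : 0 < δ)
    (hδ' : δ ≤ 1 / 2)
    (hM : ∀ z ∈ Metric.closedBall a s, z ≠ a → ‖h z‖ * ‖z - a‖ ^ 2 ≤ M) :
    ∫⁻ z in Metric.closedBall a s \ Metric.ball a ((1 - δ) * s), ‖h z‖ₑ
      ≤ ENNReal.ofReal (8 * Real.pi * M * δ) := by
  have hr : 0 < (1 - δ) * s := mul_pos (by linarith) hs
  have hM0 : 0 ≤ M := by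
    refine le_trans ?_ (hM (a + s) (by simp [abs_of_pos hs]) (by simp [hs.ne']))
    positivity
  have h1 : ∀ z ∈ Metric.closedBall a s \ Metric.ball a ((1 - δ) * s),
      ‖h z‖ₑ ≤ ENNReal.ofReal (M / ((1 - δ) * s) ^ 2) := by
    intro z hz
    have hz2 : (1 - δ) * s ≤ ‖z - a‖ := by
      have := hz.2; simpa [dist_eq_norm] using this
    have hz3 : 0 < ‖z - a‖ := hr.trans_le hz2
    have h2 := hM z hz.1 (fun h => by simp [h] at hz3)
    rw [← ofReal_norm]
    refine ENNReal.ofReal_le_ofReal ?_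
    rw [le_div_iff₀ (by positivity)]
    refine le_trans ?_ h2
    gcongr
  have hvol : volume (Metric.closedBall a s \ Metric.ball a ((1 - δ) * s))
      ≤ ENNReal.ofReal (2 * Real.pi * δ * s ^ 2) := by
    rw [measure_sdiff _ Metric.isOpen_ball.measurableSet.nullMeasurableSet
      Metric.isBounded_ball.measure_lt_top.ne]
    · rw [Complex.volume_closedBall, Complex.volume_ball]
      have e : ∀ t : ℝ, 0 ≤ t →
          ENNReal.ofReal t ^ 2 * (NNReal.pi : ENNReal) = ENNReal.ofReal (t ^ 2 * Real.pi) := by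
        intro t ht
        rw [← NNReal.coe_real_pi, ENNReal.ofReal_mul (by positivity), ENNReal.ofReal_pow ht,
          ENNReal.ofReal_coe_nnreal]
      rw [e _ hs.le, e _ hr.le, ← ENNReal.ofReal_sub _ (by positivity)]
      refine ENNReal.ofReal_le_ofReal ?_
      nlinarith [Real.pi_pos, mul_pos Real.pi_pos (pow_pos hs 2), mul_nonneg
        (mul_pos Real.pi_pos (pow_pos hs 2)).le (sq_nonneg δ)]
    · refine Metric.ball_subset_closedBall.trans (Metric.closedBall_subset_closedBall ?_)
      nlinarith
  calc _ ≤ ∫⁻ z in Metric.closedBall a s \ Metric.ball a ((1 - δ) * s),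
        ENNReal.ofReal (M / ((1 - δ) * s) ^ 2) :=
        setLIntegral_mono' (Metric.isClosed_closedBall.measurableSet.diff
          Metric.isOpen_ball.measurableSet) h1
    _ = ENNReal.ofReal (M / ((1 - δ) * s) ^ 2) *
        volume (Metric.closedBall a s \ Metric.ball a ((1 - δ) * s)) := by
        rw [setLIntegral_const]
    _ ≤ ENNReal.ofReal (M / ((1 - δ) * s) ^ 2) * ENNReal.ofReal (2 * Real.pi * δ * s ^ 2) := by
        gcongr
    _ ≤ _ := by
        rw [← ENNReal.ofReal_mul (by positivity)]
        refine ENNReal.ofReal_le_ofReal ?_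
        rw [div_mul_eq_mul_div, div_le_iff₀ (by positivity)]
        have h3 : 1 / 4 ≤ (1 - δ) ^ 2 := by nlinarith
        have h4 : 0 ≤ M * Real.pi * δ * s ^ 2 := by have := Real.pi_pos; positivity
        nlinarith [mul_le_mul_of_nonneg_left h3 h4]

lemma eventually_norm_sub_le_of_hasDerivAt {f : ℂ → ℂ} {p f' : ℂ} (hf : HasDerivAt f f' p)
    (hf' : f' ≠ 0) {δ r : ℝ} (hδ : 0 < δ) (hr : 0 < r) :
    ∀ᶠ ε in 𝓝[>] (0 : ℝ), ∀ w, ‖w - p‖ < (1 - δ) * (ε * r) → ‖f w - f p‖ ≤ ε * (‖f'‖ * r) := by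
  have h1 := hf.isLittleO.def (c := δ * ‖f'‖) (by positivity)
  obtain ⟨η, hη, h2⟩ := Metric.eventually_nhds_iff.1 h1
  have h3 : ∀ᶠ ε in 𝓝[>] (0 : ℝ), ε * r < η := by
    have : Tendsto (fun ε : ℝ => ε * r) (𝓝[>] 0) (𝓝 0) := by
      have : Tendsto (fun ε : ℝ => ε * r) (𝓝 0) (𝓝 (0 * r)) :=
        (continuous_id.mul continuous_const).tendsto 0
      rw [zero_mul] at this
      exact this.mono_left nhdsWithin_le_nhds
    exact this.eventually_lt_const hη
  filter_upwards [h3, self_mem_nhdsWithin] with ε hε hε0 w hw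
  have hε0' : 0 < ε := hε0
  have hpos : 0 < ε * r := by positivity
  have h4 := h2 (y := w) (by rw [dist_eq_norm]; nlinarith)
  have h5 : f w - f p = (f w - f p - (w - p) • f') + (w - p) * f' := by simp
  rw [h5]
  refine (norm_add_le _ _).trans ?_
  rw [norm_mul]
  have h6 : 0 < ‖f'‖ := norm_pos_iff.2 hf'
  calc _ ≤ δ * ‖f'‖ * ‖w - p‖ + ‖w - p‖ * ‖f'‖ := by gcongr
    _ = (1 + δ) * ‖f'‖ * ‖w - p‖ := by ring
    _ ≤ (1 + δ) * ‖f'‖ * ((1 - δ) * (ε * r)) := by gcongr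
    _ = (1 - δ ^ 2) * (ε * (‖f'‖ * r)) := by ring
    _ ≤ 1 * (ε * (‖f'‖ * r)) := by gcongr; nlinarith
    _ = _ := one_mul _

/-- A combination of partial fractions vanishing on an infinite set has zero numerators. -/
lemma eval_eq_zero_of_sum_div_eq_zero {m e : ℕ} (he : e ≠ 0) {x : ℕ → ℂ}
    (hinj : Set.InjOn x (Set.Iio m)) (u : ℕ → Polynomial ℂ) {S : Set ℂ} (hS : S.Infinite)
    (hSx : ∀ z ∈ S, ∀ i < m, z ≠ x i)
    (h : ∀ z ∈ S, ∑ i ∈ Finset.range m, (u i).eval z / (z - x i) ^ e = 0) {i : ℕ} (hi : i < m) :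
    (u i).eval (x i) = 0 := by
  set p : Polynomial ℂ := ∑ i ∈ Finset.range m, u i *
    ∏ j ∈ (Finset.range m).erase i, (Polynomial.X - Polynomial.C (x j)) ^ e with hp
  have hp0 : p = 0 := by
    refine Polynomial.eq_zero_of_infinite_isRoot p (hS.mono fun z hz => ?_)
    have h1 : p.eval z = (∑ i ∈ Finset.range m, (u i).eval z / (z - x i) ^ e) *
        ∏ j ∈ Finset.range m, (z - x j) ^ e := by
      rw [hp, Polynomial.eval_finsetSum, Finset.sum_mul]
      refine Finset.sum_congr rfl fun i hi => ?_
      have h2 : (z - x i) ^ e ≠ 0 :=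
        pow_ne_zero _ (sub_ne_zero.2 (hSx z hz i (Finset.mem_range.1 hi)))
      rw [← Finset.mul_prod_erase _ _ hi, Polynomial.eval_mul, Polynomial.eval_prod]
      simp only [Polynomial.eval_pow, Polynomial.eval_sub, Polynomial.eval_X, Polynomial.eval_C]
      field_simp
    show p.eval z = 0
    rw [h1, h z hz, zero_mul]
  have h1 : p.eval (x i) = (u i).eval (x i) *
      ∏ j ∈ (Finset.range m).erase i, (x i - x j) ^ e := by
    rw [hp, Polynomial.eval_finsetSum, Finset.sum_eq_single i]
    · simp [Polynomial.eval_prod]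
    · intro j hj hji
      rw [Polynomial.eval_mul, Polynomial.eval_prod,
        Finset.prod_eq_zero (Finset.mem_erase.2 ⟨hji.symm, Finset.mem_range.2 hi⟩), mul_zero]
      simp [he]
    · intro h'; exact absurd (Finset.mem_range.2 hi) h'
  rw [hp0, Polynomial.eval_zero] at h1
  refine (mul_eq_zero.1 h1.symm).resolve_right (Finset.prod_ne_zero_iff.2 fun j hj => ?_)
  rw [Finset.mem_erase, Finset.mem_range] at hj
  exact pow_ne_zero _ (sub_ne_zero.2 fun h => hj.1 (hinj hi hj.2 h).symm)

lemma measurable_quadDiff (m : ℕ) (β : ℂ) (x γ : ℕ → ℂ) : Measurable (quadDiff m β x γ) := by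
  unfold quadDiff
  fun_prop

lemma continuousOn_quadDiff (m : ℕ) (β : ℂ) (x γ : ℕ → ℂ) {S : Set ℂ}
    (hS : ∀ z ∈ S, ∀ i < m, z ≠ x i) : ContinuousOn (quadDiff m β x γ) S := by
  unfold quadDiff
  refine continuousOn_finsetSum _ fun i hi => ?_
  have : ∀ z ∈ S, z - x i ≠ 0 := fun z hz => sub_ne_zero.2 (hS z hz i (Finset.mem_range.1 hi))
  refine ContinuousOn.add (ContinuousOn.div (by fun_prop) (by fun_prop) ?_)
    (ContinuousOn.div (by fun_prop) (by fun_prop) this)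
  exact fun z hz => pow_ne_zero _ (this z hz)

end Analytic

section Rigidity

open MeasureTheory Filter Topology

variable {d m : ℕ} {c β : ℂ} {x γ : ℕ → ℂ}

/-- The exponent condition `‖∏ f' (x i)‖ = 1` forces the quadratic differential to carry no mass on
a shell outside the filled disc. -/
lemma IsInvariantData.setLIntegral_shell_le (hd : 2 ≤ d) (H : IsInvariantData d m c β x γ)
    (hm : 0 < m) (hinj : Set.InjOn x (Set.Iio m))
    (hlam : ∏ i ∈ Finset.range m, ‖(d : ℂ) * x i ^ (d - 1)‖ = 1)
    {R : ℝ} (hR : 1 < R) (hRd : R + ‖c‖ ≤ (R - 1) ^ d) (hRx : ∀ i < m, ‖x i‖ < R - 1)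
    {δ : ℝ} (hδ : 0 < δ) (hδ' : δ ≤ 1 / 2) :
    ∫⁻ z in Metric.ball 0 R \ Metric.ball 0 (R - 1), ‖quadDiff m β x γ z‖ₑ
      ≤ m * ENNReal.ofReal (8 * Real.pi * (‖β‖ + 1) * δ) := by
  have hd0 : (d : ℂ) ≠ 0 := by exact_mod_cast (by omega : d ≠ 0)
  set r : ℕ → ℝ := fun i => ∏ j ∈ Finset.range i, ‖(d : ℂ) * x j ^ (d - 1)‖ with hr
  have ha : ∀ i, (d : ℂ) * x i ^ (d - 1) ≠ 0 := fun i =>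
    mul_ne_zero hd0 (pow_ne_zero _ (H.ne_zero i))
  have hr0 : ∀ i, 0 < r i := fun i => Finset.prod_pos fun j _ => norm_pos_iff.2 (ha j)
  have hrs : ∀ i, r (i + 1) = ‖(d : ℂ) * x i ^ (d - 1)‖ * r i := fun i => by
    rw [hr]; simp only [Finset.prod_range_succ]; ring
  have hwrap : ∀ i < m, ∃ j < m, x j = x (i + 1) ∧ r j = r (i + 1) := fun i hi => by
    rcases Nat.lt_or_ge (i + 1) m with h | h
    · exact ⟨i + 1, h, rfl, rfl⟩
    · have : i + 1 = m := by omega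
      exact ⟨0, hm, by rw [this, H.periodic], by
        rw [this]; exact (Finset.prod_range_zero _).trans hlam.symm⟩
  have hfin : ∀ {p : ℕ → ℝ → Prop}, (∀ i < m, ∀ᶠ ε in 𝓝[>] (0 : ℝ), p i ε) →
      ∀ᶠ ε in 𝓝[>] (0 : ℝ), ∀ i < m, p i ε := fun {p} h => by
    have := (eventually_all_finset (l := 𝓝[>] (0 : ℝ)) (p := p) (Finset.range m)).2
      fun i hi => h i (Finset.mem_range.1 hi)
    filter_upwards [this] with ε hε i hi using hε i (Finset.mem_range.2 hi)
  have hA := hfin fun i _ => eventually_norm_sub_le_of_hasDerivAt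
    (f := fun z => z ^ d + c) (p := x i) (f' := d * x i ^ (d - 1))
    ((hasDerivAt_pow d (x i)).add_const c) (ha i) hδ (hr0 i)
  have ht : ∀ i, Tendsto (fun ε : ℝ => ε * r i) (𝓝[>] 0) (𝓝 0) := fun i => by
    have : Tendsto (fun ε : ℝ => ε * r i) (𝓝 0) (𝓝 (0 * r i)) :=
      (continuous_id.mul continuous_const).tendsto 0
    rw [zero_mul] at this
    exact this.mono_left nhdsWithin_le_nhds
  have hB : ∀ᶠ ε in 𝓝[>] (0 : ℝ), ∀ i < m, ∀ z ∈ Metric.closedBall (x i) (ε * r i), z ≠ x i →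
      ‖quadDiff m β x γ z‖ * ‖z - x i‖ ^ 2 ≤ ‖β‖ + 1 := hfin fun i hi => by
    obtain ⟨η, hη, h2⟩ :=
      Metric.eventually_nhds_iff.1 (eventually_norm_quadDiff_mul_le β γ hinj hi)
    filter_upwards [(ht i).eventually_lt_const hη] with ε hε z hz hne
    exact h2 (lt_of_le_of_lt hz hε) hne
  have hC : ∀ᶠ ε in 𝓝[>] (0 : ℝ), ∀ i < m, ε * r i < R - 1 - ‖x i‖ := hfin fun i hi =>
    (ht i).eventually_lt_const (sub_pos.2 (hRx i hi))
  obtain ⟨ε, ⟨⟨hA, hB⟩, hC⟩, hε⟩ := (((hA.and hB).and hC).and self_mem_nhdsWithin).exists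
  replace hε : 0 < ε := hε
  set h := quadDiff m β x γ with hh
  set U := Metric.ball (0 : ℂ) R \ ⋃ i ∈ Finset.range m, Metric.closedBall (x i) (ε * r i) with hU
  set S := Metric.ball (0 : ℂ) R \ Metric.ball 0 (R - 1) with hS
  set A : ℕ → Set ℂ := fun i =>
    Metric.closedBall (x i) (ε * r i) \ Metric.ball (x i) ((1 - δ) * (ε * r i)) with hAdef
  have hUm : MeasurableSet U := Metric.isOpen_ball.measurableSet.diff
    (Finset.measurableSet_biUnion _ fun i _ => Metric.isClosed_closedBall.measurableSet)
  have hSm : MeasurableSet S :=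
    Metric.isOpen_ball.measurableSet.diff Metric.isOpen_ball.measurableSet
  have hSU : S ⊆ U := by
    intro z hz
    refine ⟨hz.1, ?_⟩
    simp only [Set.mem_iUnion, not_exists]
    intro i hi hzi
    rw [Finset.mem_range] at hi
    apply hz.2
    rw [mem_ball_zero_iff]
    rw [mem_closedBall_iff_norm] at hzi
    have := norm_add_le (z - x i) (x i)
    rw [sub_add_cancel] at this
    linarith [hC i hi]
  have hpre : (fun z : ℂ => z ^ d + c) ⁻¹' U ⊆ (U \ S) ∪ ⋃ i ∈ Finset.range m, A i := by
    intro w hw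
    have hw1 : ‖w‖ < R - 1 := by
      by_contra hcon
      rw [not_lt] at hcon
      have h1 : (R - 1) ^ d ≤ ‖w‖ ^ d := pow_le_pow_left₀ (by linarith) hcon d
      have h2 : ‖w ^ d + c‖ < R := mem_ball_zero_iff.1 hw.1
      have h3 := norm_sub_le (w ^ d + c) c
      rw [add_sub_cancel_right, norm_pow] at h3
      linarith
    have hw2 : ∀ i < m, (1 - δ) * (ε * r i) ≤ ‖w - x i‖ := by
      intro i hi
      by_contra hcon
      rw [not_le] at hcon
      have h1 := hA i hi w hcon
      obtain ⟨j, hj, hj1, hj2⟩ := hwrap i hi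
      refine hw.2 (Set.mem_biUnion (x := j) (Finset.mem_coe.2 (Finset.mem_range.2 hj)) ?_)
      rw [mem_closedBall_iff_norm, hj1, hj2, hrs, H.map_eq]
      exact h1
    by_cases hwi : ∃ i < m, w ∈ Metric.closedBall (x i) (ε * r i)
    · obtain ⟨i, hi, hwi⟩ := hwi
      refine Or.inr (Set.mem_biUnion (x := i) (Finset.mem_coe.2 (Finset.mem_range.2 hi)) ?_)
      refine ⟨hwi, fun hcon => ?_⟩
      rw [mem_ball_iff_norm] at hcon
      exact absurd (hw2 i hi) (not_le.2 hcon)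
    · refine Or.inl ⟨⟨?_, ?_⟩, ?_⟩
      · rw [mem_ball_zero_iff]; linarith
      · simp only [Set.mem_iUnion, not_exists]
        intro i hi hcon
        exact hwi ⟨i, Finset.mem_range.1 hi, hcon⟩
      · intro hcon
        exact hcon.2 (mem_ball_zero_iff.2 hw1)
  have hfinite : ∫⁻ z in U \ S, ‖h z‖ₑ ≠ ⊤ := by
    set K := Metric.closedBall (0 : ℂ) R \ ⋃ i ∈ Finset.range m, Metric.ball (x i) (ε * r i)
    have hK : IsCompact K := (isCompact_closedBall (0 : ℂ) R).diff
      (isOpen_biUnion fun i _ => Metric.isOpen_ball)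
    have hcont : ContinuousOn h K := by
      refine continuousOn_quadDiff m β x γ fun z hz i hi hzi => hz.2 ?_
      refine Set.mem_biUnion (x := i) (Finset.mem_coe.2 (Finset.mem_range.2 hi)) ?_
      rw [hzi]
      exact Metric.mem_ball_self (mul_pos hε (hr0 i))
    have hint := (hcont.integrableOn_compact (μ := volume) hK).hasFiniteIntegral
    refine ne_top_of_le_ne_top hint.ne (lintegral_mono_set ?_)
    refine Set.sdiff_subset.trans (Set.sdiff_subset_sdiff Metric.ball_subset_closedBall ?_)
    exact Set.iUnion₂_mono fun i _ => Metric.ball_subset_closedBall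
  obtain ⟨ζ, hζ⟩ : ∃ ζ : ℂ, IsPrimitiveRoot ζ d := ⟨_, Complex.isPrimitiveRoot_exp d (by omega)⟩
  have hmass := setLIntegral_le_preimage hd hζ c h (measurable_quadDiff m β x γ)
    (Set.countable_range x)
    (fun w hw hz => quadDiff_transfer hd H hζ hw fun i hi => hz ⟨i, hi.symm⟩) hUm
  have hsub : ∀ s : Finset ℕ, ∫⁻ z in ⋃ i ∈ s, A i, ‖h z‖ₑ ≤ ∑ i ∈ s, ∫⁻ z in A i, ‖h z‖ₑ := by
    intro s
    induction s using Finset.induction_on with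
    | empty => simp only [Finset.notMem_empty, Set.iUnion_of_empty, Set.iUnion_empty,
        Measure.restrict_empty, lintegral_zero_measure, Finset.sum_empty, le_refl]
    | insert i s hi ih =>
      rw [Finset.set_biUnion_insert, Finset.sum_insert hi]
      exact (lintegral_union_le _ _ _).trans (by gcongr)
  have hAi : ∀ i ∈ Finset.range m, ∫⁻ z in A i, ‖h z‖ₑ
      ≤ ENNReal.ofReal (8 * Real.pi * (‖β‖ + 1) * δ) := fun i hi =>
    setLIntegral_annulus_le (mul_pos hε (hr0 i)) hδ hδ' (hB i (Finset.mem_range.1 hi))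
  have htot : (∫⁻ z in U \ S, ‖h z‖ₑ) + ∫⁻ z in S, ‖h z‖ₑ
      ≤ (∫⁻ z in U \ S, ‖h z‖ₑ) + m * ENNReal.ofReal (8 * Real.pi * (‖β‖ + 1) * δ) := by
    calc _ = ∫⁻ z in U, ‖h z‖ₑ := by
          rw [← lintegral_inter_add_sdiff (μ := volume) (fun z => ‖h z‖ₑ) U hSm,
            Set.inter_eq_self_of_subset_right hSU, add_comm]
      _ ≤ _ := hmass
      _ ≤ ∫⁻ z in (U \ S) ∪ ⋃ i ∈ Finset.range m, A i, ‖h z‖ₑ := lintegral_mono_set hpre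
      _ ≤ _ := lintegral_union_le _ _ _
      _ ≤ _ := by
          gcongr
          refine (hsub _).trans ((Finset.sum_le_sum hAi).trans ?_)
          simp
  exact (ENNReal.add_le_add_iff_left hfinite).1 htot

/-- There is no nonzero invariant quadratic differential supported on a cycle whose multiplier has
modulus one. -/
theorem IsInvariantData.eq_zero (hd : 2 ≤ d) (H : IsInvariantData d m c β x γ)
    (hm : 0 < m) (hinj : Set.InjOn x (Set.Iio m))
    (hlam : ∏ i ∈ Finset.range m, ‖(d : ℂ) * x i ^ (d - 1)‖ = 1) :
    β = 0 ∧ ∀ i < m, γ i = 0 := by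
  obtain ⟨R, hR4, hRx⟩ : ∃ R : ℝ, 4 + ‖c‖ ≤ R ∧ ∀ i < m, ‖x i‖ < R - 1 := by
    refine ⟨4 + ‖c‖ + ∑ i ∈ Finset.range m, ‖x i‖, ?_, fun i hi => ?_⟩
    · linarith [Finset.sum_nonneg fun i (_ : i ∈ Finset.range m) => norm_nonneg (x i)]
    · have := Finset.single_le_sum (fun i _ => norm_nonneg (x i)) (Finset.mem_range.2 hi)
      linarith [norm_nonneg c]
  have hc := norm_nonneg c
  have hRd : R + ‖c‖ ≤ (R - 1) ^ d := by
    calc R + ‖c‖ ≤ (R - 1) ^ 2 := by nlinarith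
      _ ≤ (R - 1) ^ d := pow_le_pow_right₀ (by linarith) hd
  have hle := fun δ (hδ : 0 < δ) (hδ' : δ ≤ 1 / 2) =>
    H.setLIntegral_shell_le hd hm hinj hlam (by linarith) hRd hRx hδ hδ'
  have hzero : ∫⁻ z in Metric.ball 0 R \ Metric.ball 0 (R - 1), ‖quadDiff m β x γ z‖ₑ = 0 := by
    have ht : Tendsto (fun δ : ℝ => (m : ENNReal) * ENNReal.ofReal (8 * Real.pi * (‖β‖ + 1) * δ))
        (𝓝[>] 0) (𝓝 0) := by
      have h1 : Tendsto (fun δ : ℝ => 8 * Real.pi * (‖β‖ + 1) * δ) (𝓝[>] 0) (𝓝 0) := by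
        have : Tendsto (fun δ : ℝ => 8 * Real.pi * (‖β‖ + 1) * δ) (𝓝 0)
            (𝓝 (8 * Real.pi * (‖β‖ + 1) * 0)) := (continuous_const.mul continuous_id).tendsto 0
        rw [mul_zero] at this
        exact this.mono_left nhdsWithin_le_nhds
      have h2 := ENNReal.Tendsto.const_mul (a := (m : ENNReal)) (ENNReal.tendsto_ofReal h1)
        (Or.inr (ENNReal.natCast_ne_top m))
      simpa using h2
    refine le_antisymm (ge_of_tendsto ht ?_) zero_le
    filter_upwards [Ioo_mem_nhdsGT (show (0 : ℝ) < 1 / 2 by norm_num)] with δ hδ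
    exact hle δ hδ.1 hδ.2.le
  set S := Metric.ball (0 : ℂ) R \ Metric.closedBall 0 (R - 1) with hS
  have hSo : IsOpen S := Metric.isOpen_ball.sdiff Metric.isClosed_closedBall
  have hSx : ∀ z ∈ S, ∀ i < m, z ≠ x i := by
    rintro z hz i hi rfl
    exact hz.2 (mem_closedBall_zero_iff.2 (hRx i hi).le)
  have hae : quadDiff m β x γ =ᵐ[volume.restrict S] 0 := by
    have h1 := (lintegral_eq_zero_iff (measurable_quadDiff m β x γ).enorm).1 hzero
    have h2 := ae_restrict_of_ae_restrict_of_subset (s := S)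
      (Set.sdiff_subset_sdiff_right Metric.ball_subset_closedBall) h1
    filter_upwards [h2] with z hz
    simpa using hz
  have hEq : Set.EqOn (quadDiff m β x γ) 0 S :=
    Measure.eqOn_open_of_ae_eq hae hSo (continuousOn_quadDiff m β x γ hSx) continuousOn_const
  have hinf : S.Infinite := by
    refine infinite_of_mem_nhds (((R - 1 / 2 : ℝ) : ℂ)) (hSo.mem_nhds ?_)
    have : 0 ≤ R - 1 / 2 := by linarith
    constructor
    · rw [mem_ball_zero_iff, Complex.norm_of_nonneg this]; linarith
    · rw [mem_closedBall_zero_iff, Complex.norm_of_nonneg this]; linarith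
  have hβ : β = 0 := by
    have := eval_eq_zero_of_sum_div_eq_zero (two_ne_zero) hinj
      (fun i => Polynomial.C β + Polynomial.C (γ i) * (Polynomial.X - Polynomial.C (x i)))
      hinf hSx (fun z hz => ?_) hm
    · simpa using this
    · have h0 : quadDiff m β x γ z = 0 := hEq hz
      rw [← h0, quadDiff]
      refine Finset.sum_congr rfl fun i hi => ?_
      have := sub_ne_zero.2 (hSx z hz i (Finset.mem_range.1 hi))
      simp
      field_simp
  refine ⟨hβ, fun i hi => ?_⟩
  have := eval_eq_zero_of_sum_div_eq_zero (one_ne_zero) hinj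
      (fun i => Polynomial.C (γ i)) hinf hSx (fun z hz => ?_) hi
  · simpa using this
  · have h0 := hEq hz
    rw [quadDiff] at h0
    simpa [hβ] using h0

end Rigidity

namespace Polynomial

section Iteration

/-- The unicritical map `z ^ d + c` over a commutative ring. -/
def powAdd {B : Type*} [CommRing B] (d : ℕ) (c : B) (z : B) : B := z ^ d + c

lemma powAdd_apply {B : Type*} [CommRing B] (d : ℕ) (c z : B) : powAdd d c z = z ^ d + c := rfl

lemma map_iterate_powAdd {A B : Type*} [CommRing A] [CommRing B] (φ : A →+* B) (d : ℕ) (c z : A)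
    (m : ℕ) : φ ((powAdd d c)^[m] z) = (powAdd d (φ c))^[m] (φ z) := by
  induction m with
  | zero => rfl
  | succ m ih => simp only [Function.iterate_succ_apply', powAdd_apply, map_add, map_pow, ih]

/-- The difference quotient of `z ^ d`. -/
def powQuot {B : Type*} [CommRing B] (d : ℕ) (a b : B) : B :=
  ∑ j ∈ Finset.range d, a ^ j * b ^ (d - 1 - j)

lemma powQuot_self {B : Type*} [CommRing B] (d : ℕ) (a : B) : powQuot d a a = d * a ^ (d - 1) := by
  have : ∀ j ∈ Finset.range d, a ^ j * a ^ (d - 1 - j) = a ^ (d - 1) := fun j hj => by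
    rw [← pow_add]; congr 1; have := Finset.mem_range.1 hj; omega
  rw [powQuot, Finset.sum_congr rfl this]; simp

lemma map_powQuot {A B : Type*} [CommRing A] [CommRing B] (φ : A →+* B) (d : ℕ) (a b : A) :
    φ (powQuot d a b) = powQuot d (φ a) (φ b) := by
  simp [powQuot]

lemma iterate_powAdd_sub {B : Type*} [CommRing B] (d : ℕ) (c a b : B) (m : ℕ) :
    (powAdd d c)^[m] a - (powAdd d c)^[m] b =
      (a - b) * ∏ i ∈ Finset.range m, powQuot d ((powAdd d c)^[i] a) ((powAdd d c)^[i] b) := by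
  induction m with
  | zero => simp
  | succ m ih =>
    rw [Finset.prod_range_succ, ← mul_assoc, ← ih, Function.iterate_succ_apply',
      Function.iterate_succ_apply', powAdd_apply, powAdd_apply, powQuot, mul_comm, geom_sum₂_mul]
    ring

/-- Evaluation of a polynomial in `x` over `ℂ[c]` at a point of a `ℂ`-algebra. -/
noncomputable def evalPt {B : Type*} [CommRing B] [Algebra ℂ B] (c x : B) : ℂ[X][X] →+* B :=
  eval₂RingHom (aeval c : ℂ[X] →ₐ[ℂ] B).toRingHom x

@[simp] lemma evalPt_X {B : Type*} [CommRing B] [Algebra ℂ B] (c x : B) :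
    evalPt c x X = x := by simp [evalPt]

@[simp] lemma evalPt_C_X {B : Type*} [CommRing B] [Algebra ℂ B] (c x : B) :
    evalPt c x (C X) = c := by simp [evalPt]

lemma evalPt_eq_eval_map (c x : ℂ) (p : ℂ[X][X]) :
    evalPt c x p = (p.map (evalRingHom c)).eval x := by
  rw [evalPt, coe_eval₂RingHom, eval_map]
  rfl

lemma map_evalPt {A B : Type*} [CommRing A] [Algebra ℂ A] [CommRing B] [Algebra ℂ B]
    (φ : A →ₐ[ℂ] B) (c x : A) (p : ℂ[X][X]) : φ (evalPt c x p) = evalPt (φ c) (φ x) p := by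
  simp only [evalPt, coe_eval₂RingHom, hom_eval₂ p _ (φ : A →+* B) x, ← RingHom.coe_coe φ]
  congr 1
  ext <;> simp

local notation "𝐜" => (C (X : ℂ[X]) : ℂ[X][X])

/-- The polynomial `f_c^m(x) - x`. -/
noncomputable def perPoly (d m : ℕ) : ℂ[X][X] := (powAdd d 𝐜)^[m] X - X

@[simp] lemma evalPt_perPoly {B : Type*} [CommRing B] [Algebra ℂ B] (c x : B) (d m : ℕ) :
    evalPt c x (perPoly d m) = (powAdd d c)^[m] x - x := by
  rw [perPoly, map_sub, map_iterate_powAdd, evalPt_X, evalPt_C_X]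

lemma perPoly_mul (d m r : ℕ) : ∃ S : ℂ[X][X], perPoly d (m * r) = perPoly d m * S ∧
    ∀ (B : Type) [CommRing B] [Algebra ℂ B] (c x : B), (powAdd d c)^[m] x = x →
      evalPt c x S = ∑ j ∈ Finset.range r,
        (∏ i ∈ Finset.range m, (d : B) * (powAdd d c)^[i] x ^ (d - 1)) ^ j := by
  induction r with
  | zero => exact ⟨0, by simp [perPoly], by simp⟩
  | succ r ih =>
    obtain ⟨S, hS, hev⟩ := ih
    refine ⟨S * ∏ i ∈ Finset.range m, powQuot d ((powAdd d 𝐜)^[i] ((powAdd d 𝐜)^[m * r] X))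
      ((powAdd d 𝐜)^[i] X) + 1, ?_, ?_⟩
    · have h1 := iterate_powAdd_sub d 𝐜 ((powAdd d 𝐜)^[m * r] X) X m
      rw [← Function.iterate_add_apply, add_comm m, ← Nat.mul_succ] at h1
      calc perPoly d (m * (r + 1)) = ((powAdd d 𝐜)^[m * r.succ] X - (powAdd d 𝐜)^[m] X)
            + perPoly d m := by rw [perPoly, perPoly]; ring
        _ = perPoly d (m * r) * _ + perPoly d m := by rw [h1, perPoly, perPoly]
        _ = _ := by rw [hS]; ring
    · intro B _ _ c x hx
      have hx' : (powAdd d c)^[m * r] x = x :=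
        (Function.IsPeriodicPt.const_mul (f := powAdd d c) hx r |> fun h => by
          rwa [mul_comm] at h : Function.IsPeriodicPt (powAdd d c) (m * r) x)
      rw [map_add, map_mul, hev B c x hx, map_one, map_prod, Finset.sum_range_succ', pow_zero,
        Finset.sum_mul]
      congr 1
      refine Finset.sum_congr rfl fun j _ => ?_
      rw [pow_succ]
      congr 1
      refine Finset.prod_congr rfl fun i _ => ?_
      simp only [map_powQuot, map_iterate_powAdd, evalPt_X, evalPt_C_X, hx', powQuot_self]

lemma iterate_powAdd_monic {d : ℕ} (hd : 2 ≤ d) {R : Type*} [CommRing R] [Nontrivial R] (c : R)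
    (m : ℕ) :
    ((powAdd d (C c))^[m] (X : R[X])).Monic ∧
      ((powAdd d (C c))^[m] (X : R[X])).natDegree = d ^ m := by
  induction m with
  | zero => simp [monic_X]
  | succ m ih =>
    rw [Function.iterate_succ_apply', powAdd_apply]
    have h1 := ih.1.pow d
    have h2 : ((powAdd d (C c))^[m] (X : R[X]) ^ d).natDegree = d ^ (m + 1) := by
      rw [ih.1.natDegree_pow, ih.2, pow_succ, mul_comm]
    have h3 : (C c : R[X]).degree < ((powAdd d (C c))^[m] (X : R[X]) ^ d).degree := by
      refine degree_C_le.trans_lt ?_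
      rw [degree_eq_natDegree h1.ne_zero, h2]
      exact_mod_cast pow_pos (by omega) _
    refine ⟨h1.add_of_left h3, ?_⟩
    rw [natDegree_add_C, h2]

lemma perPoly_monic_natDegree {d m : ℕ} (hd : 2 ≤ d) (hm : 1 ≤ m) :
    (perPoly d m).Monic ∧ (perPoly d m).natDegree = d ^ m := by
  obtain ⟨h1, h2⟩ := iterate_powAdd_monic hd (X : ℂ[X]) m
  have h3 : (X : ℂ[X][X]).natDegree < ((powAdd d 𝐜)^[m] (X : ℂ[X][X])).natDegree := by
    rw [h2, natDegree_X]
    exact Nat.one_lt_pow (by omega) (by omega)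
  refine ⟨h1.sub_of_left (degree_lt_degree h3), ?_⟩
  rw [perPoly, natDegree_sub_eq_left_of_natDegree_lt h3, h2]

lemma separable_X_pow_sub_X {N : ℕ} (hN : 2 ≤ N) : (X ^ N - X : ℂ[X]).Separable := by
  obtain ⟨M, rfl⟩ : ∃ M, N = M + 2 := ⟨N - 2, by omega⟩
  have hM : ((M : ℂ) + 1) ≠ 0 := by exact_mod_cast Nat.succ_ne_zero M
  refine ⟨-(C (((M : ℂ) + 2) ^ 2 / (M + 1)) * X ^ M),
    -1 + C (((M : ℂ) + 2) / (M + 1)) * X ^ (M + 1), ?_⟩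
  have e1 : (C (((M : ℂ) + 2) ^ 2 / (M + 1)) : ℂ[X])
      = C (((M : ℂ) + 2) / (M + 1)) * C ((M : ℂ) + 2) := by
    rw [← C_mul]; congr 1; ring
  have e2 : (C (((M : ℂ) + 2) / (M + 1)) : ℂ[X]) * (C ((M : ℂ) + 2) - 1) = C ((M : ℂ) + 2) := by
    rw [← C_1, ← C_sub, ← C_mul]
    congr 1
    have : (M : ℂ) + 2 - 1 = M + 1 := by ring
    rw [this]; field_simp
  rw [derivative_sub, derivative_X_pow, derivative_X, e1]
  rw [show M + 2 - 1 = M + 1 by omega]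
  push_cast
  linear_combination (X ^ (M + 1)) * e2

lemma map_evalRingHom_zero_perPoly (d m : ℕ) :
    (perPoly d m).map (evalRingHom 0) = X ^ d ^ m - X := by
  have h1 := map_iterate_powAdd (mapRingHom (evalRingHom (0 : ℂ))) d (C X) X m
  simp only [coe_mapRingHom, map_C, coe_evalRingHom, eval_X, map_X, C_0] at h1
  have h2 : ∀ k, (powAdd d (0 : ℂ[X]))^[k] X = X ^ d ^ k := fun k => by
    induction k with
    | zero => simp
    | succ k ih =>
      rw [Function.iterate_succ_apply', ih, powAdd_apply, add_zero, ← pow_mul, ← pow_succ]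
  rw [perPoly, Polynomial.map_sub, h1, map_X, h2]

lemma perPoly_squarefree {d m : ℕ} (hd : 2 ≤ d) (hm : 1 ≤ m) : Squarefree (perPoly d m) := by
  intro p ⟨q, hq⟩
  obtain ⟨hmon, -⟩ := perPoly_monic_natDegree hd hm
  have hlc : IsUnit p.leadingCoeff := by
    have h1 := congrArg leadingCoeff hq
    rw [hmon.leadingCoeff, leadingCoeff_mul, leadingCoeff_mul, mul_assoc] at h1
    exact IsUnit.of_mul_eq_one _ h1.symm
  have hsq : Squarefree ((perPoly d m).map (evalRingHom 0)) := by
    rw [map_evalRingHom_zero_perPoly]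
    exact (separable_X_pow_sub_X (le_trans hd (Nat.le_self_pow (by omega) d))).squarefree
  have h1 : IsUnit (p.map (evalRingHom 0)) := by
    refine hsq _ ⟨q.map (evalRingHom 0), ?_⟩
    rw [hq, Polynomial.map_mul, Polynomial.map_mul]
  have h2 : (p.map (evalRingHom (0 : ℂ))).natDegree = p.natDegree :=
    natDegree_map_of_leadingCoeff_ne_zero _ (hlc.map (evalRingHom (0 : ℂ))).ne_zero
  rw [natDegree_eq_zero_of_isUnit h1] at h2
  obtain ⟨a, rfl⟩ := natDegree_eq_zero.1 h2.symm
  rw [leadingCoeff_C] at hlc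
  exact isUnit_C.2 hlc

end Iteration

end Polynomial

namespace Polynomial

section Dynatomic

lemma dvd_perPoly_iff {p : ℂ[X][X]} {d m : ℕ} : p ∣ perPoly d m ↔
    Function.IsPeriodicPt (powAdd d (Ideal.Quotient.mk (Ideal.span {p}) (C X))) m
      (Ideal.Quotient.mk (Ideal.span {p}) X) := by
  have h := map_iterate_powAdd (A := ℂ[X][X]) (B := ℂ[X][X] ⧸ Ideal.span {p})
    (Ideal.Quotient.mk (Ideal.span {p})) d (C X) X m
  rw [← Ideal.mem_span_singleton, ← Ideal.Quotient.eq_zero_iff_mem, perPoly, map_sub,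
    sub_eq_zero, h]
  rfl

lemma dvd_perPoly_gcd {p : ℂ[X][X]} {d a b : ℕ} (ha : p ∣ perPoly d a) (hb : p ∣ perPoly d b) :
    p ∣ perPoly d (a.gcd b) :=
  dvd_perPoly_iff.2 ((dvd_perPoly_iff.1 ha).gcd (dvd_perPoly_iff.1 hb))

/-- The `m`-th dynatomic polynomial of `x ^ d + c` as a polynomial in `x` over `ℂ[c]`. -/
noncomputable def dynPoly (d m : ℕ) : ℂ[X][X] :=
  perPoly d m /ₘ ∏ e ∈ m.properDivisors.attach, dynPoly d e.1
termination_by m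
decreasing_by exact (Nat.mem_properDivisors.1 e.2).2

lemma dynPoly_eq (d m : ℕ) :
    dynPoly d m = perPoly d m /ₘ ∏ e ∈ m.properDivisors, dynPoly d e := by
  rw [dynPoly, Finset.prod_attach m.properDivisors (dynPoly d)]

theorem dynPoly_monic_and_prod {d : ℕ} (hd : 2 ≤ d) (m : ℕ) (hm : 1 ≤ m) :
    (dynPoly d m).Monic ∧ ∏ e ∈ m.divisors, dynPoly d e = perPoly d m := by
  induction m using Nat.strong_induction_on with
  | _ m ih =>
  have hprop : ∀ e ∈ m.properDivisors, 1 ≤ e ∧ e < m ∧ e ∣ m := fun e he => by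
    rw [Nat.mem_properDivisors] at he
    exact ⟨Nat.pos_of_dvd_of_pos he.1 hm, he.2, he.1⟩
  have hEF : ∀ e ∈ m.properDivisors, dynPoly d e ∣ perPoly d e := fun e he => by
    obtain ⟨h1, h2, -⟩ := hprop e he
    rw [← (ih e h2 h1).2]
    exact Finset.dvd_prod_of_mem _ (Nat.mem_divisors_self e (by omega))
  have hFF : ∀ e ∈ m.properDivisors, perPoly d e ∣ perPoly d m := fun e he => by
    obtain ⟨r, hr⟩ := (hprop e he).2.2
    obtain ⟨S, hS, -⟩ := perPoly_mul d e r
    exact ⟨S, by rw [hr, hS]⟩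
  have hkey : ∀ e ∈ m.properDivisors, ∀ g, g ∣ e → g < e → ∀ p, p ∣ dynPoly d e →
      p ∣ perPoly d g → IsUnit p := by
    intro e he g hge hlt p hp1 hp2
    obtain ⟨h1, h2, -⟩ := hprop e he
    have hg1 : 1 ≤ g := Nat.pos_of_dvd_of_pos hge h1
    refine perPoly_squarefree (m := e) hd h1 p ?_
    rw [← (ih e h2 h1).2, ← Nat.insert_self_properDivisors (by omega),
      Finset.prod_insert Nat.self_notMem_properDivisors]
    refine mul_dvd_mul hp1 (hp2.trans ?_)
    rw [← (ih g (by omega) hg1).2]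
    refine Finset.prod_dvd_prod_of_subset _ _ _ fun k hk => ?_
    have hkg := Nat.dvd_of_mem_divisors hk
    exact Nat.mem_properDivisors.2 ⟨hkg.trans hge, (Nat.le_of_dvd hg1 hkg).trans_lt hlt⟩
  have hrel : Set.Pairwise (m.properDivisors : Set ℕ)
      (Function.onFun IsRelPrime (dynPoly d)) := by
    intro e he e' he' hne p hp hp'
    have h3 := dvd_perPoly_gcd (hp.trans (hEF e he)) (hp'.trans (hEF e' he'))
    rcases (Nat.gcd_le_left e' (hprop e he).1).lt_or_eq with h | h
    · exact hkey e he _ (Nat.gcd_dvd_left _ _) h p hp h3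
    · refine hkey e' he' _ (Nat.gcd_dvd_right e e') ?_ p hp' h3
      refine lt_of_le_of_ne (Nat.gcd_le_right _ (hprop e' he').1) fun h' => hne ?_
      rw [← h, h']
  have hdvd : ∏ e ∈ m.properDivisors, dynPoly d e ∣ perPoly d m :=
    Finset.prod_dvd_of_isRelPrime hrel fun e he => (hEF e he).trans (hFF e he)
  have hmonic : (∏ e ∈ m.properDivisors, dynPoly d e).Monic :=
    monic_prod_of_monic _ _ fun e he => (ih e (hprop e he).2.1 (hprop e he).1).1
  have hmul : (∏ e ∈ m.properDivisors, dynPoly d e) * dynPoly d m = perPoly d m := by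
    have h1 := modByMonic_add_div (perPoly d m) (∏ e ∈ m.properDivisors, dynPoly d e)
    rwa [(modByMonic_eq_zero_iff_dvd hmonic).2 hdvd, zero_add, ← dynPoly_eq] at h1
  refine ⟨hmonic.of_mul_monic_left (hmul ▸ (perPoly_monic_natDegree hd hm).1), ?_⟩
  rw [← Nat.insert_self_properDivisors (by omega),
    Finset.prod_insert Nat.self_notMem_properDivisors, mul_comm, hmul]

lemma dynPoly_mul_prod_perPoly {d n : ℕ} (hd : 2 ≤ d) (hn : 1 ≤ n) :
    dynPoly d n * ∏ m ∈ n.divisors.filter fun m => ArithmeticFunction.moebius (n / m) = -1,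
        perPoly d m
      = ∏ m ∈ n.divisors.filter fun m => ArithmeticFunction.moebius (n / m) = 1,
        perPoly d m := by
  set φ := algebraMap ℂ[X][X] (FractionRing ℂ[X][X])
  have hφ : Function.Injective φ := IsFractionRing.injective _ _
  have hE0 : ∀ m, 0 < m → φ (dynPoly d m) ≠ 0 := fun m hm =>
    (map_ne_zero_iff φ hφ).2 (dynPoly_monic_and_prod hd m hm).1.ne_zero
  have hF0 : ∀ m, 0 < m → φ (perPoly d m) ≠ 0 := fun m hm =>
    (map_ne_zero_iff φ hφ).2 (perPoly_monic_natDegree hd hm).1.ne_zero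
  have h1 := (ArithmeticFunction.prod_eq_iff_prod_pow_moebius_eq_of_nonzero hE0 hF0).1
    (fun m hm => by rw [← map_prod, (dynPoly_monic_and_prod hd m hm).2]) n hn
  rw [Nat.prod_divisorsAntidiagonal'
    fun i j => φ (perPoly d j) ^ ArithmeticFunction.moebius i] at h1
  apply hφ
  rw [map_mul, map_prod, map_prod, ← h1, Finset.prod_filter, Finset.prod_filter,
    ← Finset.prod_mul_distrib]
  refine Finset.prod_congr rfl fun m hm => ?_
  have hm0 := hF0 m (Nat.pos_of_mem_divisors hm)
  rcases ArithmeticFunction.moebius_eq_or (n / m) with h | h | h <;> simp [h, hm0]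

end Dynatomic

end Polynomial

section CycleRecurrences

lemma sum_coeff_eq_zero {m : ℕ} {a b v γ : ℕ → ℂ} (hγ : ∀ i, γ (i + 1) * a i = γ i - b i)
    (hv : ∀ i, v (i + 1) = a i * v i + 1) (hγm : γ m = γ 0) (hvm : v m = v 0)
    (hb : ∑ i ∈ Finset.range m, b i * v i = 0) : ∑ i ∈ Finset.range m, γ i = 0 := by
  have h1 : ∑ i ∈ Finset.range m, γ (i + 1) = ∑ i ∈ Finset.range m, γ i := by
    have h := Finset.sum_range_succ γ m
    rw [Finset.sum_range_succ' γ m, hγm] at h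
    exact add_right_cancel h
  rw [← h1]
  have h2 : ∀ i, γ (i + 1) = (γ (i + 1) * v (i + 1) - γ i * v i) + b i * v i := fun i => by
    rw [hv]; linear_combination (-v i) * hγ i
  rw [Finset.sum_congr rfl fun i _ => h2 i, Finset.sum_add_distrib, hb,
    Finset.sum_range_sub (fun i => γ i * v i), hγm, hvm]
  ring

lemma exists_periodic_coeff {m : ℕ} {a : ℕ → ℂ} (b : ℕ → ℂ) (ha : ∀ i, a i ≠ 0)
    (hlam : ∏ i ∈ Finset.range m, a i ≠ 1) :
    ∃ γ : ℕ → ℂ, (∀ i, γ (i + 1) * a i = γ i - b i) ∧ γ m = γ 0 := by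
  let g : ℕ → ℂ := fun i => Nat.rec 0 (fun i y => (y - b i) / a i) i
  have hg : ∀ i, g (i + 1) * a i = g i - b i := fun i => div_mul_cancel₀ _ (ha i)
  set A : ℕ → ℂ := fun i => ∏ j ∈ Finset.range i, a j with hA
  have hA0 : ∀ i, A i ≠ 0 := fun i => Finset.prod_ne_zero_iff.2 fun j _ => ha j
  have hAs : ∀ i, A (i + 1) = A i * a i := fun i => Finset.prod_range_succ a i
  set s : ℂ := g m * A m / (A m - 1) with hs
  have hne : A m - 1 ≠ 0 := sub_ne_zero.2 hlam
  refine ⟨fun i => s / A i + g i, fun i => ?_, ?_⟩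
  · have h1 := ha i
    have h2 := hA0 i
    show (s / A (i + 1) + g (i + 1)) * a i = s / A i + g i - b i
    rw [add_mul, hg, hAs]
    field_simp
    ring
  · have h2 := hA0 m
    have h3 : g 0 = 0 := rfl
    have h4 : A 0 = 1 := Finset.prod_range_zero _
    simp only [h3, h4, hs]
    field_simp
    ring

end CycleRecurrences

namespace Polynomial

section DualNumbers

open TrivSqZeroExt

/-- The dual numbers over `ℂ`. -/
local notation "𝔻" => TrivSqZeroExt ℂ ℂ

lemma fst_iterate_powAdd (d : ℕ) (c x : 𝔻) (i : ℕ) :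
    ((powAdd d c)^[i] x).fst = (powAdd d c.fst)^[i] x.fst :=
  map_iterate_powAdd (fstHom ℂ ℂ ℂ : 𝔻 →ₐ[ℂ] ℂ).toRingHom d c x i

lemma snd_iterate_powAdd (d : ℕ) (c x : 𝔻) (i : ℕ) :
    ((powAdd d c)^[i + 1] x).snd =
      d * (powAdd d c.fst)^[i] x.fst ^ (d - 1) * ((powAdd d c)^[i] x).snd + c.snd := by
  rw [Function.iterate_succ_apply', powAdd_apply, snd_add, snd_pow, fst_iterate_powAdd]
  simp [mul_assoc]

lemma snd_prod_eq {ι : Type*} (s : Finset ι) (u : ι → 𝔻) (hu : ∀ i ∈ s, (u i).fst ≠ 0) :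
    (∏ i ∈ s, u i).snd = (∏ i ∈ s, (u i).fst) * ∑ i ∈ s, (u i).snd / (u i).fst := by
  classical
  have hfst : ∀ t : Finset ι, (∏ i ∈ t, u i).fst = ∏ i ∈ t, (u i).fst := fun t =>
    map_prod (fstHom ℂ ℂ ℂ : 𝔻 →ₐ[ℂ] ℂ) u t
  induction s using Finset.induction_on with
  | empty => simp
  | insert i s hi ih =>
    rw [Finset.prod_insert hi, Finset.prod_insert hi, Finset.sum_insert hi, snd_mul,
      ih fun j hj => hu j (Finset.mem_insert_of_mem hj), hfst]
    have := hu i (Finset.mem_insert_self i s)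
    simp only [smul_eq_mul, MulOpposite.smul_eq_mul_unop, MulOpposite.unop_op]
    field_simp
    ring

lemma evalPt_mul_eq_zero_of_fst {P Q : ℂ[X][X]} {c x : 𝔻} (hP : evalPt c.fst x.fst P = 0)
    (hQ : evalPt c.fst x.fst Q = 0) : evalPt c x (P * Q) = 0 := by
  have h1 : (evalPt c x P).fst = 0 := (map_evalPt (fstHom ℂ ℂ ℂ) c x P).trans hP
  have h2 : (evalPt c x Q).fst = 0 := (map_evalPt (fstHom ℂ ℂ ℂ) c x Q).trans hQ
  rw [map_mul]
  ext <;> simp [h1, h2]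

lemma not_common_zero_of_minimalPeriod_eq {d n : ℕ} (hd : 2 ≤ d) (hn : 1 ≤ n) {P Q : ℂ[X][X]}
    (h : P * Q ∣ perPoly d n) {c x : ℂ} (hinj : Set.InjOn (fun i => (powAdd d c)^[i] x) (Set.Iio n))
    (hP : evalPt c x P = 0) : evalPt c x Q ≠ 0 := by
  intro hQ
  set X : ℕ → ℂ := fun i => (powAdd d c)^[i] x with hX
  have hper : X n = X 0 := by
    have h1 : evalPt c x (perPoly d n) = 0 := by
      obtain ⟨K, hK⟩ := h
      rw [hK, map_mul, map_mul, hP, zero_mul, zero_mul]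
    rw [evalPt_perPoly] at h1
    exact sub_eq_zero.1 h1
  have hdual : ∀ c' x' : 𝔻, c'.fst = c → x'.fst = x → (powAdd d c')^[n] x' = x' := by
    rintro c' x' rfl rfl
    obtain ⟨K, hK⟩ := h
    have h1 : evalPt c' x' (perPoly d n) = 0 := by
      rw [hK, map_mul, evalPt_mul_eq_zero_of_fst hP hQ, zero_mul]
    rw [evalPt_perPoly] at h1
    exact sub_eq_zero.1 h1
  set a : ℕ → ℂ := fun i => d * X i ^ (d - 1) with ha
  have hlam : ∏ i ∈ Finset.range n, a i = 1 := by
    have h1 := hdual (inl c) (inl x + inr 1) (by simp) (by simp)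
    have h2 : ∀ i, ((powAdd d (inl c))^[i] (inl x + inr 1 : 𝔻)).snd
        = ∏ j ∈ Finset.range i, a j := fun i => by
      induction i with
      | zero => simp
      | succ i ih => 
        rw [snd_iterate_powAdd, ih, Finset.prod_range_succ]
        simp [ha, hX, mul_comm]
    rw [← h2 n, h1]
    simp
  have hshift : ∀ i, X (i + n) = X i := fun i => by
    simp only [hX, Function.iterate_add_apply]
    exact congrArg _ hper
  have ha0 : ∀ i, a i ≠ 0 := by
    intro i
    have h1 : X i = X (i % n) := by
      have : ∀ q, X (i % n + n * q) = X (i % n) := fun q => by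
        induction q with
        | zero => simp
        | succ q ih => rw [Nat.mul_succ, ← add_assoc, hshift, ih]
      rw [← this (i / n), Nat.mod_add_div]
    have h2 : a (i % n) ≠ 0 :=
      Finset.prod_ne_zero_iff.1 (hlam ▸ one_ne_zero) _ (Finset.mem_range.2 (Nat.mod_lt i hn))
    simp only [ha, h1] at h2 ⊢
    exact h2
  set γ : ℕ → ℂ := fun i => (∏ j ∈ Finset.range i, a j)⁻¹ with hγ
  have hγrec : ∀ i, γ (i + 1) * a i = γ i - 0 := fun i => by
    simp only [hγ, Finset.prod_range_succ, mul_inv, sub_zero, mul_assoc]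
    rw [inv_mul_cancel₀ (ha0 i), mul_one]
  have hγm : γ n = γ 0 := by simp [hγ, hlam]
  set v : ℕ → ℂ := fun i => ((powAdd d (inl c + inr 1))^[i] (inl x : 𝔻)).snd with hv
  have hvrec : ∀ i, v (i + 1) = a i * v i + 1 := fun i => by
    simp only [hv]
    rw [snd_iterate_powAdd]
    simp [ha, hX]
  have hvm : v n = v 0 := by
    simp only [hv]
    rw [hdual _ _ (by simp) (by simp)]
    rfl
  have hX0 : ∀ i, X i ≠ 0 := fun i h0 => ha0 i (by
    simp only [ha, h0]
    rw [zero_pow (by omega), mul_zero])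
  have H : IsInvariantData d n c 0 X γ :=
    { map_eq := fun i => by simp only [hX, Function.iterate_succ_apply', powAdd_apply]
      periodic := hper
      ne_zero := hX0
      rec_eq := fun i => by simpa using hγrec i
      coeff_periodic := hγm
      sum_eq_zero := sum_coeff_eq_zero hγrec hvrec hγm hvm (by simp) }
  have h1 := (H.eq_zero hd hn hinj (by rw [← norm_prod, hlam, norm_one])).2 0 hn
  simp [hγ] at h1

lemma not_common_zero_of_minimalPeriod_lt {d m r : ℕ} (hd : 2 ≤ d) (hm : 1 ≤ m) (hr : 2 ≤ r)
    {P Q : ℂ[X][X]} (h : perPoly d m * (P * Q) ∣ perPoly d (m * r)) {c x : ℂ}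
    (hper : (powAdd d c)^[m] x = x)
    (hinj : Set.InjOn (fun i => (powAdd d c)^[i] x) (Set.Iio m))
    (hP : evalPt c x P = 0) : evalPt c x Q ≠ 0 := by
  intro hQ
  obtain ⟨S, hS, hev⟩ := perPoly_mul d m r
  obtain ⟨K, hK⟩ : P * Q ∣ S := by
    rw [hS] at h
    exact (mul_dvd_mul_iff_left (perPoly_monic_natDegree hd hm).1.ne_zero).1 h
  set X : ℕ → ℂ := fun i => (powAdd d c)^[i] x with hX
  set a : ℕ → ℂ := fun i => d * X i ^ (d - 1) with ha
  set lam : ℂ := ∏ i ∈ Finset.range m, a i with hlamdef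
  have hgeom : ∑ j ∈ Finset.range r, lam ^ j = 0 := by
    rw [← hev ℂ c x hper, hK, map_mul, map_mul, hP, zero_mul, zero_mul]
  have hlam1 : lam ≠ 1 := by
    intro h1
    rw [h1] at hgeom
    simp at hgeom
    omega
  have hlamr : lam ^ r = 1 := by
    have := mul_geom_sum lam r
    rw [hgeom, mul_zero] at this
    exact (sub_eq_zero.1 this.symm)
  have hlam0 : lam ≠ 0 := by
    intro h0
    rw [h0, zero_pow (by omega)] at hlamr
    exact zero_ne_one hlamr
  have hshift : ∀ i, X (i + m) = X i := fun i => by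
    simp only [hX, Function.iterate_add_apply, hper]
  have ha0 : ∀ i, a i ≠ 0 := by
    intro i
    have h1 : X i = X (i % m) := by
      have : ∀ q, X (i % m + m * q) = X (i % m) := fun q => by
        induction q with
        | zero => simp
        | succ q ih => rw [Nat.mul_succ, ← add_assoc, hshift, ih]
      rw [← this (i / m), Nat.mod_add_div]
    have h2 : a (i % m) ≠ 0 :=
      Finset.prod_ne_zero_iff.1 hlam0 _ (Finset.mem_range.2 (Nat.mod_lt i hm))
    simp only [ha, h1] at h2 ⊢
    exact h2
  have hX0 : ∀ i, X i ≠ 0 := fun i h0 => ha0 i (by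
    simp only [ha, h0]
    rw [zero_pow (by omega), mul_zero])
  -- the first-order motion of the periodic point
  obtain ⟨y, hy⟩ : ∃ y : ℂ, (powAdd d (inl c + inr 1))^[m] (inl x + inr y : 𝔻) = inl x + inr y := by
    have h1 : ∀ (y : ℂ) i, ((powAdd d (inl c + inr 1))^[i] (inl x + inr y : 𝔻)).snd
        = ((powAdd d (inl c + inr 1))^[i] (inl x : 𝔻)).snd + (∏ j ∈ Finset.range i, a j) * y := by
      intro y i
      induction i with
      | zero => simp
      | succ i ih =>
        rw [snd_iterate_powAdd, snd_iterate_powAdd, ih, Finset.prod_range_succ]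
        simp [ha, hX]
        ring
    set w := ((powAdd d (inl c + inr 1))^[m] (inl x : 𝔻)).snd with hw
    refine ⟨w / (1 - lam), ?_⟩
    have h2 : 1 - lam ≠ 0 := sub_ne_zero.2 hlam1.symm
    ext
    · rw [fst_iterate_powAdd]
      simpa using hper
    · rw [h1]
      simp only [← hlamdef, ← hw, snd_add, snd_inl, snd_inr, zero_add]
      field_simp
      ring
  set v : ℕ → ℂ := fun i => ((powAdd d (inl c + inr 1))^[i] (inl x + inr y : 𝔻)).snd with hv
  have hvrec : ∀ i, v (i + 1) = a i * v i + 1 := fun i => by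
    simp only [hv]
    rw [snd_iterate_powAdd]
    simp [ha, hX]
  have hvm : v m = v 0 := by
    simp only [hv]
    rw [hy]
    rfl
  have hsum : ∑ i ∈ Finset.range m, 1 * (d - 1) / X i * v i = 0 := by
    set u : ℕ → 𝔻 := fun i =>
      (d : 𝔻) * (powAdd d (inl c + inr 1))^[i] (inl x + inr y : 𝔻) ^ (d - 1) with hu
    have hufst : ∀ i, (u i).fst = a i := fun i => by
      simp [hu, fst_mul, fst_pow, fst_iterate_powAdd, ha, hX]
    have husnd : ∀ i, (u i).snd = a i * ((d - 1) / X i * v i) := fun i => by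
      have h1 : (powAdd d c)^[i] x ≠ 0 := hX0 i
      have h2 : ((d - 1 : ℕ) : ℂ) = d - 1 := by rw [Nat.cast_sub (by omega), Nat.cast_one]
      have h3 : ((powAdd d c)^[i] x) ^ (d - 1) =
          ((powAdd d c)^[i] x) ^ (d - 2) * (powAdd d c)^[i] x := by
        rw [← pow_succ]; congr 1; omega
      simp only [hu, snd_mul, snd_pow, fst_pow, fst_iterate_powAdd, ha, hv, hX, fst_natCast,
        snd_natCast, fst_add, fst_inl, fst_inr, add_zero, smul_zero, smul_eq_mul,
        nsmul_eq_mul, h3, h2, Nat.pred_eq_sub_one, show d - 1 - 1 = d - 2 by omega]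
      field_simp
    set Λ : 𝔻 := ∏ i ∈ Finset.range m, u i with hΛ
    have hfst : Λ.fst = lam := by
      have := map_prod (fstHom ℂ ℂ ℂ : 𝔻 →ₐ[ℂ] ℂ) u (Finset.range m)
      simp only [fstHom_apply, hufst] at this
      exact this
    have hΛr : Λ ^ r = 1 := by
      have h1 : ∑ j ∈ Finset.range r, Λ ^ j = 0 := by
        rw [← hev 𝔻 (inl c + inr 1) (inl x + inr y) hy, hK, map_mul,
          evalPt_mul_eq_zero_of_fst (by simpa using hP) (by simpa using hQ), zero_mul]
      have := mul_geom_sum Λ r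
      rw [h1, mul_zero] at this
      exact (sub_eq_zero.1 this.symm)
    have h2 : Λ.snd = 0 := by
      have h3 := congrArg snd hΛr
      rw [snd_pow, hfst] at h3
      simp [hlam0] at h3
      rcases h3 with h3 | h3
      · omega
      · exact h3
    rw [hΛ, snd_prod_eq _ _ fun i _ => by rw [hufst]; exact ha0 i] at h2
    simp only [hufst, husnd] at h2
    rw [← hlamdef, mul_eq_zero, or_iff_right hlam0] at h2
    rw [← h2]
    refine Finset.sum_congr rfl fun i _ => ?_
    rw [mul_div_cancel_left₀ _ (ha0 i), one_mul]
  obtain ⟨γ, hγrec, hγm⟩ := exists_periodic_coeff (m := m) (fun i => 1 * (d - 1) / X i) ha0 hlam1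
  have H : IsInvariantData d m c 1 X γ :=
    { map_eq := fun i => by simp only [hX, Function.iterate_succ_apply', powAdd_apply]
      periodic := hper
      ne_zero := hX0
      rec_eq := hγrec
      coeff_periodic := hγm
      sum_eq_zero := sum_coeff_eq_zero hγrec hvrec hγm hvm hsum }
  have hnorm : ‖lam‖ = 1 := by
    have h1 : ‖lam‖ ^ r = 1 := by rw [← norm_pow, hlamr, norm_one]
    exact (pow_eq_one_iff_of_nonneg (norm_nonneg _) (by omega)).1 h1
  exact one_ne_zero (H.eq_zero hd hm hinj (by rw [← norm_prod]; exact hnorm)).1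

/-- The plane curves cut out by two complementary factors of a dynatomic polynomial are disjoint,
because the dynatomic curve is smooth. -/
theorem not_common_zero {d n : ℕ} (hd : 2 ≤ d) (hn : 1 ≤ n) {P Q : ℂ[X][X]}
    (h : P * Q = dynPoly d n) {c x : ℂ} (hP : evalPt c x P = 0) : evalPt c x Q ≠ 0 := by
  have hprod := (dynPoly_monic_and_prod hd n hn).2
  have h1 : P * Q ∣ perPoly d n := by
    rw [h, ← hprod]
    exact Finset.dvd_prod_of_mem _ (Nat.mem_divisors_self n (by omega))
  have hper : Function.IsPeriodicPt (powAdd d c) n x := by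
    obtain ⟨K, hK⟩ := h1
    have h1 : evalPt c x (perPoly d n) = 0 := by
      rw [hK, map_mul, map_mul, hP, zero_mul, zero_mul]
    rw [evalPt_perPoly] at h1
    exact sub_eq_zero.1 h1
  have hinj := Function.iterate_injOn_Iio_minimalPeriod (f := powAdd d c) (x := x)
  have hmp : Function.IsPeriodicPt (powAdd d c) (Function.minimalPeriod (powAdd d c) x) x :=
    Function.isPeriodicPt_minimalPeriod _ _
  have hpos : 0 < Function.minimalPeriod (powAdd d c) x := hper.minimalPeriod_pos hn
  obtain ⟨r, hr⟩ := hper.minimalPeriod_dvd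
  set m := Function.minimalPeriod (powAdd d c) x
  rcases Nat.lt_or_ge r 2 with h2 | h2
  · have hr1 : r = 1 := by
      rcases Nat.eq_zero_or_pos r with rfl | h3
      · omega
      · omega
    have hnm : n = m := by rw [hr, hr1, mul_one]
    exact not_common_zero_of_minimalPeriod_eq hd hn h1 (by rw [hnm]; exact hinj) hP
  · refine not_common_zero_of_minimalPeriod_lt hd hpos h2 ?_ hmp hinj hP
    have hlt : m < n := by rw [hr]; nlinarith
    rw [h, ← hr, ← hprod, ← (dynPoly_monic_and_prod hd m hpos).2,
      ← Nat.insert_self_properDivisors (show n ≠ 0 by omega),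
      Finset.prod_insert Nat.self_notMem_properDivisors, mul_comm (dynPoly d n)]
    refine mul_dvd_mul_right (Finset.prod_dvd_prod_of_subset _ _ _ fun k hk => ?_) _
    have hkm := Nat.dvd_of_mem_divisors hk
    exact Nat.mem_properDivisors.2 ⟨hkm.trans ⟨r, hr⟩, (Nat.le_of_dvd hpos hkm).trans_lt hlt⟩

end DualNumbers

end Polynomial

section Words

variable {n d : ℕ}

/-- The prefix of length `j` of a word, padded with `none`. -/
def wordPrefix (j : ℕ) (x : Fin n → Fin d) : Fin n → Option (Fin d) :=
  fun i => if (i : ℕ) < j then some (x i) else none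

lemma wordPrefix_eq_iff {j : ℕ} {x y : Fin n → Fin d} :
    wordPrefix j x = wordPrefix j y ↔ ∀ i : Fin n, (i : ℕ) < j → x i = y i := by
  rw [funext_iff]
  refine forall_congr' fun i => ?_
  by_cases h : (i : ℕ) < j <;> simp [wordPrefix, h]

/-- The exponent of the distance between the periodic points with codes `x` and `y`. -/
def codeExp (x y : Fin n → Fin d) : ℤ :=
  1 - ((d : ℤ) - 1) * ∑ j ∈ Finset.Ico 1 n, if wordPrefix j x = wordPrefix j y then 1 else 0

lemma codeExp_comm (x y : Fin n → Fin d) : codeExp x y = codeExp y x := by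
  simp only [codeExp, eq_comm]

/-- The sum of the distance exponents over all pairs in `A × B`. -/
def codeSum (A B : Finset (Fin n → Fin d)) : ℤ := ∑ x ∈ A, ∑ y ∈ B, codeExp x y

lemma codeSum_comm (A B : Finset (Fin n → Fin d)) : codeSum A B = codeSum B A := by
  rw [codeSum, Finset.sum_comm]
  simp only [codeSum, codeExp_comm]

/-- The periodic word of period `m` with prescribed first `m` letters. -/
def periodicWord {m : ℕ} (hm : 0 < m) (v : Fin m → Fin d) : Fin n → Fin d :=
  fun i => v ⟨i % m, Nat.mod_lt _ hm⟩

lemma periodicWord_injective {m : ℕ} (hm : 0 < m) (hmn : m ≤ n) :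
    Function.Injective (periodicWord hm : (Fin m → Fin d) → Fin n → Fin d) := by
  intro v v' h
  ext i
  have := congrFun h ⟨i, i.2.trans_le hmn⟩
  simp only [periodicWord, Nat.mod_eq_of_lt i.2] at this
  rw [this]

/-- The number of words of period `m` whose prefix of length `j` agrees with that of `x`. -/
def prefixCount {m : ℕ} (hm : 0 < m) (j : ℕ) (x : Fin n → Fin d) : ℕ :=
  (Finset.univ.filter fun v : Fin m → Fin d =>
    wordPrefix j x = wordPrefix j (periodicWord hm v)).card

lemma prefixCount_of_le {m : ℕ} (hm : 0 < m) (hmn : m ≤ n) {j : ℕ} (hj : j ≤ m)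
    (x : Fin n → Fin d) : prefixCount hm j x = d ^ (m - j) := by
  have h1 : (Finset.univ.filter fun v : Fin m → Fin d =>
      wordPrefix j x = wordPrefix j (periodicWord hm v)) =
      Fintype.piFinset fun i : Fin m =>
        if (i : ℕ) < j then {x (Fin.castLE hmn i)} else Finset.univ := by
    ext v
    simp only [Finset.mem_filter, Finset.mem_univ, true_and, Fintype.mem_piFinset,
      wordPrefix_eq_iff]
    constructor
    · intro h i
      split_ifs with hi
      · have := h (Fin.castLE hmn i) hi
        simp only [periodicWord, Fin.val_castLE, Nat.mod_eq_of_lt i.2] at this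
        simp [this]
      · simp
    · intro h i hi
      have := h ⟨i, by omega⟩
      simp only [hi, if_true, Finset.mem_singleton] at this
      simp only [periodicWord, Nat.mod_eq_of_lt (hi.trans_le hj), this]
      rfl
  rw [prefixCount, h1, Fintype.card_piFinset]
  have h2 : ∀ i : Fin m, (if (i : ℕ) < j then {x (Fin.castLE hmn i)} else Finset.univ
      : Finset (Fin d)).card = if (i : ℕ) < j then 1 else d := fun i => by
    split_ifs <;> simp
  simp only [h2]
  rw [Fin.prod_univ_eq_prod_range (fun i => if i < j then 1 else d) m, Finset.prod_ite,
    Finset.prod_const_one, one_mul, Finset.prod_const]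
  congr 1
  have h3 : (Finset.range m).filter (fun i => ¬ i < j) = Finset.Ico j m := by
    ext i; simp; omega
  rw [h3, Nat.card_Ico]

lemma prefixCount_le_one {m : ℕ} (hm : 0 < m) (hmn : m ≤ n) {j : ℕ} (hj : m ≤ j)
    (x : Fin n → Fin d) : prefixCount hm j x ≤ 1 := by
  refine Finset.card_le_one.2 fun v hv v' hv' => ?_
  simp only [Finset.mem_filter, Finset.mem_univ, true_and] at hv hv'
  have h := wordPrefix_eq_iff.1 (hv.symm.trans hv')
  ext i
  have := h ⟨i, i.2.trans_le hmn⟩ (i.2.trans_le hj)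
  simp only [periodicWord, Nat.mod_eq_of_lt i.2] at this
  rw [this]

lemma one_le_prefixCount_succ {m : ℕ} (hm : 0 < m) (hmn : m < n) (x : Fin n → Fin d)
    (hx : x ⟨0, by omega⟩ = x ⟨m, hmn⟩) : 1 ≤ prefixCount hm (m + 1) x := by
  refine Finset.card_pos.2 ⟨fun i => x (Fin.castLE hmn.le i), ?_⟩
  simp only [Finset.mem_filter, Finset.mem_univ, true_and, wordPrefix_eq_iff]
  intro i hi
  rcases Nat.lt_or_ge i m with h | h
  · simp only [periodicWord]
    congr 1
    ext
    simp [Nat.mod_eq_of_lt h]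
  · have him : i = ⟨m, hmn⟩ := by ext; simp; omega
    rw [him, ← hx]
    simp only [periodicWord]
    congr 1
    ext
    simp

lemma sum_codeExp_periodicWord {m : ℕ} (hm : 0 < m) (x : Fin n → Fin d) :
    ∑ v : Fin m → Fin d, codeExp x (periodicWord hm v) =
      d ^ m - ((d : ℤ) - 1) * ∑ j ∈ Finset.Ico 1 n, (prefixCount hm j x : ℤ) := by
  simp only [codeExp, Finset.sum_sub_distrib, ← Finset.mul_sum]
  rw [Finset.sum_comm]
  simp [prefixCount]

lemma sub_one_mul_sum_Ico_pow (d m k : ℕ) :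
    ((d : ℤ) - 1) * ∑ j ∈ Finset.Ico 1 (k + 1), (d : ℤ) ^ (m + k - j) = d ^ (m + k) - d ^ m := by
  induction k with
  | zero => simp
  | succ k ih =>
    rw [Finset.sum_Ico_eq_sum_range] at ih ⊢
    simp only [Nat.add_sub_cancel] at ih ⊢
    rw [Finset.sum_range_succ', mul_add]
    have : ∀ i ∈ Finset.range k, (d : ℤ) ^ (m + (k + 1) - (1 + (i + 1))) =
        (d : ℤ) ^ (m + k - (1 + i)) := fun i _ => by congr 1; omega
    rw [Finset.sum_congr rfl this, ih, show m + (k + 1) - (1 + 0) = m + k by omega]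
    ring

lemma sum_codeExp (hn : 0 < n) (x : Fin n → Fin d) :
    ∑ y : Fin n → Fin d, codeExp x y = d := by
  have h1 := sum_codeExp_periodicWord hn x
  have h2 : ∀ y : Fin n → Fin d, (periodicWord hn y : Fin n → Fin d) = y := fun y => by
    ext i; simp [periodicWord, Nat.mod_eq_of_lt i.2]
  simp only [h2] at h1
  have h3 : ∀ j ∈ Finset.Ico 1 n, (prefixCount hn j x : ℤ) = (d : ℤ) ^ (n - j) := fun j hj => by
    rw [prefixCount_of_le hn le_rfl (Finset.mem_Ico.1 hj).2.le]; simp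
  rw [h1, Finset.sum_congr rfl h3]
  have h4 := sub_one_mul_sum_Ico_pow d 1 (n - 1)
  rw [Nat.sub_add_cancel hn, Nat.add_sub_cancel' hn, pow_one] at h4
  rw [h4]
  ring

lemma sum_codeExp_periodicWord_of_lt {m : ℕ} (hm : 0 < m) (hmn : m < n) (x : Fin n → Fin d) :
    ∑ v : Fin m → Fin d, codeExp x (periodicWord hm v) =
      1 - ((d : ℤ) - 1) * ∑ j ∈ Finset.Ico (m + 1) n, (prefixCount hm j x : ℤ) := by
  rw [sum_codeExp_periodicWord, ← Finset.sum_Ico_consecutive _ (show 1 ≤ m + 1 by omega) hmn]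
  have h3 : ∀ j ∈ Finset.Ico 1 (m + 1), (prefixCount hm j x : ℤ) = (d : ℤ) ^ (0 + m - j) :=
    fun j hj => by
      rw [prefixCount_of_le hm hmn.le (by have := (Finset.mem_Ico.1 hj).2; omega)]; simp
  rw [Finset.sum_congr rfl h3, mul_add, sub_one_mul_sum_Ico_pow]
  simp only [zero_add, pow_zero]
  ring

lemma sum_codeExp_periodicWord_le (hd : 1 ≤ d) {m : ℕ} (hm : 0 < m) (hmn : m < n)
    (x : Fin n → Fin d) : ∑ v : Fin m → Fin d, codeExp x (periodicWord hm v) ≤ 1 := by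
  rw [sum_codeExp_periodicWord_of_lt hm hmn]
  have : (0 : ℤ) ≤ d - 1 := by have : (1 : ℤ) ≤ d := by exact_mod_cast hd
                               linarith
  have : 0 ≤ ((d : ℤ) - 1) * ∑ j ∈ Finset.Ico (m + 1) n, (prefixCount hm j x : ℤ) := by positivity
  linarith

lemma sum_codeExp_periodicWord_lt (hd : 2 ≤ d) {m : ℕ} (hm : 0 < m) (hmn : m + 1 < n)
    (x : Fin n → Fin d) (hx : x ⟨0, by omega⟩ = x ⟨m, by omega⟩) :
    ∑ v : Fin m → Fin d, codeExp x (periodicWord hm v) < 1 := by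
  rw [sum_codeExp_periodicWord_of_lt hm (by omega)]
  have h1 : (2 : ℤ) ≤ d := by exact_mod_cast hd
  have h2 : (1 : ℤ) ≤ ∑ j ∈ Finset.Ico (m + 1) n, (prefixCount hm j x : ℤ) := by
    refine le_trans ?_ (Finset.single_le_sum (f := fun j => (prefixCount hm j x : ℤ))
      (fun j _ => by positivity) (Finset.mem_Ico.2 ⟨le_rfl, hmn⟩))
    exact_mod_cast one_le_prefixCount_succ hm (by omega) x hx
  nlinarith

lemma le_sum_codeExp_periodicWord (hd : 1 ≤ d) {m : ℕ} (hm : 0 < m) (hmn : m < n)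
    (x : Fin n → Fin d) :
    (d : ℤ) - n * (d - 1) ≤ ∑ v : Fin m → Fin d, codeExp x (periodicWord hm v) := by
  rw [sum_codeExp_periodicWord_of_lt hm hmn]
  have h1 : (1 : ℤ) ≤ d := by exact_mod_cast hd
  have h2 : ∑ j ∈ Finset.Ico (m + 1) n, (prefixCount hm j x : ℤ) ≤ n - 1 := by
    refine (Finset.sum_le_card_nsmul _ _ 1 fun j hj => ?_).trans ?_
    · exact_mod_cast prefixCount_le_one hm hmn.le (by have := (Finset.mem_Ico.1 hj).1; omega) x
    · rw [Nat.card_Ico, nsmul_one, Nat.cast_sub hmn]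
      push_cast
      have : (1 : ℤ) ≤ m := by exact_mod_cast hm
      linarith
  nlinarith

end Words

section Words

lemma sum_sum_ite_eq {α β : Type*} [Fintype β] [DecidableEq β] (p : α → β) (A : Finset α)
    (δ : α → ℤ) : ∑ x ∈ A, ∑ y ∈ A, (if p x = p y then δ x * δ y else 0) =
      ∑ v : β, (∑ x ∈ A, if p x = v then δ x else 0) ^ 2 := by
  simp only [sq, Finset.sum_mul_sum]
  rw [Finset.sum_comm]
  conv_rhs => rw [Finset.sum_comm]
  rw [Finset.sum_comm]
  refine Finset.sum_congr rfl fun x _ => ?_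
  rw [Finset.sum_comm]
  refine Finset.sum_congr rfl fun y _ => ?_
  rw [Finset.sum_eq_single (p x)]
  · simp [eq_comm]
  · intro v _ hv
    simp [hv.symm]
  · simp

lemma card_sq_le_mul_sum {α β : Type*} [Fintype β] [DecidableEq β] (p : α → β) (A : Finset α) :
    (A.card : ℤ) ^ 2 ≤ Fintype.card β * ∑ x ∈ A, ∑ y ∈ A, if p x = p y then 1 else 0 := by
  have h := sum_sum_ite_eq p A fun _ => 1
  simp only [mul_one] at h
  rw [h]
  have h2 : (A.card : ℤ) = ∑ v : β, ∑ x ∈ A, if p x = v then 1 else 0 := by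
    rw [Finset.sum_comm]; simp
  rw [h2]
  exact sq_sum_le_card_mul_sum_sq

variable {n d : ℕ}

lemma sum_mul_codeExp_nonpos (hd : 1 ≤ d) (A : Finset (Fin n → Fin d)) (δ : (Fin n → Fin d) → ℤ)
    (hδ : ∑ x ∈ A, δ x = 0) : ∑ x ∈ A, ∑ y ∈ A, δ x * δ y * codeExp x y ≤ 0 := by
  have h1 : ∑ x ∈ A, ∑ y ∈ A, δ x * δ y * codeExp x y = (∑ x ∈ A, δ x) * (∑ x ∈ A, δ x) -
      ((d : ℤ) - 1) * ∑ j ∈ Finset.Ico 1 n, ∑ x ∈ A, ∑ y ∈ A,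
        if wordPrefix j x = wordPrefix j y then δ x * δ y else 0 := by
    rw [Finset.sum_mul_sum, Finset.sum_comm (s := Finset.Ico 1 n), Finset.mul_sum,
      ← Finset.sum_sub_distrib]
    refine Finset.sum_congr rfl fun x _ => ?_
    rw [Finset.sum_comm (s := Finset.Ico 1 n), Finset.mul_sum, ← Finset.sum_sub_distrib]
    refine Finset.sum_congr rfl fun y _ => ?_
    rw [codeExp, mul_sub, mul_one, mul_left_comm, Finset.mul_sum]
    simp only [mul_ite, mul_one, mul_zero]
  rw [h1, hδ, zero_mul, zero_sub, neg_nonpos]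
  have : (0 : ℤ) ≤ d - 1 := by have : (1 : ℤ) ≤ d := by exact_mod_cast hd
                               linarith
  refine mul_nonneg this (Finset.sum_nonneg fun j _ => ?_)
  rw [sum_sum_ite_eq]
  positivity

/-- The Lorentzian signature of the exponent form gives an inequality between the self-energies
and the mutual energy of two disjoint sets of words. -/
lemma codeSum_lorentz (hd : 1 ≤ d) {P Q : Finset (Fin n → Fin d)} (hPQ : Disjoint P Q) :
    (Q.card : ℤ) ^ 2 * codeSum P P + (P.card : ℤ) ^ 2 * codeSum Q Q ≤
      2 * (P.card * Q.card) * codeSum P Q := by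
  classical
  set δ : (Fin n → Fin d) → ℤ := fun x => if x ∈ P then Q.card else -P.card with hδdef
  have hP : ∀ x ∈ P, δ x = Q.card := fun x hx => if_pos hx
  have hQ : ∀ x ∈ Q, δ x = -P.card := fun x hx => if_neg fun hx' =>
    Finset.disjoint_left.1 hPQ hx' hx
  have h0 : ∑ x ∈ P ∪ Q, δ x = 0 := by
    rw [Finset.sum_union hPQ, Finset.sum_congr rfl hP, Finset.sum_congr rfl hQ]
    simp [mul_comm]
  have h1 := sum_mul_codeExp_nonpos hd (P ∪ Q) δ h0
  have h2 : ∀ (A B : Finset (Fin n → Fin d)) (s t : ℤ), (∀ x ∈ A, δ x = s) → (∀ x ∈ B, δ x = t) →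
      ∑ x ∈ A, ∑ y ∈ B, δ x * δ y * codeExp x y = s * t * codeSum A B := fun A B s t hA hB => by
    rw [codeSum, Finset.mul_sum]
    refine Finset.sum_congr rfl fun x hx => ?_
    rw [Finset.mul_sum]
    exact Finset.sum_congr rfl fun y hy => by rw [hA x hx, hB y hy]
  simp only [Finset.sum_union hPQ, Finset.sum_add_distrib] at h1
  rw [h2 P P _ _ hP hP, h2 P Q _ _ hP hQ, h2 Q P _ _ hQ hP, h2 Q Q _ _ hQ hQ,
    codeSum_comm Q P] at h1
  linarith

lemma card_sq_le_pow_mul_sum (A : Finset (Fin n → Fin d)) {j : ℕ} (hj : j ≤ n) :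
    (A.card : ℤ) ^ 2 ≤ d ^ j * ∑ x ∈ A, ∑ y ∈ A,
      if wordPrefix j x = wordPrefix j y then 1 else 0 := by
  have h := card_sq_le_mul_sum
    (fun (x : Fin n → Fin d) (i : Fin j) => x (Fin.castLE hj i)) A
  have h1 : ∀ x y : Fin n → Fin d, (fun i : Fin j => x (Fin.castLE hj i)) =
      (fun i : Fin j => y (Fin.castLE hj i)) ↔ wordPrefix j x = wordPrefix j y := fun x y => by
    rw [wordPrefix_eq_iff, funext_iff]
    exact ⟨fun h i hi => h ⟨i, hi⟩, fun h i => h _ i.2⟩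
  simp only [h1] at h
  simpa using h

lemma codeSum_self_eq (A : Finset (Fin n → Fin d)) :
    codeSum A A = (A.card : ℤ) ^ 2 - ((d : ℤ) - 1) * ∑ j ∈ Finset.Ico 1 n, ∑ x ∈ A, ∑ y ∈ A,
      if wordPrefix j x = wordPrefix j y then 1 else 0 := by
  rw [Finset.sum_comm (s := Finset.Ico 1 n), Finset.mul_sum, sq]
  have : (A.card : ℤ) * A.card = ∑ x ∈ A, (A.card : ℤ) := by simp
  rw [this, ← Finset.sum_sub_distrib]
  refine Finset.sum_congr rfl fun x _ => ?_
  rw [Finset.sum_comm (s := Finset.Ico 1 n), Finset.mul_sum]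
  have : (A.card : ℤ) = ∑ x ∈ A, 1 := by simp
  rw [this, ← Finset.sum_sub_distrib]
  rfl

lemma card_le_sum_sum_ite (A : Finset (Fin n → Fin d)) (j : ℕ) :
    (A.card : ℤ) ≤ ∑ x ∈ A, ∑ y ∈ A, if wordPrefix j x = wordPrefix j y then 1 else 0 := by
  have : (A.card : ℤ) = ∑ x ∈ A, 1 := by simp
  rw [this]
  refine Finset.sum_le_sum fun x hx => ?_
  refine le_trans ?_ (Finset.single_le_sum
    (f := fun y => if wordPrefix j x = wordPrefix j y then (1 : ℤ) else 0)
    (fun y _ => by positivity) hx)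
  simp

/-- Upper bound for the self-energy of a set of words. -/
lemma pow_mul_codeSum_self_le (hd : 1 ≤ d) (A : Finset (Fin n → Fin d)) {k : ℕ} (hk : k + 1 ≤ n) :
    (d : ℤ) ^ k * codeSum A A ≤
      (A.card : ℤ) ^ 2 - d ^ k * ((d - 1) * ((n - 1 - k) * A.card)) := by
  have hd' : (1 : ℤ) ≤ d := by exact_mod_cast hd
  set S : ℕ → ℤ := fun j => ∑ x ∈ A, ∑ y ∈ A, if wordPrefix j x = wordPrefix j y then 1 else 0
    with hS
  have h1 : ∀ k, k ≤ n → (A.card : ℤ) ^ 2 * (d ^ k - 1) ≤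
      d ^ k * ((d - 1) * ∑ j ∈ Finset.Ico 1 (k + 1), S j) := fun k => by
    induction k with
    | zero => simp
    | succ k ih =>
      intro hk
      have ih := ih (by omega)
      have hS1 : (A.card : ℤ) ^ 2 ≤ d ^ (k + 1) * S (k + 1) := card_sq_le_pow_mul_sum A hk
      rw [Finset.sum_Ico_succ_top (by omega)]
      have h2 := mul_le_mul_of_nonneg_left ih (show (0 : ℤ) ≤ d by linarith)
      have h3 := mul_le_mul_of_nonneg_left hS1 (show (0 : ℤ) ≤ d - 1 by linarith)
      rw [pow_succ (d : ℤ)] at h3 ⊢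
      linarith
  have h2 : (n - 1 - k : ℤ) * A.card ≤ ∑ j ∈ Finset.Ico (k + 1) n, S j := by
    refine le_trans ?_ (Finset.card_nsmul_le_sum _ _ (A.card : ℤ)
      fun j _ => card_le_sum_sum_ite A j)
    rw [Nat.card_Ico, nsmul_eq_mul, Nat.cast_sub hk]
    push_cast
    rw [sub_sub, add_comm (1 : ℤ)]
  have h3 := h1 k (by omega)
  rw [codeSum_self_eq, ← Finset.sum_Ico_consecutive _ (show 1 ≤ k + 1 by omega) hk]
  have h4 : (0 : ℤ) ≤ d ^ k * (d - 1) := mul_nonneg (by positivity) (by linarith)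
  have h5 := mul_le_mul_of_nonneg_left h2 h4
  linarith

end Words

section Words

variable {n d : ℕ}

/-- A partition of the words of length `n` according to their exact period, with the words of
exact period `n` split into `P` and `Q`, satisfying the positivity conditions on exponent sums
that come from resultants. -/
structure IsCodePartition (P Q : Finset (Fin n → Fin d)) (E : ℕ → Finset (Fin n → Fin d)) :
    Prop where
  disjoint : Disjoint P Q
  union_eq : P ∪ Q = E n
  disjoint_exact : ∀ m ∈ n.divisors, ∀ e ∈ n.divisors, m ≠ e → Disjoint (E m) (E e)
  periodic : ∀ m (_ : m ∣ n) (hm : 0 < m),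
    m.divisors.biUnion E = Finset.univ.image (periodicWord hm)
  nonneg : ∀ m ∈ n.divisors, ∀ e ∈ n.divisors, m ≠ e → 0 ≤ codeSum (E m) (E e)
  nonneg_left : ∀ m ∈ n.properDivisors, 0 ≤ codeSum P (E m)
  nonneg_right : ∀ m ∈ n.properDivisors, 0 ≤ codeSum Q (E m)
  nonpos : codeSum P Q ≤ 0

namespace IsCodePartition

variable {P Q : Finset (Fin n → Fin d)} {E : ℕ → Finset (Fin n → Fin d)}

lemma symm (H : IsCodePartition P Q E) : IsCodePartition Q P E :=
  { H with
    disjoint := H.disjoint.symm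
    union_eq := by rw [Finset.union_comm, H.union_eq]
    nonneg_left := H.nonneg_right
    nonneg_right := H.nonneg_left
    nonpos := by rw [codeSum_comm]; exact H.nonpos }

lemma sum_divisors_codeSum (H : IsCodePartition P Q E) (hn : 0 < n) {m : ℕ} (hmn : m ∣ n)
    (hm : 0 < m) (A : Finset (Fin n → Fin d)) :
    ∑ e ∈ m.divisors, codeSum A (E e) =
      ∑ x ∈ A, ∑ v : Fin m → Fin d, codeExp x (periodicWord hm v) := by
  simp only [codeSum]
  rw [Finset.sum_comm]
  refine Finset.sum_congr rfl fun x _ => ?_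
  rw [← Finset.sum_biUnion, H.periodic m hmn hm, Finset.sum_image]
  · exact fun _ _ _ _ h => periodicWord_injective hm (Nat.le_of_dvd hn hmn) h
  · intro a ha b hb hab
    refine H.disjoint_exact a ?_ b ?_ hab
    · exact Nat.mem_divisors.2 ⟨(Nat.dvd_of_mem_divisors ha).trans hmn, hn.ne'⟩
    · exact Nat.mem_divisors.2 ⟨(Nat.dvd_of_mem_divisors hb).trans hmn, hn.ne'⟩

lemma sum_divisors_codeSum_self (H : IsCodePartition P Q E) (hn : 0 < n)
    (A : Finset (Fin n → Fin d)) : ∑ e ∈ n.divisors, codeSum A (E e) = A.card * d := by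
  rw [H.sum_divisors_codeSum hn dvd_rfl hn]
  have h2 : ∀ y : Fin n → Fin d, (periodicWord hn y : Fin n → Fin d) = y := fun y => by
    ext i; simp [periodicWord, Nat.mod_eq_of_lt i.2]
  simp only [h2, sum_codeExp hn]
  simp

lemma codeSum_self_add (H : IsCodePartition P Q E) (hn : 0 < n) :
    codeSum P P + codeSum P Q + ∑ m ∈ n.properDivisors, codeSum P (E m) = P.card * d := by
  rw [← H.sum_divisors_codeSum_self hn P, ← Nat.insert_self_properDivisors hn.ne',
    Finset.sum_insert Nat.self_notMem_properDivisors, ← H.union_eq]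
  congr 1
  simp only [codeSum, ← Finset.sum_add_distrib, Finset.sum_union H.disjoint]

lemma div_prime_mem_properDivisors {q : ℕ} (hq : q ∈ n.primeFactors) :
    n / q ∈ n.properDivisors :=
  Nat.mem_properDivisors.2 ⟨Nat.div_dvd_of_dvd (Nat.dvd_of_mem_primeFactors hq),
    Nat.div_lt_self (Nat.pos_of_ne_zero (Nat.mem_primeFactors.1 hq).2.2)
      (Nat.prime_of_mem_primeFactors hq).one_lt⟩

lemma sum_properDivisors_le (H : IsCodePartition P Q E) :
    ∑ m ∈ n.properDivisors, codeSum P (E m) ≤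
      ∑ q ∈ n.primeFactors, ∑ e ∈ (n / q).divisors, codeSum P (E e) := by
  have h1 : ∀ q ∈ n.primeFactors, (n / q).divisors ⊆ n.properDivisors := fun q hq e he => by
    obtain ⟨h1, h2⟩ := Nat.mem_properDivisors.1 (div_prime_mem_properDivisors hq)
    have h3 := Nat.dvd_of_mem_divisors he
    exact Nat.mem_properDivisors.2 ⟨h3.trans h1, (Nat.le_of_dvd (Nat.pos_of_ne_zero
      (Nat.mem_divisors.1 he).2) h3).trans_lt h2⟩
  have h2 : ∀ q ∈ n.primeFactors, ∑ e ∈ (n / q).divisors, codeSum P (E e) =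
      ∑ m ∈ n.properDivisors, if m ∈ (n / q).divisors then codeSum P (E m) else 0 :=
    fun q hq => by rw [← Finset.sum_filter, Finset.filter_mem_eq_inter,
      Finset.inter_eq_right.2 (h1 q hq)]
  rw [Finset.sum_congr rfl h2, Finset.sum_comm]
  refine Finset.sum_le_sum fun m hm => ?_
  obtain ⟨h3, h4⟩ := Nat.mem_properDivisors.1 hm
  have hn : 0 < n := by omega
  have hk1 : n / m ≠ 1 := fun h => by
    have := Nat.div_mul_cancel h3
    rw [h] at this
    omega
  obtain ⟨q, hq, hqm⟩ := Nat.exists_prime_and_dvd hk1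
  have hmq : m * q ∣ n := by
    rw [← Nat.mul_div_cancel' h3]
    exact mul_dvd_mul_left m hqm
  have hmem : q ∈ n.primeFactors :=
    Nat.mem_primeFactors.2 ⟨hq, (dvd_mul_left q m).trans hmq, hn.ne'⟩
  have hmd : m ∈ (n / q).divisors :=
    Nat.mem_divisors.2 ⟨Nat.dvd_div_of_mul_dvd (by rwa [mul_comm]),
      (Nat.pos_of_mem_properDivisors (div_prime_mem_properDivisors hmem)).ne'⟩
  have h5 : (if m ∈ (n / q).divisors then codeSum P (E m) else 0) ≤
      ∑ q ∈ n.primeFactors, if m ∈ (n / q).divisors then codeSum P (E m) else 0 :=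
    Finset.single_le_sum (f := fun q => if m ∈ (n / q).divisors then codeSum P (E m) else 0)
      (fun i _ => by
        have := H.nonneg_left m hm
        positivity) hmem
  rwa [if_pos hmd] at h5

lemma sum_divisors_codeSum_le (H : IsCodePartition P Q E) (hd : 1 ≤ d) {m : ℕ}
    (hm : m ∈ n.properDivisors) (A : Finset (Fin n → Fin d)) :
    ∑ e ∈ m.divisors, codeSum A (E e) ≤ A.card := by
  obtain ⟨h1, h2⟩ := Nat.mem_properDivisors.1 hm
  rw [H.sum_divisors_codeSum (by omega) h1 (Nat.pos_of_mem_properDivisors hm)]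
  refine (Finset.sum_le_card_nsmul _ _ 1 fun x _ => sum_codeExp_periodicWord_le hd _ h2 x).trans ?_
  simp

lemma sum_divisors_codeSum_lt (H : IsCodePartition P Q E) (hd : 2 ≤ d) {m : ℕ}
    (hm : m ∈ n.properDivisors) (hmn : m + 1 < n) (A : Finset (Fin n → Fin d)) {x : Fin n → Fin d}
    (hxA : x ∈ A) (hx : x ⟨0, by omega⟩ = x ⟨m, by omega⟩) :
    ∑ e ∈ m.divisors, codeSum A (E e) < A.card := by
  obtain ⟨h1, h2⟩ := Nat.mem_properDivisors.1 hm
  have hm0 := Nat.pos_of_mem_properDivisors hm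
  rw [H.sum_divisors_codeSum (by omega) h1 hm0]
  refine (Finset.sum_lt_sum (g := fun _ => 1)
    (fun x _ => sum_codeExp_periodicWord_le (by omega) _ h2 x)
    ⟨x, hxA, sum_codeExp_periodicWord_lt hd hm0 hmn x hx⟩).trans_le ?_
  simp

lemma le_sum_divisors_codeSum (H : IsCodePartition P Q E) (hd : 1 ≤ d) {m : ℕ}
    (hm : m ∈ n.properDivisors) (A : Finset (Fin n → Fin d)) :
    A.card * ((d : ℤ) - n * (d - 1)) ≤ ∑ e ∈ m.divisors, codeSum A (E e) := by
  obtain ⟨h1, h2⟩ := Nat.mem_properDivisors.1 hm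
  have hm0 := Nat.pos_of_mem_properDivisors hm
  rw [H.sum_divisors_codeSum (by omega) h1 hm0, ← nsmul_eq_mul]
  exact Finset.card_nsmul_le_sum _ _ _ fun x _ => le_sum_codeExp_periodicWord hd hm0 h2 x

lemma codeSum_exact_le (H : IsCodePartition P Q E) (hd : 1 ≤ d) {m : ℕ}
    (hm : m ∈ n.properDivisors) :
    codeSum (E n) (E m) ≤ n * (d - 1) * (E m).card := by
  obtain ⟨h1, h2⟩ := Nat.mem_properDivisors.1 hm
  have hn : 0 < n := by omega
  have h3 := H.sum_divisors_codeSum_self hn (E m)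
  have h4 := H.le_sum_divisors_codeSum hd hm (E m)
  have hsub : m.divisors ⊆ n.divisors := Nat.divisors_subset_of_dvd hn.ne' h1
  rw [← Finset.sum_sdiff hsub] at h3
  have hnm : n ∉ m.divisors := fun h => by
    have := Nat.le_of_dvd (Nat.pos_of_mem_properDivisors hm) (Nat.dvd_of_mem_divisors h)
    omega
  have h5 : codeSum (E m) (E n) ≤ ∑ e ∈ n.divisors \ m.divisors, codeSum (E m) (E e) := by
    refine Finset.single_le_sum (f := fun e => codeSum (E m) (E e)) (fun e he => ?_)
      (Finset.mem_sdiff.2 ⟨Nat.mem_divisors_self n hn.ne', hnm⟩)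
    obtain ⟨h6, h7⟩ := Finset.mem_sdiff.1 he
    refine H.nonneg m (Nat.mem_divisors.2 ⟨h1, hn.ne'⟩) e h6 ?_
    rintro rfl
    exact h7 (Nat.mem_divisors_self _ (Nat.pos_of_mem_properDivisors hm).ne')
  rw [codeSum_comm]
  linarith

lemma card_exact_le (H : IsCodePartition P Q E) {m : ℕ} (hmn : m ∣ n) (hm : 0 < m) :
    (E m).card ≤ d ^ m := by
  have h1 : E m ⊆ m.divisors.biUnion E :=
    Finset.subset_biUnion_of_mem E (Nat.mem_divisors_self m hm.ne')
  rw [H.periodic m hmn hm] at h1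
  refine (Finset.card_le_card h1).trans (Finset.card_image_le.trans ?_)
  simp

lemma sum_card_exact_lt (H : IsCodePartition P Q E) (hd : 1 ≤ d) :
    ((d : ℤ) - 1) * ∑ m ∈ n.properDivisors, ((E m).card : ℤ) < d ^ (n / 2 + 1) := by
  have hd' : (1 : ℤ) ≤ d := by exact_mod_cast hd
  have h1 : ∑ m ∈ n.properDivisors, ((E m).card : ℤ) ≤
      ∑ m ∈ Finset.range (n / 2 + 1), (d : ℤ) ^ m := by
    refine (Finset.sum_le_sum (g := fun m => (d : ℤ) ^ m) fun m hm => ?_).trans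
      (Finset.sum_le_sum_of_subset_of_nonneg (fun m hm => ?_) fun _ _ _ => by positivity)
    · exact_mod_cast H.card_exact_le (Nat.mem_properDivisors.1 hm).1
        (Nat.pos_of_mem_properDivisors hm)
    · obtain ⟨⟨k, hk⟩, h3⟩ := Nat.mem_properDivisors.1 hm
      have hk2 : 2 ≤ k := by
        by_contra h
        have : m * k ≤ m * 1 := Nat.mul_le_mul_left m (by omega)
        omega
      rw [Finset.mem_range, Nat.lt_succ_iff, Nat.le_div_iff_mul_le (by omega)]
      rw [hk]
      exact Nat.mul_le_mul_left m hk2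
  have h2 := mul_geom_sum (d : ℤ) (n / 2 + 1)
  have h3 := mul_le_mul_of_nonneg_left h1 (show (0 : ℤ) ≤ d - 1 by linarith)
  linarith

lemma exists_primitive (H : IsCodePartition P Q E) (hd : 2 ≤ d) (hn : 0 < n) :
    ∃ x ∈ E n, ∀ i j : Fin n, (i : ℕ) + 1 < n → (j : ℕ) + 1 < n → x i = x j := by
  set x : Fin n → Fin d := fun i => if (i : ℕ) + 1 < n then ⟨0, by omega⟩ else ⟨1, by omega⟩
    with hx
  refine ⟨x, ?_, fun i j hi hj => by simp [hx, hi, hj]⟩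
  have h1 : x ∈ n.divisors.biUnion E := by
    rw [H.periodic n dvd_rfl hn]
    refine Finset.mem_image.2 ⟨x, Finset.mem_univ _, ?_⟩
    ext i; simp [periodicWord, Nat.mod_eq_of_lt i.2]
  obtain ⟨e, he, hxe⟩ := Finset.mem_biUnion.1 h1
  obtain ⟨hen, -⟩ := Nat.mem_divisors.1 he
  have he0 : 0 < e := Nat.pos_of_dvd_of_pos hen hn
  rcases (Nat.le_of_dvd hn hen).eq_or_lt with rfl | hlt
  · exact hxe
  · exfalso
    have h2 : x ∈ e.divisors.biUnion E :=
      Finset.mem_biUnion.2 ⟨e, Nat.mem_divisors_self e he0.ne', hxe⟩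
    rw [H.periodic e hen he0] at h2
    obtain ⟨v, -, hv⟩ := Finset.mem_image.1 h2
    have h3 := congrFun hv ⟨n - 1, by omega⟩
    have h4 := congrFun hv ⟨n - 1 - e, by omega⟩
    have h5 : (n - 1) % e = (n - 1 - e) % e := by
      rw [Nat.mod_eq_sub_mod (by omega)]
    have h6 : ¬ (n - 1 + 1 < n) := by omega
    have h7 : n - 1 - e + 1 < n := by omega
    simp only [periodicWord, h5, hx, h6, if_false] at h3
    simp only [periodicWord, hx, h7, if_true] at h4
    rw [h3] at h4
    simp at h4

end IsCodePartition

end Words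

section Words

lemma two_pow_card_primeFactors_le {n : ℕ} (hn : 0 < n) : 2 ^ n.primeFactors.card ≤ n :=
  (Finset.pow_card_le_prod _ _ _ fun _ hp => (Nat.prime_of_mem_primeFactors hp).two_le).trans
    (Nat.le_of_dvd hn (Nat.prod_primeFactors_dvd n))

lemma card_primeFactors_le_two_of_lt {n : ℕ} (h : n < 16) : n.primeFactors.card ≤ 2 := by
  have h1 : ∀ n < 16, ((Finset.range n.succ).filter fun p => p ∣ n ∧ p.Prime).card ≤ 2 := by
    decide
  refine (Finset.card_le_card fun p hp => ?_).trans (h1 n h)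
  obtain ⟨h2, h3, h4⟩ := Nat.mem_primeFactors.1 hp
  exact Finset.mem_filter.2 ⟨Finset.mem_range.2 (Nat.lt_succ_iff.2
    (Nat.le_of_dvd (Nat.pos_of_ne_zero h4) h3)), h3, h2⟩

lemma sq_le_two_pow_half {n : ℕ} (hn : 16 ≤ n) : n ^ 2 ≤ 2 ^ (n - n / 2) := by
  induction n using Nat.strong_induction_on with
  | _ n ih =>
    rcases Nat.lt_or_ge n 18 with h | h
    · interval_cases n <;> norm_num
    · have h1 := ih (n - 2) (by omega) (by omega)
      obtain ⟨k, rfl⟩ : ∃ k, n = k + 2 := ⟨n - 2, by omega⟩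
      have h2 : k + 2 - (k + 2) / 2 = k - k / 2 + 1 := by omega
      rw [h2, pow_succ 2]
      simp only [Nat.add_sub_cancel] at h1
      nlinarith

lemma mul_pow_le_mul_pow {n d w : ℕ} (hd : 2 ≤ d) (hn : 16 ≤ n) (hw : 2 ^ w ≤ n) :
    n * d ^ (n / 2 + 1) ≤ d * d ^ (n - w) := by
  by_contra! h1
  have h2n := sq_le_two_pow_half hn
  have hwh : w ≤ n - n / 2 :=
    (Nat.pow_le_pow_iff_right (by norm_num)).1 (hw.trans (le_trans (by nlinarith) h2n))
  have h2 : d * d ^ (n - w) = d ^ (n - n / 2 - w) * d ^ (n / 2 + 1) := by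
    rw [← pow_succ', ← pow_add]; congr 1; omega
  rw [h2] at h1
  have h3 : d ^ (n - n / 2 - w) < n := lt_of_mul_lt_mul_right h1 (Nat.zero_le _)
  have h4 : 2 ^ (n - n / 2 - w) < n := (Nat.pow_le_pow_left hd _).trans_lt h3
  have h5 : 2 ^ (n - n / 2) = 2 ^ (n - n / 2 - w) * 2 ^ w := by
    rw [← pow_add]; congr 1; omega
  have h6 : 2 ^ (n - n / 2 - w) * 2 ^ w < n * n :=
    Nat.mul_lt_mul_of_lt_of_le h4 hw (by positivity)
  rw [h5, sq] at h2n
  exact (h6.trans_le h2n).false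

lemma mul_le_add_of_lorentz {d a b u v X : ℤ} (hd : 0 ≤ d) (ha : 0 < a) (hb : 0 < b) (hu : 0 ≤ u)
    (hv : 0 ≤ v) (h : b ^ 2 * (a * d - u) + a ^ 2 * (b * d - v) ≤ 0) (hXa : X ≤ a) (hXb : X ≤ b) :
    d * X ≤ u + v := by
  wlog hab : a ≤ b generalizing a b u v
  · rw [add_comm]
    exact this hb ha hv hu (by linarith) hXb hXa (le_of_not_ge hab)
  have h1 : a ^ 2 * v ≤ b ^ 2 * v :=
    mul_le_mul_of_nonneg_right (pow_le_pow_left₀ ha.le hab 2) hv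
  have h2 : 0 ≤ a ^ 2 * (b * d) := by positivity
  have h3 : b ^ 2 * (a * d) ≤ b ^ 2 * (u + v) := by linarith
  have h4 : a * d ≤ u + v := le_of_mul_le_mul_left h3 (by positivity)
  exact le_trans (by nlinarith) h4

namespace IsCodePartition

variable {n d : ℕ} {P Q : Finset (Fin n → Fin d)} {E : ℕ → Finset (Fin n → Fin d)}

lemma sum_properDivisors_le_mul_card (H : IsCodePartition P Q E) (hd : 1 ≤ d) :
    ∑ m ∈ n.properDivisors, codeSum P (E m) ≤ n.primeFactors.card * P.card := by
  refine H.sum_properDivisors_le.trans ((Finset.sum_le_card_nsmul _ _ (P.card : ℤ)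
    fun q hq => ?_).trans_eq (nsmul_eq_mul _ _))
  exact H.sum_divisors_codeSum_le hd (div_prime_mem_properDivisors hq) P

lemma sum_properDivisors_lt_mul_card (H : IsCodePartition P Q E) (hd : 2 ≤ d) (hn : 0 < n)
    (hω : 2 ≤ n.primeFactors.card) {x : Fin n → Fin d} (hxP : x ∈ P)
    (hx : ∀ i j : Fin n, (i : ℕ) + 1 < n → (j : ℕ) + 1 < n → x i = x j) :
    ∑ m ∈ n.properDivisors, codeSum P (E m) < n.primeFactors.card * P.card := by
  have hn4 : 4 ≤ n := by
    have := two_pow_card_primeFactors_le hn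
    have h2 := Nat.pow_le_pow_right (show 0 < 2 by norm_num) hω
    omega
  rw [← nsmul_eq_mul, ← Finset.sum_const]
  refine H.sum_properDivisors_le.trans_lt (Finset.sum_lt_sum
    (fun q hq => H.sum_divisors_codeSum_le (by omega) (div_prime_mem_properDivisors hq) P) ?_)
  obtain ⟨q, hq⟩ := Finset.card_pos.1 (show 0 < n.primeFactors.card by omega)
  have h3 : n / q ≤ n / 2 :=
    Nat.div_le_div_left (Nat.prime_of_mem_primeFactors hq).two_le (by norm_num)
  exact ⟨q, hq, H.sum_divisors_codeSum_lt hd (div_prime_mem_properDivisors hq) (by omega) P hxP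
    (hx _ _ (show 0 + 1 < n by omega) (show n / q + 1 < n by omega))⟩

lemma pow_le_card (H : IsCodePartition P Q E) (hd : 2 ≤ d) (hn : 0 < n) (hP : P.Nonempty) :
    d ^ (n - n.primeFactors.card) ≤ P.card := by
  have hd' : (2 : ℤ) ≤ d := by exact_mod_cast hd
  set w := n.primeFactors.card with hw
  have hwn : w + 1 ≤ n := (Nat.lt_two_pow_self (n := w)).trans_le (two_pow_card_primeFactors_le hn)
  obtain ⟨k, hk⟩ : ∃ k, n = w + 1 + k := ⟨n - (w + 1), by omega⟩
  have h1 := pow_mul_codeSum_self_le (by omega) P (show k + 1 ≤ n by omega)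
  have h2 := H.codeSum_self_add hn
  have h3 := H.sum_properDivisors_le_mul_card (by omega)
  have h4 := H.nonpos
  have ha : (0 : ℤ) < P.card := by exact_mod_cast hP.card_pos
  have h5 : (n - 1 - k : ℤ) = w := by rw [hk]; push_cast; ring
  rw [h5] at h1
  have hdk : (0 : ℤ) < d ^ k := by positivity
  have h6 : (P.card : ℤ) * (d - w) ≤ codeSum P P := by linarith
  have h7 := mul_le_mul_of_nonneg_left h6 hdk.le
  have h8 : (P.card : ℤ) * (d ^ k * (d + (d - 2) * w)) ≤ P.card * P.card := by linarith
  have h9 : (d : ℤ) ^ k * (d + (d - 2) * w) ≤ P.card := le_of_mul_le_mul_left h8 ha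
  have h10 : (d : ℤ) ^ k * d ≤ d ^ k * (d + (d - 2) * w) := by
    refine mul_le_mul_of_nonneg_left ?_ hdk.le
    have : 0 ≤ ((d : ℤ) - 2) * w := mul_nonneg (by linarith) (Nat.cast_nonneg _)
    linarith
  have h11 : n - w = k + 1 := by omega
  rw [h11, pow_succ]
  exact_mod_cast h10.trans h9

lemma sum_add_sum_lt (H : IsCodePartition P Q E) (hd : 1 ≤ d) (hn : 0 < n) :
    ∑ m ∈ n.properDivisors, codeSum P (E m) + ∑ m ∈ n.properDivisors, codeSum Q (E m) <
      n * d ^ (n / 2 + 1) := by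
  have h1 : ∀ m, codeSum P (E m) + codeSum Q (E m) = codeSum (E n) (E m) := fun m => by
    rw [← H.union_eq, codeSum, codeSum, codeSum, Finset.sum_union H.disjoint]
  rw [← Finset.sum_add_distrib]
  simp only [h1]
  refine (Finset.sum_le_sum fun m hm => H.codeSum_exact_le hd hm).trans_lt ?_
  rw [← Finset.mul_sum, mul_assoc]
  exact mul_lt_mul_of_pos_left (H.sum_card_exact_lt hd) (by exact_mod_cast hn)

theorem eq_empty_or_eq_empty (H : IsCodePartition P Q E) (hd : 2 ≤ d) (hn : 0 < n) :
    P = ∅ ∨ Q = ∅ := by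
  by_contra! hne
  obtain ⟨hPne, hQne⟩ := hne
  have hd' : (2 : ℤ) ≤ d := by exact_mod_cast hd
  have ha : (0 : ℤ) < P.card := by exact_mod_cast hPne.card_pos
  have hb : (0 : ℤ) < Q.card := by exact_mod_cast hQne.card_pos
  have hP := H.codeSum_self_add hn
  have hQ := H.symm.codeSum_self_add hn
  have huP := H.sum_properDivisors_le_mul_card (by omega)
  have huQ := H.symm.sum_properDivisors_le_mul_card (by omega)
  have hU := H.sum_add_sum_lt (by omega) hn
  have hu0 := Finset.sum_nonneg H.nonneg_left
  have hv0 := Finset.sum_nonneg H.nonneg_right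
  have hlor := codeSum_lorentz (by omega) H.disjoint
  have hD := H.nonpos
  have hcP := H.pow_le_card hd hn hPne
  have hcQ := H.symm.pow_le_card hd hn hQne
  have hsP : ∀ x ∈ P, _ → _ → _ := fun x hx h2 =>
    H.sum_properDivisors_lt_mul_card hd hn h2 (x := x) hx
  have hsQ : ∀ x ∈ Q, _ → _ → _ := fun x hx h2 =>
    H.symm.sum_properDivisors_lt_mul_card hd hn h2 (x := x) hx
  obtain ⟨x, hxE, hx⟩ := H.exists_primitive hd hn
  rw [← H.union_eq, Finset.mem_union] at hxE
  rw [codeSum_comm Q P] at hQ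
  set u := ∑ m ∈ n.properDivisors, codeSum P (E m)
  set v := ∑ m ∈ n.properDivisors, codeSum Q (E m)
  set D := codeSum P Q
  set a : ℤ := (P.card : ℤ) with hadef
  set b : ℤ := (Q.card : ℤ) with hbdef
  have key : b ^ 2 * (a * d - u) + a ^ 2 * (b * d - v) ≤ 0 := by
    have h1 : b ^ 2 * (a * d - u) + a ^ 2 * (b * d - v) ≤ D * (a + b) ^ 2 := by
      rw [← hP, ← hQ]; linarith
    exact h1.trans (mul_nonpos_of_nonpos_of_nonneg hD (sq_nonneg _))
  have ha2 : 0 < a ^ 2 := by positivity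
  have hb2 : 0 < b ^ 2 := by positivity
  rcases le_or_gt n.primeFactors.card d with hwd | hwd
  · have hwd' : (n.primeFactors.card : ℤ) ≤ d := by exact_mod_cast hwd
    have h1 : u ≤ a * d := huP.trans (by nlinarith)
    have h2 : v ≤ b * d := huQ.trans (by nlinarith)
    have h3 : u < a * d ∨ v < b * d := by
      rcases hwd.eq_or_lt with h | h
      · rcases hxE with h4 | h4
        · left
          have := hsP x h4 (by omega) hx
          rw [h] at this
          linarith
        · right
          have := hsQ x h4 (by omega) hx
          rw [h] at this
          linarith
      · left
        have h' : (n.primeFactors.card : ℤ) < d := by exact_mod_cast h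
        exact huP.trans_lt (by nlinarith)
    rcases h3 with h3 | h3 <;> nlinarith
  · have hn16 : 16 ≤ n := by
      by_contra h
      have := card_primeFactors_le_two_of_lt (not_le.1 h)
      omega
    have hmin := mul_le_add_of_lorentz (X := (d : ℤ) ^ (n - n.primeFactors.card)) (by omega) ha hb
      hu0 hv0 key (by rw [hadef]; exact_mod_cast hcP) (by rw [hbdef]; exact_mod_cast hcQ)
    refine (mul_pow_le_mul_pow hd hn16 (two_pow_card_primeFactors_le hn)).not_gt ?_
    exact_mod_cast hmin.trans_lt hU

end IsCodePartition

end Words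

section Coding

open Filter Topology

namespace Polynomial

/-- The absolute value of the `d`-th roots of `c`. -/
noncomputable def critScale (d : ℕ) (c : ℂ) : ℝ := ‖c‖ ^ ((d : ℝ)⁻¹)

lemma critScale_pow {d : ℕ} (hd : d ≠ 0) (c : ℂ) : critScale d c ^ d = ‖c‖ := by
  rw [critScale, Real.rpow_inv_natCast_pow (norm_nonneg c) hd]

lemma tendsto_critScale {d : ℕ} (hd : 2 ≤ d) :
    Tendsto (critScale d) (Bornology.cobounded ℂ) atTop :=
  (tendsto_rpow_atTop (by positivity)).comp tendsto_norm_cobounded_atTop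

lemma norm_le_of_iterate_eq {d : ℕ} (hd : 2 ≤ d) {c : ℂ} (hc : 2 ≤ critScale d c) {m : ℕ}
    (hm : 0 < m) {x : ℂ} (hx : (powAdd d c)^[m] x = x) : ‖x‖ ≤ 2 * critScale d c := by
  set ρ := critScale d c with hρ
  by_contra! h
  have step : ∀ z : ℂ, 2 * ρ < ‖z‖ → ‖z‖ < ‖powAdd d c z‖ := fun z hz => by
    obtain ⟨e, rfl⟩ : ∃ e, d = e + 1 := ⟨d - 1, by omega⟩
    have h1 : ‖z‖ ^ (e + 1) ≤ ‖powAdd (e + 1) c z‖ + ρ ^ (e + 1) := by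
      rw [hρ, critScale_pow (by omega), ← norm_pow]
      have := norm_sub_le (powAdd (e + 1) c z) c
      rwa [powAdd_apply, add_sub_cancel_right] at this
    have h2 : 2 * ρ ^ e ≤ ‖z‖ ^ e := by
      calc 2 * ρ ^ e ≤ 2 ^ e * ρ ^ e := by
            gcongr
            exact le_self_pow₀ (by norm_num) (by omega)
        _ = (2 * ρ) ^ e := (mul_pow _ _ _).symm
        _ ≤ ‖z‖ ^ e := by gcongr
    have h3 : 2 ≤ ρ ^ e := hc.trans (le_self_pow₀ (by linarith) (by omega))
    rw [pow_succ, pow_succ] at h1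
    nlinarith [mul_le_mul_of_nonneg_right h2 (norm_nonneg z),
      mul_le_mul_of_nonneg_left (show ρ ≤ ‖z‖ by linarith) (show 0 ≤ ρ ^ e by linarith),
      mul_le_mul_of_nonneg_right h3 (norm_nonneg z)]
  have grow : ∀ k, ‖x‖ ≤ ‖(powAdd d c)^[k] x‖ := fun k => by
    induction k with
    | zero => rfl
    | succ k ih =>
      rw [Function.iterate_succ_apply']
      exact ih.trans (step _ (h.trans_le ih)).le
  obtain ⟨k, rfl⟩ : ∃ k, m = k + 1 := ⟨m - 1, by omega⟩
  have := (grow k).trans_lt (step _ (h.trans_le (grow k)))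
  rw [← Function.iterate_succ_apply' (powAdd d c), hx] at this
  exact lt_irrefl _ this

lemma continuous_powQuot (d : ℕ) : Continuous fun p : ℂ × ℂ => powQuot d p.1 p.2 := by
  unfold powQuot
  fun_prop

lemma powQuot_mul (d : ℕ) (s a b : ℂ) :
    powQuot d (s * a) (s * b) = s ^ (d - 1) * powQuot d a b := by
  rw [powQuot, powQuot, Finset.mul_sum]
  refine Finset.sum_congr rfl fun j hj => ?_
  have h := Finset.mem_range.1 hj
  rw [mul_pow, mul_pow, show d - 1 = j + (d - 1 - j) by omega, pow_add,
    show j + (d - 1 - j) - j = d - 1 - j by omega]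
  ring

lemma exists_rootsOfUnity_radius {d : ℕ} (hd : 2 ≤ d) {ζ : ℂ} (hζ : IsPrimitiveRoot ζ d) :
    ∃ η > 0, (∀ i j : Fin d, i ≠ j → 3 * η ≤ ‖ζ ^ (i : ℕ) - ζ ^ (j : ℕ)‖) ∧
      ∀ (j : Fin d) (a b : ℂ), ‖a - ζ ^ (j : ℕ)‖ ≤ η → ‖b - ζ ^ (j : ℕ)‖ ≤ η →
        1 ≤ ‖powQuot d a b‖ ∧ ‖powQuot d a b‖ ≤ d + 1 := by
  have hd' : (2 : ℝ) ≤ d := by exact_mod_cast hd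
  have h1 : ∀ᶠ η : ℝ in 𝓝[>] 0, ∀ i j : Fin d, i ≠ j → 3 * η ≤ ‖ζ ^ (i : ℕ) - ζ ^ (j : ℕ)‖ := by
    refine eventually_all.2 fun i => eventually_all.2 fun j => ?_
    by_cases hij : i = j
    · simp [hij]
    · have hpos : 0 < ‖ζ ^ (i : ℕ) - ζ ^ (j : ℕ)‖ := by
        rw [norm_pos_iff, sub_ne_zero]
        exact fun h => hij (Fin.ext (hζ.pow_inj i.2 j.2 h))
      filter_upwards [Ioo_mem_nhdsGT (show (0 : ℝ) < ‖ζ ^ (i : ℕ) - ζ ^ (j : ℕ)‖ / 3 by positivity)]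
        with η hη _
      linarith [hη.2]
  have h2 : ∀ᶠ η : ℝ in 𝓝[>] 0, ∀ (j : Fin d) (a b : ℂ), ‖a - ζ ^ (j : ℕ)‖ ≤ η →
      ‖b - ζ ^ (j : ℕ)‖ ≤ η → 1 ≤ ‖powQuot d a b‖ ∧ ‖powQuot d a b‖ ≤ d + 1 := by
    refine eventually_all.2 fun j => ?_
    have hval : ‖powQuot d (ζ ^ (j : ℕ)) (ζ ^ (j : ℕ))‖ = d := by
      rw [powQuot_self, norm_mul, norm_pow, norm_pow, hζ.norm'_eq_one (by omega)]
      simp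
    have hc : ∀ᶠ p in 𝓝 ((ζ ^ (j : ℕ), ζ ^ (j : ℕ)) : ℂ × ℂ),
        ‖powQuot d p.1 p.2‖ ∈ Set.Icc (1 : ℝ) (d + 1) := by
      refine (continuous_powQuot d).norm.continuousAt.eventually_mem (Icc_mem_nhds ?_ ?_)
      · simp only [hval]; linarith
      · simp only [hval]; linarith
    obtain ⟨δ, hδ, hball⟩ := Metric.eventually_nhds_iff.1 hc
    filter_upwards [Ioo_mem_nhdsGT hδ] with η hη a b ha hb
    refine hball (y := (a, b)) ?_
    rw [Prod.dist_eq, dist_eq_norm, dist_eq_norm]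
    exact max_lt (ha.trans_lt hη.2) (hb.trans_lt hη.2)
  obtain ⟨η, hη, h3, h4⟩ := ((eventually_mem_nhdsWithin (s := Set.Ioi (0 : ℝ))).and (h1.and h2)).exists
  exact ⟨η, hη, h3, h4⟩

lemma exists_rootOfUnity_near {d : ℕ} (hd : 2 ≤ d) {ζ : ℂ} (hζ : IsPrimitiveRoot ζ d) {η : ℝ}
    (hη : 0 < η) {z : ℂ} (hz : ‖z ^ d - 1‖ ≤ η ^ d) : ∃ j : Fin d, ‖z - ζ ^ (j : ℕ)‖ ≤ η := by
  have hd0 : 0 < d := by omega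
  by_contra! h
  have h1 := hζ.pow_sub_pow_eq_prod_sub_mul z 1 hd0
  simp only [one_pow, mul_one] at h1
  rw [h1, norm_prod] at hz
  have h2 : ∏ _ξ ∈ nthRootsFinset d (1 : ℂ), η < ∏ ξ ∈ nthRootsFinset d (1 : ℂ), ‖z - ξ‖ := by
    refine Finset.prod_lt_prod_of_nonempty (fun _ _ => hη) (fun ξ hξ => ?_)
      ⟨1, (mem_nthRootsFinset hd0 1).2 (one_pow d)⟩
    have : NeZero d := ⟨hd0.ne'⟩
    obtain ⟨j, hj, rfl⟩ := hζ.eq_pow_of_pow_eq_one ((mem_nthRootsFinset hd0 1).1 hξ)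
    exact h ⟨j, hj⟩
  rw [Finset.prod_const, hζ.card_nthRootsFinset] at h2
  exact hz.not_gt h2

/-- Points that, together with their images, lie in the disc of radius `2 ‖c‖ ^ (1 / d)` can be
labelled by the `d`-th root of `-c` they are close to. -/
lemma exists_label {d : ℕ} (hd : 2 ≤ d) : ∃ K : ℝ, 1 ≤ K ∧ ∀ᶠ c in Bornology.cobounded ℂ,
    ∃ l : ℂ → Fin d, ∀ a b, ‖a‖ ≤ 2 * critScale d c → ‖powAdd d c a‖ ≤ 2 * critScale d c →
      ‖b‖ ≤ 2 * critScale d c → ‖powAdd d c b‖ ≤ 2 * critScale d c →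
      (l a ≠ l b → critScale d c ≤ K * ‖a - b‖ ∧ ‖a - b‖ ≤ K * critScale d c) ∧
      (l a = l b → critScale d c ^ (d - 1) ≤ K * ‖powQuot d a b‖ ∧
        ‖powQuot d a b‖ ≤ K * critScale d c ^ (d - 1)) := by
  have hζ := Complex.isPrimitiveRoot_exp d (by omega)
  set ζ := Complex.exp (2 * Real.pi * Complex.I / d)
  obtain ⟨η, hη, hsep, hquot⟩ := exists_rootsOfUnity_radius hd hζ
  refine ⟨max (max η⁻¹ 4) (d + 1), le_max_of_le_left (le_max_of_le_right (by norm_num)), ?_⟩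
  filter_upwards [(tendsto_critScale hd).eventually_ge_atTop (max 1 (2 * (η ^ d)⁻¹))] with c hc
  set ρ := critScale d c with hρ
  set K := max (max η⁻¹ 4) ((d : ℝ) + 1)
  have hK1 : η⁻¹ ≤ K := (le_max_left _ _).trans (le_max_left _ _)
  have hK2 : 4 ≤ K := (le_max_right _ _).trans (le_max_left _ _)
  have hK3 : (d : ℝ) + 1 ≤ K := le_max_right _ _
  have hρ1 : 1 ≤ ρ := (le_max_left _ _).trans hc
  have hρ2 : 2 * (η ^ d)⁻¹ ≤ ρ := (le_max_right _ _).trans hc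
  have hρ0 : 0 < ρ := by linarith
  obtain ⟨s, hs⟩ := IsAlgClosed.exists_pow_nat_eq (-c) (show 0 < d by omega)
  have hsn : ‖s‖ = ρ := by
    refine (pow_left_inj₀ (norm_nonneg s) hρ0.le (show d ≠ 0 by omega)).1 ?_
    rw [hρ, critScale_pow (by omega), ← norm_pow, hs, norm_neg]
  have hs0 : s ≠ 0 := norm_pos_iff.1 (hsn ▸ hρ0)
  have hex : ∀ a : ℂ, ∃ j : Fin d, ‖powAdd d c a‖ ≤ 2 * ρ → ‖a / s - ζ ^ (j : ℕ)‖ ≤ η := by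
    intro a
    by_cases ha : ‖powAdd d c a‖ ≤ 2 * ρ
    · obtain ⟨j, hj⟩ := exists_rootOfUnity_near hd hζ hη (z := a / s) <| by
        have h1 : (a / s) ^ d - 1 = powAdd d c a / s ^ d := by
          rw [div_pow, div_sub_one (pow_ne_zero _ hs0), powAdd_apply, hs, sub_neg_eq_add]
        rw [h1, norm_div, norm_pow, hsn, div_le_iff₀ (by positivity)]
        have h2 : 2 ≤ η ^ d * ρ := by
          rw [← div_eq_mul_inv, div_le_iff₀ (by positivity)] at hρ2
          linarith
        have h3 : ρ ^ 2 ≤ ρ ^ d := pow_le_pow_right₀ hρ1 hd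
        calc ‖powAdd d c a‖ ≤ 2 * ρ := ha
          _ ≤ η ^ d * ρ * ρ := by gcongr
          _ = η ^ d * ρ ^ 2 := by ring
          _ ≤ η ^ d * ρ ^ d := by gcongr
      exact ⟨j, fun _ => hj⟩
    · exact ⟨⟨0, by omega⟩, fun h => absurd h ha⟩
  choose l hl using hex
  refine ⟨l, fun a b ha ha' hb hb' => ⟨fun hab => ⟨?_, ?_⟩, fun hab => ?_⟩⟩
  · have h1 := hsep _ _ hab
    have h2 : ‖ζ ^ (l a : ℕ) - ζ ^ (l b : ℕ)‖ ≤
        ‖a / s - b / s‖ + ‖a / s - ζ ^ (l a : ℕ)‖ + ‖b / s - ζ ^ (l b : ℕ)‖ := by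
      have := norm_sub_le (a / s - b / s - (a / s - ζ ^ (l a : ℕ))) (-(b / s - ζ ^ (l b : ℕ)))
      have h3 := norm_sub_le (a / s - b / s) (a / s - ζ ^ (l a : ℕ))
      rw [norm_neg] at this
      calc _ = ‖a / s - b / s - (a / s - ζ ^ (l a : ℕ)) - -(b / s - ζ ^ (l b : ℕ))‖ := by
            congr 1; ring
        _ ≤ _ := by linarith
    have h3 : η ≤ ‖a - b‖ / ρ := by
      rw [← hsn, ← norm_div, sub_div]
      linarith [hl a ha', hl b hb']
    rw [le_div_iff₀ hρ0] at h3
    calc ρ = η⁻¹ * (η * ρ) := by field_simp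
      _ ≤ K * ‖a - b‖ := by gcongr
  · calc ‖a - b‖ ≤ ‖a‖ + ‖b‖ := norm_sub_le _ _
      _ ≤ 4 * ρ := by linarith
      _ ≤ K * ρ := by gcongr
  · obtain ⟨h1, h2⟩ := hquot (l a) (a / s) (b / s) (hl a ha') (hab ▸ hl b hb')
    have h3 := powQuot_mul d s (a / s) (b / s)
    rw [mul_div_cancel₀ _ hs0, mul_div_cancel₀ _ hs0] at h3
    rw [h3, norm_mul, norm_pow, hsn]
    have h4 : 0 ≤ ρ ^ (d - 1) := by positivity
    constructor
    · nlinarith [mul_le_mul (show 1 ≤ K by linarith) h1 zero_le_one (by linarith)]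
    · rw [mul_comm]
      gcongr
      exact h2.trans hK3

/-- `w` codes the `n`-periodic points of `z ^ d + c` by words of length `n` in such a way that the
distances between them are governed by the common prefixes of the codes. -/
structure IsCoding (n d : ℕ) (c : ℂ) (M : ℝ) (w : ℂ → Fin n → Fin d) : Prop where
  injOn : ∀ x y, (powAdd d c)^[n] x = x → (powAdd d c)^[n] y = y → w x = w y → x = y
  lower : ∀ x y, (powAdd d c)^[n] x = x → (powAdd d c)^[n] y = y → x ≠ y →
    critScale d c ^ codeExp (w x) (w y) ≤ M * ‖x - y‖
  upper : ∀ x y, (powAdd d c)^[n] x = x → (powAdd d c)^[n] y = y → x ≠ y →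
    ‖x - y‖ ≤ M * critScale d c ^ codeExp (w x) (w y)
  periodic : ∀ m x, (powAdd d c)^[m] x = x → ∀ i j : Fin n, (i : ℕ) ≡ j [MOD m] → w x i = w x j
  nodup : ((perPoly d n).map (evalRingHom c)).roots.Nodup

lemma codeExp_eq_of_first_ne {n d : ℕ} {x y : Fin n → Fin d} {k : Fin n} (hk : x k ≠ y k)
    (hlt : ∀ i < k, x i = y i) : codeExp x y = 1 - ((d : ℤ) - 1) * (k : ℕ) := by
  have h1 : ∀ j ∈ Finset.Ico 1 n, (if wordPrefix j x = wordPrefix j y then (1 : ℤ) else 0) =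
      if j ≤ k then 1 else 0 := fun j _ => by
    refine if_congr ?_ rfl rfl
    rw [wordPrefix_eq_iff]
    refine ⟨fun h => ?_, fun h i hi => hlt i (Fin.lt_def.2 (hi.trans_le h))⟩
    by_contra! hj
    exact hk (h k hj)
  have h2 : (Finset.Ico 1 n).filter (· ≤ (k : ℕ)) = Finset.Ico 1 (k + 1 : ℕ) := by
    ext j
    have := k.2
    simp only [Finset.mem_filter, Finset.mem_Ico]
    omega
  rw [codeExp, Finset.sum_congr rfl h1, Finset.sum_boole, h2]
  simp

lemma map_perPoly_eq_mul {d n : ℕ} {c x : ℂ} (hx : (powAdd d c)^[n] x = x) :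
    (perPoly d n).map (evalRingHom c) = (X - C x) * (∏ i ∈ Finset.range n,
      powQuot d ((powAdd d (C c))^[i] X) ((powAdd d (C c))^[i] (C x)) - 1) := by
  have h1 := map_iterate_powAdd (mapRingHom (evalRingHom c)) d (C X) X n
  simp only [coe_mapRingHom, map_C, coe_evalRingHom, eval_X, map_X] at h1
  have h2 := map_iterate_powAdd (C : ℂ →+* ℂ[X]) d c x n
  rw [hx] at h2
  rw [mul_sub, ← iterate_powAdd_sub, ← h2, mul_one, perPoly, Polynomial.map_sub, map_X, h1]
  ring

lemma nodup_roots_of_norm_prod_ne_one {d n : ℕ} (hd : 2 ≤ d) (hn : 1 ≤ n) {c : ℂ}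
    (h : ∀ x, (powAdd d c)^[n] x = x →
      ∏ i ∈ Finset.range n, ‖powQuot d ((powAdd d c)^[i] x) ((powAdd d c)^[i] x)‖ ≠ 1) :
    ((perPoly d n).map (evalRingHom c)).roots.Nodup := by
  have hne : (perPoly d n).map (evalRingHom c) ≠ 0 :=
    ((perPoly_monic_natDegree hd hn).1.map _).ne_zero
  rw [Multiset.nodup_iff_count_le_one]
  intro x
  by_cases hx : x ∈ ((perPoly d n).map (evalRingHom c)).roots
  · have hx' : (powAdd d c)^[n] x = x := by
      have := (mem_roots hne).1 hx
      rwa [IsRoot, ← evalPt_eq_eval_map, evalPt_perPoly, sub_eq_zero] at this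
    rw [count_roots, rootMultiplicity_le_iff hne]
    rintro ⟨S, hS⟩
    rw [map_perPoly_eq_mul hx', one_add_one_eq_two, pow_two, mul_assoc] at hS
    have h1 := congrArg (eval x) (mul_left_cancel₀ (X_sub_C_ne_zero x) hS)
    rw [eval_mul, eval_sub, eval_sub, eval_X, eval_C, sub_self, zero_mul, eval_one, sub_eq_zero,
      ← coe_evalRingHom, map_prod] at h1
    simp only [map_powQuot, map_iterate_powAdd, coe_evalRingHom, eval_C, eval_X] at h1
    refine h x hx' ?_
    rw [← norm_prod, h1, norm_one]
  · rw [Multiset.count_eq_zero_of_notMem hx]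
    exact zero_le_one

theorem exists_isCoding {n d : ℕ} (hd : 2 ≤ d) (hn : 1 ≤ n) :
    ∃ M : ℝ, 0 < M ∧ ∀ᶠ c in Bornology.cobounded ℂ, ∃ w, IsCoding n d c M w := by
  obtain ⟨K, hK, hev⟩ := exists_label hd
  refine ⟨K ^ n, by positivity, ?_⟩
  filter_upwards [hev, (tendsto_critScale hd).eventually_ge_atTop (K + 2)] with c ⟨l, hl⟩ hc
  set ρ := critScale d c with hρ
  set f := powAdd d c with hf
  have hρ0 : 0 < ρ := by linarith
  have hρK : K < ρ ^ (d - 1) :=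
    (show K < ρ by linarith).trans_le (le_self_pow₀ (by linarith) (by omega))
  have hbd : ∀ x, f^[n] x = x → ∀ i, ‖f^[i] x‖ ≤ 2 * ρ := fun x hx i => by
    refine norm_le_of_iterate_eq hd (by linarith) hn ?_
    rw [← hf, ← Function.iterate_add_apply, add_comm, Function.iterate_add_apply, hx]
  have hl' : ∀ x y, f^[n] x = x → f^[n] y = y → ∀ i, _ := fun x y hx hy i =>
    hl (f^[i] x) (f^[i] y) (hbd x hx i)
      (by rw [← Function.iterate_succ_apply' f]; exact hbd x hx _) (hbd y hy i)
      (by rw [← Function.iterate_succ_apply' f]; exact hbd y hy _)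
  have hbig : ∀ x y, f^[n] x = x → f^[n] y = y → (∀ i < n, l (f^[i] x) = l (f^[i] y)) →
      1 < ∏ i ∈ Finset.range n, ‖powQuot d (f^[i] x) (f^[i] y)‖ := fun x y hx hy h => by
    calc (1 : ℝ) = ∏ _i ∈ Finset.range n, 1 := by simp
      _ < _ := by
        refine Finset.prod_lt_prod_of_nonempty (fun _ _ => one_pos) (fun i hi => ?_)
          ⟨0, Finset.mem_range.2 hn⟩
        have h1 := ((hl' x y hx hy i).2 (h i (Finset.mem_range.1 hi))).1
        nlinarith
  let w : ℂ → Fin n → Fin d := fun x i => l (f^[i] x)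
  have hinj : ∀ x y, f^[n] x = x → f^[n] y = y → w x = w y → x = y := by
    intro x y hx hy h
    by_contra hxy
    have h1 := iterate_powAdd_sub d c x y n
    rw [← hf, hx, hy] at h1
    have h2 := congrArg norm (mul_left_cancel₀ (sub_ne_zero.2 hxy) ((mul_one (x - y)).trans h1))
    rw [norm_one, norm_prod] at h2
    exact (hbig x y hx hy fun i hi => congrFun h ⟨i, hi⟩).ne h2
  have hfirst : ∀ x y, f^[n] x = x → f^[n] y = y → x ≠ y →
      ∃ k : Fin n, w x k ≠ w y k ∧ ∀ i < k, w x i = w y i := by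
    intro x y hx hy hxy
    obtain ⟨i, hi⟩ := Function.ne_iff.1 (mt (hinj x y hx hy) hxy)
    classical
    obtain ⟨k, hk, hmin⟩ := WellFounded.has_min (wellFounded_lt (α := Fin n))
      {i | w x i ≠ w y i} ⟨i, hi⟩
    exact ⟨k, hk, fun i hik => by_contra fun h => hmin i h hik⟩
  have hexp : ∀ k : ℕ, ρ ^ (1 - ((d : ℤ) - 1) * (k : ℕ)) * (ρ ^ (d - 1)) ^ k = ρ := fun k => by
    have h1 : ((d : ℤ) - 1) = ((d - 1 : ℕ) : ℤ) := by
      rw [Nat.cast_sub (by omega), Nat.cast_one]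
    rw [h1, ← pow_mul, ← zpow_natCast, ← zpow_add₀ hρ0.ne']
    push_cast
    simp
  refine ⟨w, hinj, ?_, ?_, ?_, ?_⟩
  · intro x y hx hy hxy
    obtain ⟨k, hk, hlt⟩ := hfirst x y hx hy hxy
    have h1 := ((hl' x y hx hy k).1 hk).1
    rw [iterate_powAdd_sub, norm_mul, norm_prod] at h1
    have h2 : ∏ i ∈ Finset.range k, ‖powQuot d (f^[i] x) (f^[i] y)‖ ≤
        ∏ _i ∈ Finset.range k, K * ρ ^ (d - 1) :=
      Finset.prod_le_prod (fun _ _ => norm_nonneg _) fun i hi =>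
        ((hl' x y hx hy i).2 (hlt ⟨i, (Finset.mem_range.1 hi).trans k.2⟩
          (Fin.lt_def.2 (Finset.mem_range.1 hi)))).2
    rw [Finset.prod_const, Finset.card_range, mul_pow] at h2
    rw [codeExp_eq_of_first_ne hk hlt]
    refine le_of_mul_le_mul_right ?_ (show 0 < (ρ ^ (d - 1)) ^ (k : ℕ) by positivity)
    rw [hexp]
    calc ρ ≤ _ := h1
      _ ≤ K * (‖x - y‖ * (K ^ (k : ℕ) * (ρ ^ (d - 1)) ^ (k : ℕ))) := by gcongr
      _ = K ^ ((k : ℕ) + 1) * (‖x - y‖ * (ρ ^ (d - 1)) ^ (k : ℕ)) := by ring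
      _ ≤ K ^ n * (‖x - y‖ * (ρ ^ (d - 1)) ^ (k : ℕ)) := by
          gcongr
          exact k.2
      _ = _ := by ring
  · intro x y hx hy hxy
    obtain ⟨k, hk, hlt⟩ := hfirst x y hx hy hxy
    have h1 := ((hl' x y hx hy k).1 hk).2
    rw [iterate_powAdd_sub, norm_mul, norm_prod] at h1
    have h2 : ∏ _i ∈ Finset.range k, ρ ^ (d - 1) ≤
        ∏ i ∈ Finset.range k, K * ‖powQuot d (f^[i] x) (f^[i] y)‖ :=
      Finset.prod_le_prod (fun _ _ => by positivity) fun i hi =>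
        ((hl' x y hx hy i).2 (hlt ⟨i, (Finset.mem_range.1 hi).trans k.2⟩
          (Fin.lt_def.2 (Finset.mem_range.1 hi)))).1
    rw [Finset.prod_const, Finset.prod_mul_distrib, Finset.prod_const, Finset.card_range] at h2
    rw [codeExp_eq_of_first_ne hk hlt]
    refine le_of_mul_le_mul_right ?_ (show 0 < (ρ ^ (d - 1)) ^ (k : ℕ) by positivity)
    rw [mul_assoc, hexp]
    calc ‖x - y‖ * (ρ ^ (d - 1)) ^ (k : ℕ)
        ≤ ‖x - y‖ * (K ^ (k : ℕ) * ∏ i ∈ Finset.range k, ‖powQuot d (f^[i] x) (f^[i] y)‖) := by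
          gcongr
      _ = K ^ (k : ℕ) * (‖x - y‖ * ∏ i ∈ Finset.range k, ‖powQuot d (f^[i] x) (f^[i] y)‖) := by
          ring
      _ ≤ K ^ (k : ℕ) * (K * ρ) := by gcongr
      _ = K ^ ((k : ℕ) + 1) * ρ := by ring
      _ ≤ K ^ n * ρ := by
          gcongr
          exact k.2
  · intro m x hx i j hij
    have h : ∀ i : ℕ, f^[i % m] x = f^[i] x := fun i => Function.IsPeriodicPt.iterate_mod_apply hx i
    show l (f^[i] x) = l (f^[j] x)
    rw [← h i, ← h j, hij]
  · exact nodup_roots_of_norm_prod_ne_one hd hn fun x hx =>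
      (hbig x x hx hx fun _ _ => rfl).ne'

end Polynomial

end Coding

section Fiber

open Filter Topology

namespace Polynomial

/-- The zeros of a polynomial family at the parameter `c`. -/
noncomputable def fiber (c : ℂ) (A : ℂ[X][X]) : Finset ℂ := (A.map (evalRingHom c)).roots.toFinset

variable {c : ℂ} {A B : ℂ[X][X]} {n d : ℕ}

lemma mem_fiber (hA : A.Monic) {x : ℂ} : x ∈ fiber c A ↔ evalPt c x A = 0 := by
  rw [fiber, Multiset.mem_toFinset, mem_roots (hA.map _).ne_zero, IsRoot, evalPt_eq_eval_map]

lemma iterate_eq_of_mem_fiber (hA : A.Monic) (h : A ∣ perPoly d n) {x : ℂ} (hx : x ∈ fiber c A) :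
    (powAdd d c)^[n] x = x := by
  obtain ⟨S, hS⟩ := h
  rw [← sub_eq_zero, ← evalPt_perPoly, hS, map_mul, (mem_fiber hA).1 hx, zero_mul]

lemma nodup_roots_of_dvd (hd : 2 ≤ d) (hn : 1 ≤ n) (h : A ∣ perPoly d n)
    (hc : ((perPoly d n).map (evalRingHom c)).roots.Nodup) :
    (A.map (evalRingHom c)).roots.Nodup :=
  Multiset.nodup_of_le (roots.le_of_dvd ((perPoly_monic_natDegree hd hn).1.map _).ne_zero
    (Polynomial.map_dvd _ h)) hc

lemma card_fiber (hA : A.Monic) (h : (A.map (evalRingHom c)).roots.Nodup) :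
    (fiber c A).card = A.natDegree := by
  rw [fiber, Multiset.toFinset_card_of_nodup h,
    ← (IsAlgClosed.splits _).natDegree_eq_card_roots, hA.natDegree_map]

lemma disjoint_fiber (hA : A.Monic) (hB : B.Monic)
    (h : ((A * B).map (evalRingHom c)).roots.Nodup) : Disjoint (fiber c A) (fiber c B) := by
  rw [Polynomial.map_mul, roots_mul (mul_ne_zero (hA.map _).ne_zero (hB.map _).ne_zero),
    Multiset.nodup_add] at h
  exact Multiset.disjoint_toFinset.2 h.2.2

lemma eval_resultant (hA : A.Monic) (hB : B.Monic) : (resultant A B).eval c =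
    (((A.map (evalRingHom c)).roots ×ˢ (B.map (evalRingHom c)).roots).map
      fun ij => ij.1 - ij.2).prod := by
  have h1 := resultant_map_map A B A.natDegree B.natDegree (evalRingHom c)
  have h2 := resultant_eq_prod_roots_sub (A.map (evalRingHom c)) (B.map (evalRingHom c))
    (hA.map _) (hB.map _) (IsAlgClosed.splits _) (IsAlgClosed.splits _)
  rw [hA.natDegree_map, hB.natDegree_map] at h2
  rw [← coe_evalRingHom, ← h1, h2]

lemma prod_fiber_norm_sub (hA : A.Monic) (hB : B.Monic)
    (hA' : (A.map (evalRingHom c)).roots.Nodup) (hB' : (B.map (evalRingHom c)).roots.Nodup) :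
    ∏ x ∈ fiber c A, ∏ y ∈ fiber c B, ‖x - y‖ = ‖(resultant A B).eval c‖ := by
  rw [eval_resultant hA hB, ← Finset.prod_product' (f := fun x y => ‖x - y‖), ← norm_prod]
  congr 1
  rw [Finset.prod_eq_multiset_prod, Finset.product_val, fiber,
    fiber, Multiset.toFinset_val, Multiset.toFinset_val, hA'.dedup, hB'.dedup]

lemma exists_resultant_eq_C (hA : A.Monic) (hB : B.Monic)
    (h : ∀ c x : ℂ, evalPt c x A = 0 → evalPt c x B ≠ 0) : ∃ a, resultant A B = C a := by
  by_contra! hne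
  have hdeg : (resultant A B).degree ≠ 0 := fun h0 => hne _ (eq_C_of_degree_eq_zero h0)
  obtain ⟨c, hc⟩ := IsAlgClosed.exists_root _ hdeg
  rw [IsRoot, eval_resultant hA hB, Multiset.prod_eq_zero_iff, Multiset.mem_map] at hc
  obtain ⟨⟨x, y⟩, hxy, h0⟩ := hc
  obtain ⟨hx, hy⟩ := Multiset.mem_product.1 hxy
  obtain rfl : x = y := sub_eq_zero.1 h0
  rw [mem_roots (hA.map _).ne_zero, IsRoot, ← evalPt_eq_eval_map] at hx
  rw [mem_roots (hB.map _).ne_zero, IsRoot, ← evalPt_eq_eval_map] at hy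
  exact h c x hx hy

lemma eval_resultant_ne_zero (hd : 2 ≤ d) (hn : 1 ≤ n) (hA : A.Monic) (hB : B.Monic)
    (h : A * B ∣ perPoly d n) (hc : ((perPoly d n).map (evalRingHom c)).roots.Nodup) :
    (resultant A B).eval c ≠ 0 := by
  have hAB := nodup_roots_of_dvd hd hn h hc
  rw [← norm_ne_zero_iff, ← prod_fiber_norm_sub hA hB
    (nodup_roots_of_dvd hd hn ((dvd_mul_right A B).trans h) hc)
    (nodup_roots_of_dvd hd hn ((dvd_mul_left B A).trans h) hc)]
  refine Finset.prod_ne_zero_iff.2 fun x hx => Finset.prod_ne_zero_iff.2 fun y hy => ?_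
  rw [norm_ne_zero_iff, sub_ne_zero]
  rintro rfl
  exact Finset.disjoint_left.1 (disjoint_fiber hA hB hAB) hx hy

lemma resultant_ne_zero_of_dvd_perPoly (hd : 2 ≤ d) (hn : 1 ≤ n) (hA : A.Monic) (hB : B.Monic)
    (h : A * B ∣ perPoly d n) : resultant A B ≠ 0 := by
  intro h0
  refine eval_resultant_ne_zero (c := 0) hd hn hA hB h ?_ (by rw [h0, eval_zero])
  rw [map_evalRingHom_zero_perPoly]
  exact nodup_roots (separable_X_pow_sub_X (hd.trans (Nat.le_self_pow (by omega) d)))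

lemma eventually_le_norm_eval {R : ℂ[X]} (hR : R ≠ 0) :
    ∃ κ : ℝ, 0 < κ ∧ ∀ᶠ c in Bornology.cobounded ℂ, κ ≤ ‖R.eval c‖ := by
  rcases Nat.eq_zero_or_pos R.natDegree with h | h
  · obtain ⟨a, rfl⟩ := natDegree_eq_zero.1 h
    exact ⟨‖a‖, norm_pos_iff.2 (by simpa using hR), by simp⟩
  · exact ⟨1, one_pos, (R.tendsto_norm_atTop (natDegree_pos_iff_degree_pos.1 h)
      tendsto_norm_cobounded_atTop).eventually_ge_atTop 1⟩

lemma zpow_sum {ι K : Type*} [CommGroupWithZero K] {r : K} (hr : r ≠ 0) (s : Finset ι) (u : ι → ℤ) :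
    r ^ ∑ i ∈ s, u i = ∏ i ∈ s, r ^ u i := by
  classical
  induction s using Finset.induction_on with
  | empty => simp
  | insert a s ha ih => rw [Finset.sum_insert ha, Finset.prod_insert ha, zpow_add₀ hr, ih]

lemma codeSum_image {w : ℂ → Fin n → Fin d} {F G : Finset ℂ} (hF : Set.InjOn w F)
    (hG : Set.InjOn w G) :
    codeSum (F.image w) (G.image w) = ∑ x ∈ F, ∑ y ∈ G, codeExp (w x) (w y) := by
  rw [codeSum, Finset.sum_image hF]
  exact Finset.sum_congr rfl fun x _ => Finset.sum_image hG

lemma IsCoding.injOn_fiber {M : ℝ} {w : ℂ → Fin n → Fin d} (hw : IsCoding n d c M w)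
    (hA : A.Monic) (h : A ∣ perPoly d n) : Set.InjOn w (fiber c A) := fun x hx y hy =>
  hw.injOn x y (iterate_eq_of_mem_fiber hA h hx) (iterate_eq_of_mem_fiber hA h hy)

lemma IsCoding.norm_resultant_bounds (hd : 2 ≤ d) (hn : 1 ≤ n) (hA : A.Monic) (hB : B.Monic)
    (h : A * B ∣ perPoly d n) {M : ℝ} (hc : 0 < critScale d c)
    {w : ℂ → Fin n → Fin d} (hw : IsCoding n d c M w) :
    ‖(resultant A B).eval c‖ ≤ M ^ (A.natDegree * B.natDegree) *
        critScale d c ^ codeSum ((fiber c A).image w) ((fiber c B).image w) ∧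
      critScale d c ^ codeSum ((fiber c A).image w) ((fiber c B).image w) ≤
        M ^ (A.natDegree * B.natDegree) * ‖(resultant A B).eval c‖ := by
  have hdA := (dvd_mul_right A B).trans h
  have hdB := (dvd_mul_left B A).trans h
  have hnA := nodup_roots_of_dvd hd hn hdA hw.nodup
  have hnB := nodup_roots_of_dvd hd hn hdB hw.nodup
  have hdisj := disjoint_fiber hA hB (nodup_roots_of_dvd hd hn h hw.nodup)
  have hxy : ∀ x ∈ fiber c A, ∀ y ∈ fiber c B, x ≠ y := fun x hx y hy hxy =>
    Finset.disjoint_left.1 hdisj hx (hxy ▸ hy)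
  have hM : ∀ u : ℂ → ℂ → ℝ, ∏ x ∈ fiber c A, ∏ y ∈ fiber c B, M * u x y =
      M ^ (A.natDegree * B.natDegree) * ∏ x ∈ fiber c A, ∏ y ∈ fiber c B, u x y := fun u => by
    simp only [Finset.prod_mul_distrib, Finset.prod_const, card_fiber hA hnA, card_fiber hB hnB]
    rw [← pow_mul, mul_comm B.natDegree]
  have hS : critScale d c ^ codeSum ((fiber c A).image w) ((fiber c B).image w) =
      ∏ x ∈ fiber c A, ∏ y ∈ fiber c B, critScale d c ^ codeExp (w x) (w y) := by
    rw [codeSum_image (hw.injOn_fiber hA hdA) (hw.injOn_fiber hB hdB)]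
    simp only [zpow_sum hc.ne']
  rw [hS, ← hM, ← prod_fiber_norm_sub hA hB hnA hnB, ← hM]
  constructor
  · exact Finset.prod_le_prod (fun _ _ => Finset.prod_nonneg fun _ _ => norm_nonneg _)
      fun x hx => Finset.prod_le_prod (fun _ _ => norm_nonneg _) fun y hy =>
        hw.upper x y (iterate_eq_of_mem_fiber hA hdA hx) (iterate_eq_of_mem_fiber hB hdB hy)
          (hxy x hx y hy)
  · exact Finset.prod_le_prod (fun _ _ => Finset.prod_nonneg fun _ _ => by positivity)
      fun x hx => Finset.prod_le_prod (fun _ _ => by positivity) fun y hy =>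
        hw.lower x y (iterate_eq_of_mem_fiber hA hdA hx) (iterate_eq_of_mem_fiber hB hdB hy)
          (hxy x hx y hy)

theorem eventually_codeSum_nonneg (hd : 2 ≤ d) (hn : 1 ≤ n) (hA : A.Monic) (hB : B.Monic)
    (h : A * B ∣ perPoly d n) {M : ℝ} (hM : 0 < M) :
    ∀ᶠ c in Bornology.cobounded ℂ, ∀ w, IsCoding n d c M w →
      0 ≤ codeSum ((fiber c A).image w) ((fiber c B).image w) := by
  obtain ⟨κ, hκ, hev⟩ := eventually_le_norm_eval (resultant_ne_zero_of_dvd_perPoly hd hn hA hB h)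
  filter_upwards [hev, (tendsto_critScale hd).eventually_gt_atTop
    (max 1 (M ^ (A.natDegree * B.natDegree) / κ))] with c hc hρ w hw
  have hρ1 : 1 < critScale d c := (le_max_left _ _).trans_lt hρ
  have hρ2 := (le_max_right _ _).trans_lt hρ
  by_contra! hneg
  have h1 := (hw.norm_resultant_bounds hd hn hA hB h (by linarith)).1
  have h2 : critScale d c ^ codeSum ((fiber c A).image w) ((fiber c B).image w) ≤
      critScale d c ^ (-1 : ℤ) := zpow_le_zpow_right₀ hρ1.le (by omega)
  rw [zpow_neg_one] at h2
  rw [div_lt_iff₀ hκ] at hρ2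
  have h3 : κ ≤ M ^ (A.natDegree * B.natDegree) * (critScale d c)⁻¹ :=
    hc.trans (h1.trans (by gcongr))
  rw [← div_eq_mul_inv, le_div_iff₀ (by linarith)] at h3
  linarith

theorem eventually_codeSum_nonpos (hd : 2 ≤ d) (hn : 1 ≤ n) (hA : A.Monic) (hB : B.Monic)
    (h : A * B = dynPoly d n) {M : ℝ} :
    ∀ᶠ c in Bornology.cobounded ℂ, ∀ w, IsCoding n d c M w →
      codeSum ((fiber c A).image w) ((fiber c B).image w) ≤ 0 := by
  have hdvd : A * B ∣ perPoly d n := by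
    rw [h, ← (dynPoly_monic_and_prod hd n hn).2]
    exact Finset.dvd_prod_of_mem _ (Nat.mem_divisors_self n (by omega))
  obtain ⟨a, ha⟩ := exists_resultant_eq_C hA hB fun _ _ => not_common_zero hd hn h
  filter_upwards [(tendsto_critScale hd).eventually_gt_atTop
    (max 1 (M ^ (A.natDegree * B.natDegree) * ‖a‖))] with c hρ w hw
  have hρ1 : 1 < critScale d c := (le_max_left _ _).trans_lt hρ
  have hρ2 := (le_max_right _ _).trans_lt hρ
  by_contra! hpos
  have h1 := (hw.norm_resultant_bounds hd hn hA hB hdvd (by linarith)).2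
  rw [ha, eval_C] at h1
  have h2 : critScale d c ^ (1 : ℤ) ≤
      critScale d c ^ codeSum ((fiber c A).image w) ((fiber c B).image w) :=
    zpow_le_zpow_right₀ hρ1.le (by omega)
  rw [zpow_one] at h2
  linarith

end Polynomial

end Fiber

section Partition

open Filter Topology

namespace Polynomial

variable {c : ℂ} {n d : ℕ}

lemma dynPoly_dvd_perPoly (hd : 2 ≤ d) {m : ℕ} (hm : m ∈ n.divisors) :
    dynPoly d m ∣ perPoly d n := by
  rw [← (dynPoly_monic_and_prod hd n (Nat.pos_of_ne_zero (Nat.mem_divisors.1 hm).2)).2]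
  exact Finset.dvd_prod_of_mem _ hm

lemma dynPoly_mul_dvd_perPoly (hd : 2 ≤ d) {m e : ℕ} (hm : m ∈ n.divisors)
    (he : e ∈ n.divisors) (hme : m ≠ e) : dynPoly d m * dynPoly d e ∣ perPoly d n := by
  rw [← (dynPoly_monic_and_prod hd n (Nat.pos_of_ne_zero (Nat.mem_divisors.1 hm).2)).2,
    ← Finset.prod_pair hme]
  exact Finset.prod_dvd_prod_of_subset _ _ _ (by
    intro k hk
    rcases Finset.mem_insert.1 hk with rfl | hk
    · exact hm
    · exact Finset.mem_singleton.1 hk ▸ he)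

lemma mem_fiber_perPoly (hd : 2 ≤ d) {m : ℕ} (hm : 0 < m) {x : ℂ} :
    x ∈ fiber c (perPoly d m) ↔ ∃ e ∈ m.divisors, x ∈ fiber c (dynPoly d e) := by
  rw [mem_fiber (perPoly_monic_natDegree hd hm).1, ← (dynPoly_monic_and_prod hd m hm).2, map_prod,
    Finset.prod_eq_zero_iff]
  refine exists_congr fun e => and_congr_right fun he => ?_
  rw [mem_fiber (dynPoly_monic_and_prod hd e (Nat.pos_of_mem_divisors he)).1]

lemma fiber_perPoly_eq_biUnion (hd : 2 ≤ d) {m : ℕ} (hm : 0 < m) :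
    fiber c (perPoly d m) = m.divisors.biUnion fun e => fiber c (dynPoly d e) := by
  ext x
  rw [mem_fiber_perPoly hd hm, Finset.mem_biUnion]

lemma fiber_mul {A B : ℂ[X][X]} (hA : A.Monic) (hB : B.Monic) :
    fiber c (A * B) = fiber c A ∪ fiber c B := by
  ext x
  rw [Finset.mem_union, mem_fiber (hA.mul hB), mem_fiber hA, mem_fiber hB, map_mul, mul_eq_zero]

lemma IsCoding.disjoint_image {M : ℝ} {w : ℂ → Fin n → Fin d} (hw : IsCoding n d c M w)
    (hd : 2 ≤ d) (hn : 1 ≤ n) {A B : ℂ[X][X]} (hA : A.Monic) (hB : B.Monic)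
    (h : A * B ∣ perPoly d n) : Disjoint ((fiber c A).image w) ((fiber c B).image w) := by
  rw [Finset.disjoint_left]
  intro v hv hv'
  obtain ⟨x, hx, rfl⟩ := Finset.mem_image.1 hv
  obtain ⟨y, hy, hxy⟩ := Finset.mem_image.1 hv'
  have := hw.injOn y x (iterate_eq_of_mem_fiber hB ((dvd_mul_left B A).trans h) hy)
    (iterate_eq_of_mem_fiber hA ((dvd_mul_right A B).trans h) hx) hxy
  subst this
  exact Finset.disjoint_left.1 (disjoint_fiber hA hB (nodup_roots_of_dvd hd hn h hw.nodup)) hx hy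

lemma IsCoding.image_fiber_perPoly {M : ℝ} {w : ℂ → Fin n → Fin d} (hw : IsCoding n d c M w)
    (hd : 2 ≤ d) (hn : 1 ≤ n) {m : ℕ} (hmn : m ∣ n) (hm : 0 < m) :
    (fiber c (perPoly d m)).image w = Finset.univ.image (periodicWord hm) := by
  obtain ⟨hmon, hdeg⟩ := perPoly_monic_natDegree hd hm
  have hdvd : perPoly d m ∣ perPoly d n := by
    obtain ⟨r, rfl⟩ := hmn
    obtain ⟨S, hS, -⟩ := perPoly_mul d m r
    exact ⟨S, hS⟩
  have hle := Nat.le_of_dvd hn hmn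
  refine Finset.eq_of_subset_of_card_le (fun v hv => ?_) (le_of_eq ?_)
  · obtain ⟨x, hx, rfl⟩ := Finset.mem_image.1 hv
    refine Finset.mem_image.2 ⟨fun i => w x (Fin.castLE hle i), Finset.mem_univ _, ?_⟩
    funext i
    exact hw.periodic m x (iterate_eq_of_mem_fiber hmon dvd_rfl hx) _ _ (Nat.mod_modEq i m)
  · rw [Finset.card_image_of_injOn (hw.injOn_fiber hmon hdvd),
      card_fiber hmon (nodup_roots_of_dvd hd hn hdvd hw.nodup), hdeg,
      Finset.card_image_of_injective _ (periodicWord_injective hm hle)]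
    simp

theorem isCodePartition_of_isCoding (hd : 2 ≤ d) (hn : 1 ≤ n) {P Q : ℂ[X][X]} (hP : P.Monic)
    (hQ : Q.Monic) (h : P * Q = dynPoly d n) {M : ℝ} (hM : 0 < M) :
    ∀ᶠ c in Bornology.cobounded ℂ, ∀ w, IsCoding n d c M w →
      IsCodePartition ((fiber c P).image w) ((fiber c Q).image w)
        fun m => (fiber c (dynPoly d m)).image w := by
  have hnn := Nat.mem_divisors_self n (by omega)
  have hmon : ∀ m ∈ n.divisors, (dynPoly d m).Monic := fun m hm =>
    (dynPoly_monic_and_prod hd m (Nat.pos_of_mem_divisors hm)).1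
  have hPQ : P * Q ∣ perPoly d n := h ▸ dynPoly_dvd_perPoly hd hnn
  have hsub : ∀ m ∈ n.properDivisors, m ∈ n.divisors := fun m hm =>
    Nat.properDivisors_subset_divisors hm
  have hprop : ∀ m ∈ n.properDivisors, P * Q * dynPoly d m ∣ perPoly d n := fun m hm =>
    h ▸ dynPoly_mul_dvd_perPoly hd hnn (hsub m hm) (Nat.mem_properDivisors.1 hm).2.ne'
  have h1 : ∀ᶠ c in Bornology.cobounded ℂ, ∀ m ∈ n.divisors, ∀ e ∈ n.divisors, m ≠ e → ∀ w,
      IsCoding n d c M w → 0 ≤ codeSum ((fiber c (dynPoly d m)).image w)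
        ((fiber c (dynPoly d e)).image w) := by
    refine (eventually_all_finset _).2 fun m hm => (eventually_all_finset _).2 fun e he =>
      eventually_imp_distrib_left.2 fun hme => ?_
    exact eventually_codeSum_nonneg hd hn (hmon m hm) (hmon e he)
      (dynPoly_mul_dvd_perPoly hd hm he hme) hM
  have h2 : ∀ R : ℂ[X][X], R.Monic → R ∣ P * Q → ∀ᶠ c in Bornology.cobounded ℂ,
      ∀ m ∈ n.properDivisors, ∀ w, IsCoding n d c M w →
        0 ≤ codeSum ((fiber c R).image w) ((fiber c (dynPoly d m)).image w) :=
    fun R hR hdvd => (eventually_all_finset _).2 fun m hm =>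
      eventually_codeSum_nonneg hd hn hR (hmon m (hsub m hm))
        ((mul_dvd_mul_right hdvd _).trans (hprop m hm)) hM
  filter_upwards [h1, h2 P hP (dvd_mul_right _ _), h2 Q hQ (dvd_mul_left _ _),
    eventually_codeSum_nonpos hd hn hP hQ h (M := M)] with c h1 h2 h3 h4 w hw
  refine ⟨hw.disjoint_image hd hn hP hQ hPQ, ?_, fun m hm e he hme => ?_, fun m hmn hm => ?_,
    fun m hm e he hme => h1 m hm e he hme w hw, fun m hm => h2 m hm w hw,
    fun m hm => h3 m hm w hw, h4 w hw⟩
  · rw [← Finset.image_union, ← fiber_mul hP hQ, h]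
  · exact hw.disjoint_image hd hn (hmon m hm) (hmon e he) (dynPoly_mul_dvd_perPoly hd hm he hme)
  · rw [← hw.image_fiber_perPoly hd hn hmn hm, fiber_perPoly_eq_biUnion hd hm,
      Finset.biUnion_image]

theorem eq_one_or_eq_one_of_mul_eq_dynPoly (hd : 2 ≤ d) (hn : 1 ≤ n) {P Q : ℂ[X][X]}
    (hP : P.Monic) (hQ : Q.Monic) (h : P * Q = dynPoly d n) : P = 1 ∨ Q = 1 := by
  obtain ⟨M, hM, hev⟩ := exists_isCoding hd hn
  obtain ⟨c, ⟨w, hw⟩, hc⟩ := (hev.and (isCodePartition_of_isCoding hd hn hP hQ h hM)).exists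
  have hPQ : P * Q ∣ perPoly d n :=
    h ▸ dynPoly_dvd_perPoly hd (Nat.mem_divisors_self n (by omega))
  have key : ∀ R : ℂ[X][X], R.Monic → R ∣ P * Q → (fiber c R).image w = ∅ → R = 1 :=
    fun R hR hdvd h0 => by
      rw [← Monic.natDegree_eq_zero hR,
        ← card_fiber hR (nodup_roots_of_dvd hd hn (hdvd.trans hPQ) hw.nodup),
        Finset.image_eq_empty.1 h0, Finset.card_empty]
  exact ((hc w hw).eq_empty_or_eq_empty hd hn).imp (key P hP (dvd_mul_right _ _))
    (key Q hQ (dvd_mul_left _ _))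

end Polynomial

end Partition

section Irreducibility

namespace Polynomial

lemma dynPoly_ne_one {d n : ℕ} (hd : 2 ≤ d) (hn : 1 ≤ n) : dynPoly d n ≠ 1 := by
  intro h
  have hpos : ∀ m ∈ n.properDivisors, 1 ≤ m := fun m hm =>
    Nat.pos_of_dvd_of_pos (Nat.mem_properDivisors.1 hm).1 hn
  have h1 := congrArg natDegree (dynPoly_monic_and_prod hd n hn).2
  rw [← Nat.insert_self_properDivisors (by omega),
    Finset.prod_insert Nat.self_notMem_properDivisors, h, one_mul,
    natDegree_prod_of_monic _ _ fun m hm => (dynPoly_monic_and_prod hd m (hpos m hm)).1,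
    (perPoly_monic_natDegree hd hn).2] at h1
  have h2 : ∑ m ∈ n.properDivisors, (dynPoly d m).natDegree ≤ ∑ m ∈ n.properDivisors, d ^ m :=
    Finset.sum_le_sum fun m hm => by
      obtain ⟨hmon, hdeg⟩ := perPoly_monic_natDegree hd (hpos m hm)
      rw [← hdeg]
      exact natDegree_le_of_dvd
        (dynPoly_dvd_perPoly hd (Nat.mem_divisors_self m (by have := hpos m hm; omega)))
        hmon.ne_zero
  have h3 := Nat.geomSum_lt hd fun m (hm : m ∈ n.properDivisors) => (Nat.mem_properDivisors.1 hm).2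
  omega

theorem irreducible_dynPoly {d n : ℕ} (hd : 2 ≤ d) (hn : 1 ≤ n) : Irreducible (dynPoly d n) := by
  refine (dynPoly_monic_and_prod hd n hn).1.irreducible_iff_natDegree.2
    ⟨dynPoly_ne_one hd hn, fun P Q hP hQ h => ?_⟩
  exact (eq_one_or_eq_one_of_mul_eq_dynPoly hd hn hP hQ h).imp
    (Monic.natDegree_eq_zero hP).2 (Monic.natDegree_eq_zero hQ).2

/-- The identification of `ℂ[x, c]` with `ℂ[c][x]`. -/
noncomputable def bivariateEquiv : MvPolynomial (Fin 2) ℂ ≃ₐ[ℂ] ℂ[X][X] :=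
  (MvPolynomial.finSuccEquiv ℂ 1).trans (mapAlgEquiv (MvPolynomial.uniqueAlgEquiv ℂ (Fin 1)))

lemma bivariateEquiv_X_zero : bivariateEquiv (MvPolynomial.X 0) = X := by
  simp [bivariateEquiv, MvPolynomial.finSuccEquiv_X_zero]

lemma bivariateEquiv_X_one : bivariateEquiv (MvPolynomial.X 1) = C X := by
  have h : MvPolynomial.finSuccEquiv ℂ 1 (MvPolynomial.X 1) = C (MvPolynomial.X 0) :=
    MvPolynomial.finSuccEquiv_X_succ (R := ℂ) (j := (0 : Fin 1))
  simp [bivariateEquiv, h]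

lemma bivariateEquiv_fcIter_sub (d m : ℕ) :
    bivariateEquiv (fcIter d m - MvPolynomial.X 0) = perPoly d m := by
  have h : bivariateEquiv (fcIter d m) = (powAdd d (C (X : ℂ[X]) : ℂ[X][X]))^[m] X := by
    induction m with
    | zero => exact bivariateEquiv_X_zero
    | succ m ih =>
      rw [Function.iterate_succ_apply', ← ih, fcIter, map_add, map_pow, bivariateEquiv_X_one,
        powAdd_apply]
  rw [map_sub, h, bivariateEquiv_X_zero, perPoly]

end Polynomial

end Irreducibility

/-- Bousch, Lau–Schleicher, Morton: for d ≥ 2 and n ≥ 1, the n-th dynatomic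
polynomial Φ_n(x, c) of f_c(x) = x^d + c, characterized by
Φ_n · ∏_{m ∣ n, μ(n/m) = −1} (f_c^m(x) − x) = ∏_{m ∣ n, μ(n/m) = 1} (f_c^m(x) − x),
is irreducible in ℂ[x, c]. -/
theorem dynatomic_irreducible (d n : ℕ) (hd : 2 ≤ d) (hn : 1 ≤ n)
    (Φ : MvPolynomial (Fin 2) ℂ)
    (hΦ : Φ * ∏ m ∈ n.divisors.filter fun m => ArithmeticFunction.moebius (n / m) = -1,
            (fcIter d m - X 0)
          = ∏ m ∈ n.divisors.filter fun m => ArithmeticFunction.moebius (n / m) = 1,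
            (fcIter d m - X 0)) :
    Irreducible Φ := by
  have h1 := congrArg Polynomial.bivariateEquiv hΦ
  simp only [map_mul, map_prod, Polynomial.bivariateEquiv_fcIter_sub] at h1
  rw [← Polynomial.dynPoly_mul_prod_perPoly hd hn] at h1
  have h2 : ∏ m ∈ n.divisors.filter fun m => ArithmeticFunction.moebius (n / m) = -1,
      Polynomial.perPoly d m ≠ 0 := Finset.prod_ne_zero_iff.2 fun m hm =>
    (Polynomial.perPoly_monic_natDegree hd
      (Nat.pos_of_mem_divisors (Finset.mem_filter.1 hm).1)).1.ne_zero
  rw [← MulEquiv.irreducible_iff Polynomial.bivariateEquiv, mul_right_cancel₀ h2 h1]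
  exact Polynomial.irreducible_dynPoly hd hn
end

section
/- Consider the family of rational maps f_b(x) = b·x + 1/x with homogeneous form F(X,Y) = b·X² + Y², G(X,Y) = X·Y over the ring ℚ[b] with b an indeterminate, and define the iterates F_1 = F, G_1 = G, F_{k+1}(X,Y) = F(F_k, G_k), G_{k+1}(X,Y) = G(F_k, G_k), and the dynatomic polynomials Φ_k ∈ ℚ[b, X, Y] determined recursively by ∏_{m ∣ k} Φ_m = Y·F_k − X·G_k. Then for every n ≥ 2, the dynatomic polynomial Φ_{2n} has at least two irreducible factors in ℚ[b, X, Y]; in particular, Φ_{2n} is not irreducible. -/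
open MvPolynomial

/-- The homogeneous form F(X, Y) = b·X² + Y² of the family f_b(x) = bx + 1/x, over ℚ[b],
where b is `Polynomial.X` and X, Y are the variables `X 0`, `X 1`. -/
noncomputable def manesF : MvPolynomial (Fin 2) (Polynomial ℚ) :=
  C Polynomial.X * X 0 ^ 2 + X 1 ^ 2

/-- The homogeneous form G(X, Y) = X·Y of the family f_b(x) = bx + 1/x. -/
noncomputable def manesG : MvPolynomial (Fin 2) (Polynomial ℚ) :=
  X 0 * X 1

/-- The iterated pair (F_k, G_k): F_0 = X, G_0 = Y, F_{k+1} = F(F_k, G_k),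
G_{k+1} = G(F_k, G_k). -/
noncomputable def manesIter :
    ℕ → MvPolynomial (Fin 2) (Polynomial ℚ) × MvPolynomial (Fin 2) (Polynomial ℚ)
  | 0 => (X 0, X 1)
  | k + 1 =>
      (aeval ![(manesIter k).1, (manesIter k).2] manesF,
       aeval ![(manesIter k).1, (manesIter k).2] manesG)

/-- The homogeneous lift (x, y) ↦ (bx² + y², xy) of x ↦ bx + 1/x on pairs of ring elements. -/
def manesStep {R : Type*} [CommRing R] (b : R) (p : R × R) : R × R :=
  (b * p.1 ^ 2 + p.2 ^ 2, p.1 * p.2)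

section Step

variable {R : Type*} [CommRing R]

theorem manesStep_iterate_smul (b c : R) (p : R × R) (k : ℕ) :
    (manesStep b)^[k] (c • p) = c ^ 2 ^ k • (manesStep b)^[k] p := by
  induction k with
  | zero => simp
  | succ k ih =>
    rw [Function.iterate_succ_apply', Function.iterate_succ_apply', ih]
    ext <;> simp [manesStep] <;> ring

theorem manesStep_iterate_neg_snd (b : R) (p : R × R) (k : ℕ) :
    (manesStep b)^[k] (p.1, -p.2) =
      (((manesStep b)^[k] p).1, -((manesStep b)^[k] p).2) := by
  induction k with
  | zero => simp
  | succ k ih =>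
    rw [Function.iterate_succ_apply', Function.iterate_succ_apply', ih]
    simp [manesStep]

/-- A point sent to its negative by the `n`-th iterate is fixed by the `2n`-th iterate. -/
theorem manesStep_iterate_two_mul (b x y : R) (n : ℕ)
    (h : y * ((manesStep b)^[n] (x, y)).1 + x * ((manesStep b)^[n] (x, y)).2 = 0) :
    y ^ 2 ^ n * (y * ((manesStep b)^[2 * n] (x, y)).1 -
      x * ((manesStep b)^[2 * n] (x, y)).2) = 0 := by
  set u := (manesStep b)^[n] (x, y) with hu
  have key : y • u = (-u.2) • (x, -y) := by
    ext
    · simp only [Prod.smul_fst, smul_eq_mul]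
      linear_combination h
    · simp [mul_comm]
  have h2 : y ^ 2 ^ n • (manesStep b)^[2 * n] (x, y) =
      (-u.2) ^ 2 ^ n • (u.1, -u.2) := by
    rw [two_mul, Function.iterate_add_apply, ← hu, ← manesStep_iterate_smul, key,
      manesStep_iterate_smul, manesStep_iterate_neg_snd b (x, y) n]
  have h3 := congrArg Prod.fst h2
  have h4 := congrArg Prod.snd h2
  simp only [Prod.smul_fst, Prod.smul_snd, smul_eq_mul] at h3 h4
  linear_combination y * h3 - x * h4 + (-u.2) ^ 2 ^ n * h

theorem map_manesIter (φ : MvPolynomial (Fin 2) (Polynomial ℚ) →+* R) (k : ℕ) :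
    (φ (manesIter k).1, φ (manesIter k).2) =
      (manesStep (φ (C Polynomial.X)))^[k] (φ (X 0), φ (X 1)) := by
  induction k with
  | zero => rfl
  | succ k ih =>
    rw [Function.iterate_succ_apply', ← ih]
    simp [manesIter, manesF, manesG, manesStep, algebraMap_eq]

end Step

theorem manes_dvd (n : ℕ) :
    (X 1 * (manesIter n).1 + X 0 * (manesIter n).2) ∣
      X 1 ^ 2 ^ n * (X 1 * (manesIter (2 * n)).1 - X 0 * (manesIter (2 * n)).2) := by
  rw [← Ideal.mem_span_singleton, ← Ideal.Quotient.eq_zero_iff_mem]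
  set Q := X 1 * (manesIter n).1 + X 0 * (manesIter n).2 with hQ
  set φ := Ideal.Quotient.mk (Ideal.span {Q})
  have h0 : φ Q = 0 := Ideal.Quotient.eq_zero_iff_mem.2 (Ideal.mem_span_singleton_self Q)
  have := manesStep_iterate_two_mul (φ (C Polynomial.X)) (φ (X 0)) (φ (X 1)) n
  rw [← map_manesIter, ← map_manesIter] at this
  simpa using this (by simpa [hQ] using h0)

/-- Evaluation at b = 1/2 and [X : Y] = [√2 (1 + z) : 1 - z]. In the coordinate `z` the map
x ↦ x/2 + 1/x becomes z ↦ z². -/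
noncomputable def manesEval (z : ℂ) : MvPolynomial (Fin 2) (Polynomial ℚ) →+* ℂ :=
  eval₂Hom (Polynomial.aeval (1 / 2 : ℂ)).toRingHom ![(√2 : ℝ) * (1 + z), 1 - z]

theorem manesStep_iterate_half (z : ℂ) (k : ℕ) :
    ∃ c : ℂ, c ≠ 0 ∧ (manesStep (1 / 2 : ℂ))^[k] ((√2 : ℝ) * (1 + z), 1 - z) =
      (c * ((√2 : ℝ) * (1 + z ^ 2 ^ k)), c * (1 - z ^ 2 ^ k)) := by
  have hs : ((√2 : ℝ) : ℂ) ^ 2 = 2 := by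
    rw [← Complex.ofReal_pow, Real.sq_sqrt (by norm_num)]
    norm_num
  induction k with
  | zero => exact ⟨1, one_ne_zero, by simp⟩
  | succ k ih =>
    obtain ⟨c, hc, h⟩ := ih
    refine ⟨c ^ 2 * (√2 : ℝ), by simp [hc], ?_⟩
    rw [Function.iterate_succ_apply', h, pow_succ 2 k, pow_mul]
    ext
    · simp only [manesStep]
      linear_combination (c ^ 2 * ((1 + z ^ 2 ^ k) ^ 2 / 2 - (1 + (z ^ 2 ^ k) ^ 2))) * hs
    · simp only [manesStep]
      ring

theorem manesEval_iterate (z : ℂ) (k : ℕ) :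
    ∃ c : ℂ, c ≠ 0 ∧
      manesEval z (X 1 * (manesIter k).1 - X 0 * (manesIter k).2) = c * (z ^ 2 ^ k - z) ∧
      manesEval z (X 1 * (manesIter k).1 + X 0 * (manesIter k).2) = c * (1 - z * z ^ 2 ^ k) := by
  obtain ⟨c, hc, h⟩ := manesStep_iterate_half z k
  have hX : manesEval z (X 0) = (√2 : ℝ) * (1 + z) := by simp [manesEval]
  have hY : manesEval z (X 1) = 1 - z := by simp [manesEval]
  have hb : manesEval z (C Polynomial.X) = 1 / 2 := by simp [manesEval]
  have hm := map_manesIter (manesEval z) k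
  rw [hX, hY, hb, h, Prod.mk.injEq] at hm
  refine ⟨2 * (√2 : ℝ) * c, by simp [hc], ?_, ?_⟩
  · rw [map_sub, map_mul, map_mul, hm.1, hm.2, hX, hY]
    ring
  · rw [map_add, map_mul, map_mul, hm.1, hm.2, hX, hY]
    ring

/-- If `z` has exact period `2n` under squaring, then Φ_{2n} vanishes there while the dynatomic
polynomials of proper divisors do not. -/
theorem manesEval_dynatomic {Φ : ℕ → MvPolynomial (Fin 2) (Polynomial ℚ)}
    (hΦ : ∀ k : ℕ, 1 ≤ k →
      ∏ m ∈ k.divisors, Φ m = X 1 * (manesIter k).1 - X 0 * (manesIter k).2)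
    {n : ℕ} (hn : 1 ≤ n) {z : ℂ} (hz : z ^ 2 ^ (2 * n) = z)
    (hper : ∀ m, 1 ≤ m → m ≤ n → z ^ 2 ^ m ≠ z) :
    manesEval z (Φ (2 * n)) = 0 ∧ manesEval z (∏ m ∈ (2 * n).properDivisors, Φ m) ≠ 0 := by
  have hO : manesEval z (∏ m ∈ (2 * n).properDivisors, Φ m) ≠ 0 := by
    rw [map_prod, Finset.prod_ne_zero_iff]
    intro m hm h0
    obtain ⟨⟨d, hd⟩, hlt⟩ := Nat.mem_properDivisors.1 hm
    have hm1 : 1 ≤ m := Nat.pos_of_ne_zero (by rintro rfl; omega)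
    have hd2 : 2 ≤ d := by
      by_contra! hd'
      interval_cases d <;> omega
    have hmn : m ≤ n := by nlinarith
    obtain ⟨c, hc, h, -⟩ := manesEval_iterate z m
    have hdvd : Φ m ∣ X 1 * (manesIter m).1 - X 0 * (manesIter m).2 :=
      hΦ m hm1 ▸ Finset.dvd_prod_of_mem Φ (Nat.mem_divisors_self m (by omega))
    have := map_dvd (manesEval z) hdvd
    rw [h0, zero_dvd_iff, h] at this
    exact mul_ne_zero hc (sub_ne_zero.2 (hper m hm1 hmn)) this
  refine ⟨?_, hO⟩
  obtain ⟨c, -, h, -⟩ := manesEval_iterate z (2 * n)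
  rw [hz, sub_self, mul_zero, ← hΦ _ (by omega), ← Nat.cons_self_properDivisors (by omega),
    Finset.prod_cons, map_mul] at h
  exact (mul_eq_zero.1 h).resolve_right hO

theorem pow_two_pow_ne_self {z : ℂ} {N m : ℕ} (hz : IsPrimitiveRoot z N) (hm : 1 ≤ m)
    (hN : 2 ^ m - 1 < N) : z ^ 2 ^ m ≠ z := by
  intro h
  have h2 : 2 ≤ 2 ^ m := by simpa using Nat.pow_le_pow_right (show 0 < 2 by norm_num) hm
  refine hz.pow_ne_one_of_pos_of_lt (l := 2 ^ m - 1) (by omega) hN ?_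
  have h0 : z ≠ 0 := hz.ne_zero (by omega)
  rw [← mul_left_inj' h0, ← pow_succ, Nat.sub_add_cancel (by omega), h, one_mul]

/-- Manes: let Φ_k ∈ ℚ[b, X, Y] be the dynatomic polynomials of the family
f_b(x) = bx + 1/x, determined recursively by ∏_{m ∣ k} Φ_m = Y·F_k − X·G_k. Then for every
n ≥ 2 the dynatomic polynomial Φ_{2n} is a product of two non-units, i.e. it has at least
two irreducible factors and in particular is not irreducible. -/
theorem manes_dynatomic_reducible
    (Φ : ℕ → MvPolynomial (Fin 2) (Polynomial ℚ))
    (hΦ : ∀ k : ℕ, 1 ≤ k →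
      ∏ m ∈ k.divisors, Φ m = X 1 * (manesIter k).1 - X 0 * (manesIter k).2)
    (n : ℕ) (hn : 2 ≤ n) :
    ∃ A B : MvPolynomial (Fin 2) (Polynomial ℚ),
      ¬IsUnit A ∧ ¬IsUnit B ∧ Φ (2 * n) = A * B := by
  have hfour : 4 ≤ 2 ^ n := by simpa using Nat.pow_le_pow_right (show 0 < 2 by norm_num) hn
  have hsq : 2 ^ (2 * n) = 2 ^ n * 2 ^ n := by rw [two_mul, pow_add]
  have hbig : 2 ^ n * 4 ≤ 2 ^ (2 * n) := hsq ▸ Nat.mul_le_mul_left _ hfour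
  have hpow : ∀ m ≤ n, 2 ^ m ≤ 2 ^ n := fun m hm => Nat.pow_le_pow_right (by norm_num) hm
  -- a point with fⁿ(x) = -x of exact period 2n
  have hz := Complex.isPrimitiveRoot_exp (2 ^ n + 1) (by omega)
  set z := Complex.exp (2 * Real.pi * Complex.I / ((2 ^ n + 1 : ℕ) : ℂ))
  have hz1 : z * z ^ 2 ^ n = 1 := by rw [← pow_succ', hz.pow_eq_one]
  have hz2 : z ^ 2 ^ (2 * n) = z := by
    have hinv : z ^ 2 ^ n = z⁻¹ := eq_inv_of_mul_eq_one_right hz1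
    rw [hsq, pow_mul, hinv, inv_pow, hinv, inv_inv]
  obtain ⟨hzΦ, hzO⟩ := manesEval_dynatomic hΦ (by omega) hz2 fun m hm hmn =>
    pow_two_pow_ne_self hz hm (by have := hpow m hmn; omega)
  -- a point of exact period 2n with fⁿ(x) ≠ -x
  have hw := Complex.isPrimitiveRoot_exp (2 ^ (2 * n) - 1) (by omega)
  set w := Complex.exp (2 * Real.pi * Complex.I / ((2 ^ (2 * n) - 1 : ℕ) : ℂ))
  have hw1 : w ^ 2 ^ (2 * n) = w := by
    rw [← Nat.sub_add_cancel (by omega : 1 ≤ 2 ^ (2 * n)), pow_succ, hw.pow_eq_one, one_mul]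
  obtain ⟨hwΦ, -⟩ := manesEval_dynatomic hΦ (by omega) hw1 fun m hm hmn =>
    pow_two_pow_ne_self hw hm (by have := hpow m hmn; omega)
  have hndvd : ¬ Φ (2 * n) ∣ X 1 * (manesIter n).1 + X 0 * (manesIter n).2 := by
    intro hdvd
    obtain ⟨c, hc, -, h⟩ := manesEval_iterate w n
    have := map_dvd (manesEval w) hdvd
    rw [hwΦ, zero_dvd_iff, h, ← pow_succ'] at this
    have hne := hw.pow_ne_one_of_pos_of_lt (l := 2 ^ n + 1) (by omega) (by omega)
    exact mul_ne_zero hc (sub_ne_zero.2 hne.symm) this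
  by_contra! hcon
  have h0 : Φ (2 * n) ≠ 0 := fun h => hcon 0 0 not_isUnit_zero not_isUnit_zero (by simp [h])
  have hirr : Irreducible (Φ (2 * n)) := by
    refine ⟨fun hu => (hu.map (manesEval z)).ne_zero hzΦ, fun a b hab => ?_⟩
    by_contra! h
    exact hcon a b h.1 h.2 hab
  obtain ⟨D, hD⟩ := manes_dvd n
  rw [← hΦ _ (by omega), ← Nat.cons_self_properDivisors (by omega), Finset.prod_cons] at hD
  have hdvd : Φ (2 * n) ∣ (X 1 * (manesIter n).1 + X 0 * (manesIter n).2) * D :=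
    hD ▸ (dvd_mul_right _ _).mul_left _
  obtain ⟨E, rfl⟩ := (hirr.prime.dvd_or_dvd hdvd).resolve_left hndvd
  have hE : X 1 ^ 2 ^ n * ∏ m ∈ (2 * n).properDivisors, Φ m =
      (X 1 * (manesIter n).1 + X 0 * (manesIter n).2) * E :=
    mul_left_cancel₀ h0 (by linear_combination hD)
  obtain ⟨c, -, -, h⟩ := manesEval_iterate z n
  have heval := congrArg (manesEval z) hE
  rw [map_mul, map_mul, h, hz1, sub_self, mul_zero, zero_mul, map_pow] at heval
  have hY : manesEval z (X 1) = 1 - z := by simp [manesEval]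
  rw [hY] at heval
  have hz_ne : z ≠ 1 := hz.ne_one (by omega)
  exact mul_ne_zero (pow_ne_zero _ (sub_ne_zero.2 hz_ne.symm)) hzO heval
end
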